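/- Let d≥3 be an integer, W=ℝ^{d+1}, D=binom(d+1,2). Let G=(V,E) be a finite multigraph and {B,R} a partition of V. Then the following are equivalent: (1) there exist a rod-configuration r on R (each r_v∈⋀^{d−1}W nonzero decomposable, pairwise non-proportional) and vectors a_e,b_e∈W for each e∈E with q_e := a_e∧b_e ≠ 0 and q_e∧r_w = 0 for every endpoint w∈R of e, such that the body-rod-bar framework is minimally infinitesimally rigid, meaning: the space of maps m:V→⋀^{d−1}W satisfying q_e∧(m(u)−m(v)) = 0 in ⋀^{d+1}W for every edge e with endpoints u,v has dimension exactly D+|R|, while for each e₀∈E the space of maps satisfying these constraints for all edges except e₀ has dimension at least D+|R|+1; (2) |E| = D|B| + (D−1)|R| − D and |F| ≤ D|B(F)| + (D−1)|R(F)| − D for every nonempty F⊆E, where B(F)=V(F)∩B and R(F)=V(F)∩R. -/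

import Mathlib

/- STATEMENT 3: existence of a minimally infinitesimally rigid body-rod-bar realization is
equivalent to the count condition `|E| = D|B| + (D-1)|R| - D` together with
`|F| ≤ D|B(F)| + (D-1)|R(F)| - D` for all nonempty `F ⊆ E`. -/

set_option synthInstance.maxHeartbeats 1000000
set_option maxHeartbeats 1000000

open ExteriorAlgebra

/-- `W = ℝ^{d+1}`. -/
abbrev Wd (d : ℕ) : Type := Fin (d + 1) → ℝ

/-- The exterior algebra of `W = ℝ^{d+1}`; the exterior powers `⋀^k W` are realized as
the degree-`k` homogeneous submodules of this algebra, and the exterior product is the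
algebra multiplication. -/
abbrev ExtAlg (d : ℕ) : Type := ExteriorAlgebra ℝ (Wd d)

/-- The degree-`k` homogeneous part `⋀^k W` of the exterior algebra. -/
noncomputable def extGrade (d k : ℕ) : Submodule ℝ (ExtAlg d) :=
  (LinearMap.range (ι ℝ : Wd d →ₗ[ℝ] ExtAlg d)) ^ k

/-- `x` is a decomposable element of `⋀^k W`, i.e. `x = w₁ ∧ ⋯ ∧ w_k`. -/
def IsDecomp (d k : ℕ) (x : ExtAlg d) : Prop :=
  ∃ w : Fin k → Wd d, x = (List.ofFn fun i => ι ℝ (w i)).prod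

/-- The set `V(F)` of vertices spanned by an edge set `F`. -/
def VF {V E : Type} [DecidableEq V] (ends : E → V × V) (F : Finset E) : Finset V :=
  F.image (fun e => (ends e).1) ∪ F.image (fun e => (ends e).2)

/-- The space of infinitesimal motions `m : V → ⋀^{d-1}W` satisfying the bar constraints
`q_e ∧ (m(u) - m(v)) = 0` for all edges `e` in a subset `E₀` of the edges. -/
noncomputable def motionSpace {V E : Type} [DecidableEq V] (d : ℕ) (ends : E → V × V)
    (q : E → ExtAlg d) (E₀ : Set E) : Submodule ℝ (V → ExtAlg d) :=
  (⨅ v : V, (extGrade d (d - 1)).comap (LinearMap.proj v : (V → ExtAlg d) →ₗ[ℝ] ExtAlg d)) ⊓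
  (⨅ e ∈ E₀, LinearMap.ker ((LinearMap.mulLeft ℝ (q e)).comp
      ((LinearMap.proj (ends e).1 : (V → ExtAlg d) →ₗ[ℝ] ExtAlg d)
        - LinearMap.proj (ends e).2)))


namespace BRB
open Module Submodule

theorem prop_lemma {U Z : Type*} [AddCommGroup U] [Module ℝ U] [AddCommGroup Z] [Module ℝ Z]
    (f g : U →ₗ[ℝ] Z) (h : ∀ a, f a ∈ span ℝ {g a}) : ∃ l : ℝ, f = l • g := by
  by_cases h0 : ∀ a, g a = 0
  · refine ⟨0, ?_⟩
    ext a
    have := h a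
    rw [h0 a] at this
    simpa using this
  push Not at h0
  obtain ⟨a, ha⟩ := h0
  obtain ⟨l, hl⟩ := mem_span_singleton.1 (h a)
  refine ⟨l, ?_⟩
  ext b
  obtain ⟨l', hl'⟩ := mem_span_singleton.1 (h b)
  simp only [LinearMap.smul_apply]
  by_cases hb : g b ∈ span ℝ {g a}
  · obtain ⟨c, hc⟩ := mem_span_singleton.1 hb
    have h1 := h (b - c • a)
    have h2 : g (b - c • a) = 0 := by simp [hc]
    rw [h2] at h1
    have h3 : f (b - c • a) = 0 := by simpa using h1
    rw [map_sub, map_smul, sub_eq_zero] at h3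
    rw [h3, ← hl, ← hc, smul_comm]
  · obtain ⟨μ, hμ⟩ := mem_span_singleton.1 (h (a + b))
    have e : (l' - μ) • g b = (μ - l) • g a := by
      rw [map_add, map_add, ← hl, ← hl', smul_add] at hμ
      rw [sub_smul, sub_smul, sub_eq_sub_iff_add_eq_add, hμ, add_comm]
    have hl'μ : l' - μ = 0 := by
      by_contra hne
      apply hb
      refine mem_span_singleton.2 ⟨(l' - μ)⁻¹ * (μ - l), ?_⟩
      rw [mul_smul, ← e, smul_smul, inv_mul_cancel₀ hne, one_smul]
    rw [hl'μ, zero_smul] at e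
    have : μ - l = 0 := by
      rcases smul_eq_zero.1 e.symm with h | h
      · exact h
      · exact absurd h ha
    rw [← hl']
    congr 1
    linarith

theorem rado {X E : Type*} [AddCommGroup X] [Module ℝ X] [FiniteDimensional ℝ X] [DecidableEq E]
    (S : E → Set X) : ∀ (n : ℕ) (A : Finset E) (_ : A.card = n) (U : Submodule ℝ X)
    (_ : ∀ F ⊆ A, finrank ℝ U + F.card ≤ finrank ℝ ↥(U ⊔ span ℝ (⋃ e ∈ F, S e))),
    ∃ x : E → X, (∀ e ∈ A, x e ∈ S e) ∧
      finrank ℝ U + A.card ≤ finrank ℝ ↥(U ⊔ span ℝ (x '' A)) := by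
  intro n
  induction n using Nat.strong_induction_on with
  | _ n ih =>
  intro A hA U hU
  rcases A.eq_empty_or_nonempty with rfl | ⟨e0, he0⟩
  · exact ⟨fun _ => 0, by simp, by simpa using finrank_mono le_sup_left⟩
  by_cases ht : ∃ F ⊆ A, F.Nonempty ∧ F ≠ A ∧
      finrank ℝ ↥(U ⊔ span ℝ (⋃ e ∈ F, S e)) = finrank ℝ U + F.card
  · obtain ⟨F, hFA, hFn, hFne, hF⟩ := ht
    have hss : F ⊂ A := Finset.ssubset_iff_subset_ne.2 ⟨hFA, hFne⟩
    obtain ⟨x, hx, hxr⟩ := ih F.card (hA ▸ Finset.card_lt_card hss) F rfl U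
      (fun F' hF' => hU F' (hF'.trans hFA))
    have hle : U ⊔ span ℝ (x '' F) ≤ U ⊔ span ℝ (⋃ e ∈ F, S e) := by
      apply sup_le_sup_left
      apply span_mono
      rintro _ ⟨e, he, rfl⟩
      simp only [Set.mem_iUnion]
      exact ⟨e, he, hx e he⟩
    have heq : U ⊔ span ℝ (x '' F) = U ⊔ span ℝ (⋃ e ∈ F, S e) :=
      eq_of_le_of_finrank_le hle (by omega)
    have hc : (A \ F).card < n := by
      rw [← hA]; apply Finset.card_lt_card
      exact Finset.sdiff_ssubset hFA hFn
    obtain ⟨y, hy, hyr⟩ := ih _ hc (A \ F) rfl (U ⊔ span ℝ (x '' F)) (by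
      intro F' hF'
      have h1 := hU (F ∪ F') (Finset.union_subset hFA (hF'.trans Finset.sdiff_subset))
      have hd : Disjoint F F' := by
        rw [Finset.disjoint_left]; intro a ha ha'
        exact (Finset.mem_sdiff.1 (hF' ha')).2 ha
      rw [Finset.card_union_of_disjoint hd] at h1
      rw [heq, sup_assoc, ← span_union]
      have : (⋃ e ∈ F ∪ F', S e) = (⋃ e ∈ F, S e) ∪ (⋃ e ∈ F', S e) := by
        ext z; simp only [Set.mem_iUnion, Finset.mem_union, Set.mem_union]
        constructor
        · rintro ⟨i, h | h, hz⟩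
          · exact Or.inl ⟨i, h, hz⟩
          · exact Or.inr ⟨i, h, hz⟩
        · rintro (⟨i, h, hz⟩ | ⟨i, h, hz⟩)
          · exact ⟨i, Or.inl h, hz⟩
          · exact ⟨i, Or.inr h, hz⟩
      rw [this] at h1
      omega)
    refine ⟨fun e => if e ∈ F then x e else y e, ?_, ?_⟩
    · intro e he
      by_cases h : e ∈ F
      · simp only [h, if_true]; exact hx e h
      · simp only [h, if_false]; exact hy e (Finset.mem_sdiff.2 ⟨he, h⟩)
    · have h2 : (fun e => if e ∈ F then x e else y e) '' (A : Set E)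
          = x '' F ∪ y '' (A \ F : Finset E) := by
        ext z
        simp only [Set.mem_image, Set.mem_union, Finset.mem_coe, Finset.mem_sdiff]
        constructor
        · rintro ⟨e, he, rfl⟩
          by_cases h : e ∈ F
          · exact Or.inl ⟨e, h, by simp [h]⟩
          · exact Or.inr ⟨e, ⟨he, h⟩, by simp [h]⟩
        · rintro (⟨e, h, rfl⟩ | ⟨e, ⟨h, h'⟩, rfl⟩)
          · exact ⟨e, hFA h, by simp [h]⟩
          · exact ⟨e, h, by simp [h']⟩
      rw [h2, span_union, ← sup_assoc]
      have := Finset.card_sdiff_add_card_eq_card hFA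
      omega
  · push Not at ht
    have h1 := hU {e0} (by simpa using he0)
    have : ∃ x ∈ S e0, x ∉ U := by
      by_contra hcon
      push Not at hcon
      have h3 : U ⊔ span ℝ (⋃ e ∈ ({e0} : Finset E), S e) = U := by
        rw [sup_eq_left, span_le]
        intro z hz
        simp only [Finset.mem_singleton, Set.iUnion_iUnion_eq_left] at hz
        exact hcon z hz
      rw [h3] at h1
      simp at h1
    obtain ⟨x0, hx0, hx0U⟩ := this
    have hlt : U < U ⊔ span ℝ {x0} := by
      refine lt_of_le_of_ne le_sup_left ?_
      intro h
      apply hx0U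
      rw [h]
      exact mem_sup_right (mem_span_singleton_self x0)
    have hfr := finrank_lt_finrank_of_lt hlt
    have hfr2 : finrank ℝ ↥(U ⊔ span ℝ {x0}) ≤ finrank ℝ U + 1 := by
      refine (finrank_add_le_finrank_add_finrank _ _).trans ?_
      have := finrank_span_le_card (R := ℝ) ({x0} : Set X)
      simp at this
      omega
    obtain ⟨y, hy, hyr⟩ := ih (A.erase e0).card (by
        rw [← hA]; exact Finset.card_lt_card (Finset.erase_ssubset he0)) _ rfl (U ⊔ span ℝ {x0}) (by
      intro F hF
      rcases F.eq_empty_or_nonempty with rfl | hFn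
      · simpa using finrank_mono le_sup_left
      have hFA : F ⊆ A := hF.trans (Finset.erase_subset _ _)
      have h4 := hU F hFA
      have h5 := ht F hFA hFn (by rintro rfl; exact absurd (hF he0) (by simp))
      have h6 : finrank ℝ ↥(U ⊔ span ℝ (⋃ e ∈ F, S e)) ≤
          finrank ℝ ↥(U ⊔ span ℝ {x0} ⊔ span ℝ (⋃ e ∈ F, S e)) :=
        finrank_mono (sup_le_sup_right le_sup_left _)
      omega)
    refine ⟨fun e => if e = e0 then x0 else y e, ?_, ?_⟩
    · intro e he
      by_cases h : e = e0
      · subst h; simpa using hx0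
      · simp only [h, if_false]; exact hy e (Finset.mem_erase.2 ⟨h, he⟩)
    · have h2 : (fun e => if e = e0 then x0 else y e) '' (A : Set E)
          = {x0} ∪ y '' (A.erase e0 : Finset E) := by
        ext z
        simp only [Set.mem_image, Set.mem_union, Finset.mem_coe, Finset.mem_erase,
          Set.mem_singleton_iff]
        constructor
        · rintro ⟨e, he, rfl⟩
          by_cases h : e = e0
          · exact Or.inl (by simp [h])
          · exact Or.inr ⟨e, ⟨h, he⟩, by simp [h]⟩
        · rintro (rfl | ⟨e, ⟨h, h'⟩, rfl⟩)
          · exact ⟨e0, he0, by simp⟩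
          · exact ⟨e, h', by simp [h]⟩
      rw [h2, span_union, ← sup_assoc]
      have := Finset.card_erase_add_one he0
      omega

end BRB

namespace BRB
open Module Submodule

section comb
variable {V : Type} [DecidableEq V]

def ins {E : Type} [Fintype E] (ends : E → V × V) (X : Finset V) : Finset E :=
  Finset.univ.filter (fun e => (ends e).1 ∈ X ∧ (ends e).2 ∈ X)

def del {E : Type} [Fintype E] (ends : E → V × V) (v : V) : Finset E :=
  Finset.univ.filter (fun e => (ends e).1 = v ∨ (ends e).2 = v)

def cc (D : ℕ) (R : Finset V) (v : V) : ℤ := if v ∈ R then (D : ℤ) - 1 else D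

def fX (D : ℕ) (R : Finset V) (X : Finset V) : ℤ := ∑ v ∈ X, cc D R v - D

def Sp {E : Type} [Fintype E] (D : ℕ) (R : Finset V) (ends : E → V × V) : Prop :=
  (∀ e, (ends e).1 ≠ (ends e).2) ∧
    ∀ X : Finset V, 2 ≤ X.card → ((ins ends X).card : ℤ) ≤ fX D R X

theorem mem_ins {E : Type} [Fintype E] {ends : E → V × V} {X : Finset V} {e : E} :
    e ∈ ins ends X ↔ (ends e).1 ∈ X ∧ (ends e).2 ∈ X := by simp [ins]

theorem mem_del {E : Type} [Fintype E] {ends : E → V × V} {v : V} {e : E} :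
    e ∈ del ends v ↔ (ends e).1 = v ∨ (ends e).2 = v := by simp [del]

theorem Sp.comp {E E' : Type} [Fintype E] [Fintype E'] {D : ℕ} {R : Finset V} {ends : E → V × V}
    (h : Sp D R ends) (g : E' → E) (hg : Function.Injective g) : Sp D R (fun e => ends (g e)) := by
  refine ⟨fun e => h.1 _, fun X hX => le_trans ?_ (h.2 X hX)⟩
  rw [Nat.cast_le]
  apply Finset.card_le_card_of_injOn g
  · intro e he
    have := mem_ins.1 (Finset.mem_coe.1 he)
    exact Finset.mem_coe.2 (mem_ins.2 this)
  · exact hg.injOn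

theorem cc_le (D : ℕ) (R : Finset V) (v : V) : cc D R v ≤ D := by
  unfold cc; split_ifs <;> omega

theorem fX_mod (D : ℕ) (R X Y : Finset V) :
    fX D R (X ∪ Y) + fX D R (X ∩ Y) = fX D R X + fX D R Y := by
  unfold fX
  have := Finset.sum_union_inter (s₁ := X) (s₂ := Y) (f := cc D R)
  linarith

theorem fX_insert (D : ℕ) (R X : Finset V) (v : V) (h : v ∉ X) :
    fX D R (insert v X) = cc D R v + fX D R X := by
  unfold fX
  rw [Finset.sum_insert h]; ring

theorem pinch {E : Type} [Fintype E] [DecidableEq E] (D : ℕ) (hD : 3 < D) (R : Finset V)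
    (ends : E → V × V) (hs : Sp D R ends) (v : V) (hv : v ∉ R) (hdeg : D < (del ends v).card)
    (e : E) (he : e ∈ del ends v) :
    ∃ u w : V, u ≠ w ∧ u ≠ v ∧ w ≠ v ∧
      (∃ a, ends a = (u, v) ∨ ends a = (v, u)) ∧ (∃ a, ends a = (w, v) ∨ ends a = (v, w)) ∧
      Sp D R (Function.update ends e (u, w)) := by
  by_contra hcon
  set Γ : V → Prop := fun u => u ≠ v ∧ ∃ a, ends a = (u, v) ∨ ends a = (v, u) with hΓ
  set I : Finset V → Finset E := fun X => (ins ends X).erase e with hI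
  set T : Finset V → Prop := fun X => 2 ≤ X.card ∧ ((I X).card : ℤ) = fX D R X with hT
  have memI : ∀ X a, a ∈ I X ↔ a ≠ e ∧ (ends a).1 ∈ X ∧ (ends a).2 ∈ X := by
    intro X a; simp only [hI, Finset.mem_erase, mem_ins]
  have Ile : ∀ X, 2 ≤ X.card → ((I X).card : ℤ) ≤ fX D R X := by
    intro X hX
    refine le_trans ?_ (hs.2 X hX)
    rw [Nat.cast_le]
    exact Finset.card_le_card (Finset.erase_subset _ _)
  have Imono : ∀ X Y, X ⊆ Y → I X ⊆ I Y := by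
    intro X Y h a ha
    rw [memI] at ha ⊢
    exact ⟨ha.1, h ha.2.1, h ha.2.2⟩
  have Iinter : ∀ X Y, I X ∩ I Y = I (X ∩ Y) := by
    intro X Y
    ext a
    simp only [Finset.mem_inter, memI]
    tauto
  have Ising : ∀ u, I {u} = ∅ := by
    intro u
    ext a
    simp only [memI, Finset.mem_singleton, Finset.notMem_empty, iff_false]
    rintro ⟨-, h1, h2⟩
    exact hs.1 a (h1.trans h2.symm)
  have pair : ∀ u w, Γ u → Γ w → u ≠ w → ∃ X, T X ∧ u ∈ X ∧ w ∈ X := by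
    intro u w hu hw huw
    by_contra hno
    apply hcon
    refine ⟨u, w, huw, hu.1, hw.1, hu.2, hw.2, ?_, ?_⟩
    · intro a
      by_cases h : a = e
      · subst h; simpa using huw
      · rw [Function.update_of_ne h]; exact hs.1 a
    · intro X hX
      by_cases hm : u ∈ X ∧ w ∈ X
      · have h1 : ((I X).card : ℤ) ≠ fX D R X := fun h => hno ⟨X, ⟨hX, h⟩, hm⟩
        have h2 := Ile X hX
        have h3 : (ins (Function.update ends e (u, w)) X) ⊆ insert e (I X) := by
          intro a ha
          by_cases h : a = e
          · simp [h]
          · rw [mem_ins, Function.update_of_ne h] at ha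
            rw [Finset.mem_insert, memI]
            exact Or.inr ⟨h, ha⟩
        have h4 := (Finset.card_le_card h3).trans (Finset.card_insert_le _ _)
        omega
      · have h3 : (ins (Function.update ends e (u, w)) X) ⊆ I X := by
          intro a ha
          by_cases h : a = e
          · subst h
            rw [mem_ins, Function.update_self] at ha
            exact absurd ha hm
          · rw [mem_ins, Function.update_of_ne h] at ha
            rw [memI]
            exact ⟨h, ha⟩
        have h4 := (Finset.card_le_card h3)
        have := Ile X hX
        omega
  have un : ∀ X Y, T X → T Y → ((I (X ∩ Y)).card : ℤ) ≤ fX D R (X ∩ Y) → T (X ∪ Y) := by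
    intro X Y hX hY h
    have hc : 2 ≤ (X ∪ Y).card := hX.1.trans (Finset.card_le_card Finset.subset_union_left)
    refine ⟨hc, le_antisymm (Ile _ hc) ?_⟩
    have h1 := fX_mod D R X Y
    have h2 : I X ∪ I Y ⊆ I (X ∪ Y) :=
      Finset.union_subset (Imono _ _ Finset.subset_union_left) (Imono _ _ Finset.subset_union_right)
    have h3 := Finset.card_le_card h2
    have h4 := Finset.card_union_add_card_inter (I X) (I Y)
    rw [Iinter] at h4
    have := hX.2
    have := hY.2
    omega
  -- if the union is not tight, the intersection at a common point is a rod singleton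
  have un2 : ∀ X Y u, T X → T Y → u ∈ X → u ∈ Y → ¬ T (X ∪ Y) → X ∩ Y = {u} ∧ u ∈ R := by
    intro X Y u hX hY huX huY hn
    have hu : u ∈ X ∩ Y := Finset.mem_inter.2 ⟨huX, huY⟩
    have hn2 : ¬ ((I (X ∩ Y)).card : ℤ) ≤ fX D R (X ∩ Y) := fun h => hn (un X Y hX hY h)
    have hc : (X ∩ Y).card < 2 := by
      by_contra hc
      exact hn2 (Ile _ (by omega))
    have heq : X ∩ Y = {u} := by
      have h1 : (X ∩ Y).card = 1 := by
        have := Finset.card_pos.2 ⟨u, hu⟩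
        omega
      obtain ⟨z, hz⟩ := Finset.card_eq_one.1 h1
      rw [hz] at hu ⊢
      rw [Finset.mem_singleton.1 hu]
    refine ⟨heq, ?_⟩
    by_contra huR
    apply hn2
    rw [heq, Ising]
    simp [fX, cc, huR]
  have e_end : ∃ u, Γ u ∧ (ends e = (u, v) ∨ ends e = (v, u)) := by
    have hl := hs.1 e
    rcases mem_del.1 he with h | h
    · exact ⟨(ends e).2, ⟨fun h' => hl (h.trans h'.symm), e, Or.inr (Prod.ext h rfl)⟩,
        Or.inr (Prod.ext h rfl)⟩
    · exact ⟨(ends e).1, ⟨fun h' => hl (h'.trans h.symm), e, Or.inl (Prod.ext rfl h)⟩,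
        Or.inl (Prod.ext rfl h)⟩
  have nbr : ∀ a ∈ del ends v, ∃ u, Γ u ∧ (ends a = (u, v) ∨ ends a = (v, u)) := by
    intro a ha
    have hl := hs.1 a
    rcases mem_del.1 ha with h | h
    · exact ⟨(ends a).2, ⟨fun h' => hl (h.trans h'.symm), a, Or.inr (Prod.ext h rfl)⟩,
        Or.inr (Prod.ext h rfl)⟩
    · exact ⟨(ends a).1, ⟨fun h' => hl (h'.trans h.symm), a, Or.inl (Prod.ext rfl h)⟩,
        Or.inl (Prod.ext rfl h)⟩
  obtain ⟨u0, hu0, he0⟩ := e_end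
  -- two distinct neighbours
  have two : ∃ w, Γ w ∧ w ≠ u0 := by
    by_contra h
    push Not at h
    have h1 : del ends v ⊆ ins ends {u0, v} := by
      intro a ha
      obtain ⟨u, hu, hau⟩ := nbr a ha
      have := h u hu
      subst this
      rw [mem_ins]
      rcases hau with h | h <;> rw [h] <;> simp
    have h2 := Finset.card_le_card h1
    have h3 := hs.2 {u0, v} (by rw [Finset.card_pair hu0.1])
    rw [fX, Finset.sum_pair hu0.1] at h3
    have := cc_le D R u0
    have := cc_le D R v
    omega
  obtain ⟨w0, hw0, hwu0⟩ := two
  -- a maximal tight set with two neighbours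
  obtain ⟨X0, hX0, huX0, hwX0⟩ := pair u0 w0 hu0 hw0 hwu0.symm
  have hmax : ∃ X, (T X ∧ ∃ u w, Γ u ∧ Γ w ∧ u ≠ w ∧ u ∈ X ∧ w ∈ X) ∧
      ∀ Y, (T Y ∧ ∃ u w, Γ u ∧ Γ w ∧ u ≠ w ∧ u ∈ Y ∧ w ∈ Y) → X ⊆ Y → Y = X := by
    -- cardinalities are bounded? use edges: induct via bounded measure
    classical
    let U : Finset V := Finset.univ.image (fun a => (ends a).1) ∪ Finset.univ.image (fun a => (ends a).2)
    have hTU : ∀ X, T X → X ⊆ U := by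
      intro X hX x hx
      by_contra hxU
      have hIe : I X = I (X.erase x) := by
        ext a
        simp only [memI, Finset.mem_erase]
        constructor
        · rintro ⟨h1, h2, h3⟩
          refine ⟨h1, ⟨?_, h2⟩, ⟨?_, h3⟩⟩
          · rintro h; apply hxU; rw [← h]; simp [U]
          · rintro h; apply hxU; rw [← h]; simp [U]
        · rintro ⟨h1, h2, h3⟩
          exact ⟨h1, h2.2, h3.2⟩
      have h1 := fX_insert D R (X.erase x) x (by simp)
      rw [Finset.insert_erase hx] at h1
      have h2 := hX.2
      have h5 : cc D R x ≥ D - 1 := by unfold cc; split_ifs <;> omega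
      by_cases hc : 2 ≤ (X.erase x).card
      · have h3 := Ile _ hc
        rw [hIe] at h2
        omega
      · have h3 := hX.1
        have h4 := Finset.card_erase_add_one hx
        have h6 : (X.erase x).card = 1 := by omega
        obtain ⟨z, hz⟩ := Finset.card_eq_one.1 h6
        rw [hIe, hz, Ising] at h2
        rw [hz] at h1
        have h7 : fX D R {z} ≥ -1 := by
          simp only [fX, Finset.sum_singleton]
          have : cc D R z ≥ D - 1 := by unfold cc; split_ifs <;> omega
          omega
        simp at h2
        omega
    let A := U.powerset.filter (fun X => T X ∧ ∃ u w, Γ u ∧ Γ w ∧ u ≠ w ∧ u ∈ X ∧ w ∈ X)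
    obtain ⟨X, hX, hXm⟩ := Finset.exists_max_image A Finset.card
      ⟨X0, Finset.mem_filter.2 ⟨Finset.mem_powerset.2 (hTU _ hX0), hX0, u0, w0, hu0, hw0, hwu0.symm, huX0, hwX0⟩⟩
    refine ⟨X, (Finset.mem_filter.1 hX).2, fun Y hY hXY => ?_⟩
    exact (Finset.eq_of_subset_of_card_le hXY
      (hXm Y (Finset.mem_filter.2 ⟨Finset.mem_powerset.2 (hTU _ hY.1), hY⟩))).symm
  obtain ⟨X, ⟨hXT, u, w, hu, hw, huw, huX, hwX⟩, hXm⟩ := hmax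
  have notT : ∀ Y y, y ∈ Y → y ∉ X → ¬ T (X ∪ Y) := by
    intro Y y hyY hyX h
    have := hXm (X ∪ Y) ⟨h, u, w, hu, hw, huw, Finset.mem_union_left _ huX,
      Finset.mem_union_left _ hwX⟩ Finset.subset_union_left
    apply hyX
    rw [← this]
    exact Finset.mem_union_right _ hyY
  have hsub : ∀ y, Γ y → y ∈ X := by
    intro y hy
    by_contra hyX
    have huy : u ≠ y := fun h => hyX (h ▸ huX)
    have hwy : w ≠ y := fun h => hyX (h ▸ hwX)
    obtain ⟨Y1, hY1, huY1, hyY1⟩ := pair u y hu hy huy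
    obtain ⟨Y2, hY2, hwY2, hyY2⟩ := pair w y hw hy hwy
    obtain ⟨hi1, hr1⟩ := un2 X Y1 u hXT hY1 huX huY1 (notT Y1 y hyY1 hyX)
    obtain ⟨hi2, hr2⟩ := un2 X Y2 w hXT hY2 hwX hwY2 (notT Y2 y hyY2 hyX)
    have hn3 : ¬ T (Y1 ∪ Y2) := by
      intro h
      have h1 : ¬ T (X ∪ (Y1 ∪ Y2)) := notT (Y1 ∪ Y2) y (Finset.mem_union_left _ hyY1) hyX
      obtain ⟨h2, -⟩ := un2 X (Y1 ∪ Y2) u hXT h huX (Finset.mem_union_left _ huY1) h1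
      have : w ∈ X ∩ (Y1 ∪ Y2) := Finset.mem_inter.2 ⟨hwX, Finset.mem_union_right _ hwY2⟩
      rw [h2, Finset.mem_singleton] at this
      exact huw this.symm
    obtain ⟨hi3, hr3⟩ := un2 Y1 Y2 y hY1 hY2 hyY1 hyY2 hn3
    have d1 : Disjoint (I X) (I Y1) := by
      rw [Finset.disjoint_iff_inter_eq_empty, Iinter, hi1, Ising]
    have d2 : Disjoint (I X ∪ I Y1) (I Y2) := by
      rw [Finset.disjoint_union_left]
      constructor
      · rw [Finset.disjoint_iff_inter_eq_empty, Iinter, hi2, Ising]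
      · rw [Finset.disjoint_iff_inter_eq_empty, Iinter, hi3, Ising]
    have hsubs : (I X ∪ I Y1) ∪ I Y2 ⊆ I ((X ∪ Y1) ∪ Y2) := by
      refine Finset.union_subset (Finset.union_subset ?_ ?_) ?_
      · exact Imono _ _ (Finset.subset_union_left.trans Finset.subset_union_left)
      · exact Imono _ _ (Finset.subset_union_right.trans Finset.subset_union_left)
      · exact Imono _ _ Finset.subset_union_right
    have hc := Finset.card_le_card hsubs
    rw [Finset.card_union_of_disjoint d2, Finset.card_union_of_disjoint d1] at hc
    have hbig : 2 ≤ ((X ∪ Y1) ∪ Y2).card :=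
      hXT.1.trans (Finset.card_le_card (Finset.subset_union_left.trans Finset.subset_union_left))
    have hle := Ile _ hbig
    have m1 := fX_mod D R X Y1
    have m2 := fX_mod D R (X ∪ Y1) Y2
    have hi4 : (X ∪ Y1) ∩ Y2 = {w, y} := by
      rw [Finset.union_inter_distrib_right, hi2, hi3]; rfl
    rw [hi1] at m1
    rw [hi4] at m2
    have q1 : fX D R {u} = -1 := by simp [fX, cc, hr1]
    have q2 : fX D R {w, y} = D - 2 := by
      rw [fX, Finset.sum_pair hwy]; simp only [cc, hr2, hr3, if_true]; ring
    have := hXT.2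
    have := hY1.2
    have := hY2.2
    omega
  by_cases hvX : v ∈ X
  · have h1 := hs.2 X hXT.1
    have h2 : e ∈ ins ends X := by
      rw [mem_ins]
      rcases he0 with h | h <;> rw [h] <;> simp [hvX, hsub u0 hu0]
    have h3 := Finset.card_erase_add_one h2
    have h4 := hXT.2
    simp only [hI] at h4
    omega
  · have h1 : I X ∪ del ends v ⊆ ins ends (insert v X) := by
      intro a ha
      rw [mem_ins]
      rcases Finset.mem_union.1 ha with h | h
      · rw [memI] at h
        exact ⟨Finset.mem_insert_of_mem h.2.1, Finset.mem_insert_of_mem h.2.2⟩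
      · obtain ⟨z, hz, haz⟩ := nbr a h
        have := hsub z hz
        rcases haz with h | h <;> rw [h] <;> simp [this]
    have h2 : Disjoint (I X) (del ends v) := by
      rw [Finset.disjoint_left]
      intro a ha ha'
      rw [memI] at ha
      rw [mem_del] at ha'
      rcases ha' with h | h
      · exact hvX (h ▸ ha.2.1)
      · exact hvX (h ▸ ha.2.2)
    have h3 := Finset.card_le_card h1
    rw [Finset.card_union_of_disjoint h2] at h3
    have h4 := hs.2 (insert v X) (by rw [Finset.card_insert_of_notMem hvX]; have := hXT.1; omega)
    rw [fX_insert _ _ _ _ hvX] at h4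
    have := cc_le D R v
    have := hXT.2
    omega

end comb
end BRB

namespace BRB
open Module Submodule

section mot
variable {V : Type} [DecidableEq V] [Fintype V]
variable {K : Type} [AddCommGroup K] [Module ℝ K] [FiniteDimensional ℝ K]

def Mot {E : Type} (r : V → K) (ends : E → V × V) : Submodule ℝ (V → K) :=
  ⨅ e, (span ℝ {r (ends e).1, r (ends e).2}).comap
    ((LinearMap.proj (ends e).1 : (V → K) →ₗ[ℝ] K) - LinearMap.proj (ends e).2)

theorem mem_Mot {E : Type} {r : V → K} {ends : E → V × V} {m : V → K} :
    m ∈ Mot r ends ↔ ∀ e, m (ends e).1 - m (ends e).2 ∈ span ℝ {r (ends e).1, r (ends e).2} := by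
  simp [Mot, Submodule.mem_iInf]

def GoodOn (R S : Finset V) (r : V → K) : Prop :=
  ∀ (E : Type) [Fintype E] (ends : E → V × V), Sp (finrank ℝ K) R ends →
    (∀ e, (ends e).1 ∈ S ∧ (ends e).2 ∈ S) →
    finrank ℝ (Mot r ends) + Fintype.card E ≤ finrank ℝ K * Fintype.card V

theorem Mot_swap {E : Type} (r : V → K) (ends ends' : E → V × V)
    (h : ∀ e, ends' e = ends e ∨ ends' e = (ends e).swap) : Mot r ends' = Mot r ends := by
  ext m
  rw [mem_Mot, mem_Mot]
  apply forall_congr'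
  intro e
  rcases h e with h | h
  · rw [h]
  · rw [h]
    simp only [Prod.fst_swap, Prod.snd_swap]
    rw [Set.pair_comm, ← neg_sub, neg_mem_iff]

theorem ins_swap {E : Type} [Fintype E] (ends ends' : E → V × V)
    (h : ∀ e, ends' e = ends e ∨ ends' e = (ends e).swap) (X : Finset V) :
    ins ends' X = ins ends X := by
  ext e
  rw [mem_ins, mem_ins]
  rcases h e with h | h
  · rw [h]
  · rw [h]
    simp only [Prod.fst_swap, Prod.snd_swap]
    exact and_comm

theorem Sp_swap {E : Type} [Fintype E] {D : ℕ} {R : Finset V} {ends : E → V × V} (hs : Sp D R ends)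
    (ends' : E → V × V)
    (h : ∀ e, ends' e = ends e ∨ ends' e = (ends e).swap) : Sp D R ends' := by
  refine ⟨?_, ?_⟩
  · intro e
    have := hs.1 e
    rcases h e with h | h
    · rwa [h]
    · rw [h]
      exact this.symm
  · intro X hX
    rw [ins_swap ends ends' h]
    exact hs.2 X hX

theorem exists_orient {E : Type} [Fintype E] {D : ℕ} {R : Finset V} {ends : E → V × V}
    (hs : Sp D R ends) (v : V) : ∃ ends' : E → V × V,
      (∀ e, ends' e = ends e ∨ ends' e = (ends e).swap) ∧ ∀ e, (ends' e).1 ≠ v := by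
  refine ⟨fun e => if (ends e).1 = v then (ends e).swap else ends e, ?_, ?_⟩
  · intro e
    by_cases h : (ends e).1 = v <;> simp [h]
  · intro e
    by_cases h : (ends e).1 = v
    · simp only [h, if_true, Prod.fst_swap]
      intro h'
      exact hs.1 e (h.trans h'.symm)
    · simp only [h, if_false]
      exact h

theorem finrank_fun : finrank ℝ (V → K) = finrank ℝ K * Fintype.card V := by
  rw [Module.finrank_pi_fintype]; simp [mul_comm]

theorem card_split {E : Type} [Fintype E] [DecidableEq E] (ends : E → V × V) (v : V) :
    Fintype.card {e // e ∉ del ends v} + (del ends v).card = Fintype.card E := by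
  classical
  rw [Fintype.card_subtype_compl, Fintype.card_coe]
  have := Finset.card_le_univ (del ends v)
  omega

theorem body_lemma (hD : 3 < finrank ℝ K) (R S : Finset V) (r : V → K) (hG : GoodOn R S r)
    (v : V) (hvR : v ∉ R) (hvS : v ∉ S) (hr : ∀ u, u ∉ R → r u = 0)
    (hNP : ∀ u ∈ S, ∀ w ∈ S, u ≠ w → Disjoint (span ℝ {r u}) (span ℝ {r w})) :
    GoodOn R (insert v S) r := by
  classical
  intro E _ ends
  generalize hn : (del ends v).card = n
  induction n using Nat.strong_induction_on generalizing ends with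
  | _ n ih =>
  intro hs hE
  by_cases hdeg : finrank ℝ K < (del ends v).card
  · obtain ⟨e, he⟩ : (del ends v).Nonempty := Finset.card_pos.1 (by omega)
    obtain ⟨u, w, huw, huv, hwv, ⟨a, ha⟩, ⟨b, hb⟩, hs'⟩ := pinch _ hD R ends hs v hvR hdeg e he
    have hlt : (del (Function.update ends e (u, w)) v).card < n := by
      rw [← hn]
      apply Finset.card_lt_card
      refine Finset.ssubset_iff_subset_ne.2 ⟨?_, ?_⟩
      · intro x hx
        by_cases h : x = e
        · rw [h]; exact he
        · rw [mem_del, Function.update_of_ne h] at hx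
          exact mem_del.2 hx
      · intro h
        rw [← h, mem_del, Function.update_self] at he
        rcases he with h | h
        · exact huv h
        · exact hwv h
    have huS : u ∈ insert v S := by
      have := hE a
      rcases ha with h | h <;> rw [h] at this
      · exact this.1
      · exact this.2
    have hwS : w ∈ insert v S := by
      have := hE b
      rcases hb with h | h <;> rw [h] at this
      · exact this.1
      · exact this.2
    have := ih _ hlt (Function.update ends e (u, w)) rfl hs' (by
      intro x
      by_cases h : x = e
      · subst h; rw [Function.update_self]; exact ⟨huS, hwS⟩
      · rw [Function.update_of_ne h]; exact hE x)
    refine le_trans ?_ this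
    gcongr
    apply finrank_mono
    intro m hm
    rw [mem_Mot] at hm ⊢
    have key : ∀ z, (∃ a, ends a = (z, v) ∨ ends a = (v, z)) → m z - m v ∈ span ℝ {r z} := by
      rintro z ⟨a, ha⟩
      have := hm a
      rcases ha with h | h <;> rw [h] at this <;> simp only [hr v hvR] at this
      · rwa [Set.pair_comm, span_insert_zero] at this
      · rw [span_insert_zero] at this
        rwa [← neg_sub, neg_mem_iff]
    intro x
    by_cases h : x = e
    · subst h
      rw [Function.update_self]
      simp only
      have h1 := span_mono (R := ℝ) (show {r u} ⊆ ({r u, r w} : Set K) by simp) (key u ⟨a, ha⟩)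
      have h2 := span_mono (R := ℝ) (show {r w} ⊆ ({r u, r w} : Set K) by simp) (key w ⟨b, hb⟩)
      have := sub_mem h1 h2
      simpa using this
    · rw [Function.update_of_ne h]; exact hm x
  · -- low degree
    push Not at hdeg
    obtain ⟨ends', hsw, hor⟩ := exists_orient hs v
    have hs' := Sp_swap hs ends' hsw
    rw [← Mot_swap r ends ends' hsw]
    have hE' : ∀ e, (ends' e).1 ∈ insert v S ∧ (ends' e).2 ∈ insert v S := by
      intro e
      rcases hsw e with h | h <;> rw [h]
      · exact hE e
      · exact ⟨(hE e).2, (hE e).1⟩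
    have hdel : del ends' v = del ends v := by
      ext e
      rw [mem_del, mem_del]
      rcases hsw e with h | h <;> rw [h]
      simp only [Prod.fst_swap, Prod.snd_swap]
      exact or_comm
    rw [← hdel] at hdeg hn
    clear hdel
    have hcs := card_split ends' v
    have hN := hG {e // e ∉ del ends' v} (fun e => ends' e) (hs'.comp _ Subtype.val_injective) (by
      intro e
      have h1 := e.2
      rw [mem_del] at h1
      push Not at h1
      have := hE' e
      simp only [Finset.mem_insert] at this
      exact ⟨this.1.resolve_left h1.1, this.2.resolve_left h1.2⟩)
    set N := Mot r (fun e : {e // e ∉ del ends' v} => ends' e) with hNdef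
    have hPN : Mot r ends' ≤ N := by
      intro m hm
      rw [mem_Mot] at hm ⊢
      intro e
      exact hm e
    suffices finrank ℝ (Mot r ends') + (del ends' v).card ≤ finrank ℝ N by omega
    rcases (del ends' v).eq_empty_or_nonempty with h0 | ⟨e0, he0⟩
    · rw [h0]; simpa using finrank_mono hPN
    let Z : Submodule ℝ (V → K) := LinearMap.range (LinearMap.single ℝ (fun _ : V => K) v)
    have hZ : finrank ℝ Z = finrank ℝ K :=
      LinearMap.finrank_range_of_inj (Pi.single_injective (M := fun _ : V => K) v)
    have hZN : Z ≤ N := by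
      rintro _ ⟨k, rfl⟩
      rw [mem_Mot]
      intro e
      have h1 := e.2
      rw [mem_del] at h1
      push Not at h1
      simp [h1.1, h1.2]
    have hsum := finrank_sup_add_finrank_inf_eq (Mot r ends') Z
    have hle := finrank_mono (sup_le hPN hZN)
    have hv2 : ∀ e ∈ del ends' v, (ends' e).2 = v := by
      intro e he
      exact (mem_del.1 he).resolve_left (hor e)
    have hmap : ∀ e ∈ del ends' v, Mot r ends' ⊓ Z ≤
        (span ℝ {r (ends' e).1}).map (LinearMap.single ℝ (fun _ : V => K) v) := by
      rintro e he m ⟨hm, ⟨k, rfl⟩⟩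
      have := (mem_Mot.1 hm) e
      rw [hv2 e he, hr v hvR, Set.pair_comm, span_insert_zero] at this
      simp only [LinearMap.single_apply] at this
      rw [Pi.single_eq_same, Pi.single_eq_of_ne (hor e), zero_sub, neg_mem_iff] at this
      exact mem_map_of_mem this
    suffices (del ends' v).card + finrank ℝ ↥(Mot r ends' ⊓ Z) ≤ finrank ℝ K by omega
    by_cases hall : ∀ e ∈ del ends' v, (ends' e).1 = (ends' e0).1
    · have h1 : del ends' v ⊆ ins ends' {(ends' e0).1, v} := by
        intro e he
        rw [mem_ins, hall e he, hv2 e he]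
        simp
      have h2 := Finset.card_le_card h1
      have h3 := hs'.2 {(ends' e0).1, v} (by rw [Finset.card_pair (hor e0)])
      rw [fX, Finset.sum_pair (hor e0)] at h3
      have h4 : cc (finrank ℝ K) R v = finrank ℝ K := by simp [cc, hvR]
      have h5 := (finrank_mono (hmap e0 he0)).trans (finrank_map_le _ _)
      by_cases hu : (ends' e0).1 ∈ R
      · have h6 : cc (finrank ℝ K) R (ends' e0).1 = finrank ℝ K - 1 := by simp [cc, hu]
        have h7 := finrank_span_le_card (R := ℝ) ({r (ends' e0).1} : Set K)
        simp at h7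
        omega
      · have h6 : cc (finrank ℝ K) R (ends' e0).1 = finrank ℝ K := by simp [cc, hu]
        have h7 : finrank ℝ (span ℝ ({r (ends' e0).1} : Set K)) = 0 := by
          rw [hr _ hu]; simp
        omega
    · push Not at hall
      obtain ⟨e1, he1, hne⟩ := hall
      have h1 : Mot r ends' ⊓ Z = ⊥ := by
        rw [eq_bot_iff]
        intro m hm
        obtain ⟨k, hk, hkm⟩ := hmap e0 he0 hm
        obtain ⟨k', hk', hkm'⟩ := hmap e1 he1 hm
        have : k = k' := Pi.single_injective (M := fun _ : V => K) v
          (hkm.trans hkm'.symm)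
        subst this
        have hmem : ∀ e, (ends' e).1 ∈ S := fun e =>
          (Finset.mem_insert.1 (hE' e).1).resolve_left (hor e)
        have hd := hNP _ (hmem e1) _ (hmem e0) hne
        have := (disjoint_def.1 hd) k hk' hk
        rw [← hkm, this, map_zero]
        exact zero_mem _
      rw [h1, finrank_bot]
      omega

end mot
end BRB

namespace BRB
open Module Submodule

theorem tau_lemma (c1 c2 d1 d2 : ℝ) (h1 : c1 ≠ 0) (h2 : c2 ≠ 0) :
    ∃ t : ℝ, t ≠ 0 ∧ c1 + t * d1 ≠ 0 ∧ c2 + t * d2 ≠ 0 := by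
  by_contra h
  push Not at h
  have a1 := h 1 (by norm_num)
  have a2 := h 2 (by norm_num)
  have a3 := h 3 (by norm_num)
  by_cases p1 : c1 + 1 * d1 = 0
  · have b2 := a2 (by intro p; apply h1; linarith)
    have b3 := a3 (by intro p; apply h1; linarith)
    apply h2; linarith
  · have b1 := a1 p1
    by_cases p2 : c1 + 2 * d1 = 0
    · have b3 := a3 (by intro p; apply h1; linarith)
      apply h2; linarith
    · have b2 := a2 p2
      apply h2; linarith

section rod
variable {K : Type} [AddCommGroup K] [Module ℝ K] [FiniteDimensional ℝ K]

theorem dec2 (x k : K) (hk : k ≠ 0) (hx : x ∉ span ℝ {k}) :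
    ∃ f g : K →ₗ[ℝ] ℝ, ∀ y ∈ span ℝ {k, x}, y = f y • x + g y • k := by
  obtain ⟨f, hf, hf'⟩ := Submodule.exists_le_ker_of_notMem hx
  have hk' : k ∉ span ℝ {x} := by
    intro h
    obtain ⟨c, hc⟩ := mem_span_singleton.1 h
    have hc0 : c ≠ 0 := by rintro rfl; apply hk; rw [← hc, zero_smul]
    apply hx
    rw [mem_span_singleton]
    exact ⟨c⁻¹, by rw [← hc, smul_smul, inv_mul_cancel₀ hc0, one_smul]⟩
  obtain ⟨g, hg, hg'⟩ := Submodule.exists_le_ker_of_notMem hk'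
  have fk : f k = 0 := hf' (mem_span_singleton_self k)
  have gx : g x = 0 := hg' (mem_span_singleton_self x)
  refine ⟨(f x)⁻¹ • f, (g k)⁻¹ • g, ?_⟩
  intro y hy
  obtain ⟨a, b, rfl⟩ := mem_span_pair.1 hy
  simp only [LinearMap.smul_apply, map_add, map_smul, fk, gx, smul_eq_mul, mul_zero, zero_add,
    add_zero]
  rw [inv_mul_cancel₀ hf, inv_mul_cancel₀ hg, mul_one, mul_one,
    add_comm]

theorem finrank_sing_le (x : K) : finrank ℝ (span ℝ {x}) ≤ 1 := by
  have := finrank_span_le_card (R := ℝ) ({x} : Set K)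
  simpa using this

theorem count_lemma {A B : Type*} [AddCommGroup A] [Module ℝ A] [FiniteDimensional ℝ A]
    [AddCommGroup B] [Module ℝ B] [FiniteDimensional ℝ B] (Ψ : A →ₗ[ℝ] B)
    (hΨ : Function.Surjective Ψ) (Q : Submodule ℝ B) :
    finrank ℝ (Q.comap Ψ) + finrank ℝ B ≤ finrank ℝ A + finrank ℝ Q := by
  have h1 := LinearMap.finrank_range_add_finrank_ker Ψ
  rw [LinearMap.range_eq_top.2 hΨ, finrank_top] at h1
  have h2 := LinearMap.finrank_range_add_finrank_ker (Ψ.domRestrict (Q.comap Ψ))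
  have h3 : finrank ℝ (LinearMap.range (Ψ.domRestrict (Q.comap Ψ))) ≤ finrank ℝ Q := by
    apply finrank_mono
    rintro _ ⟨⟨a, ha⟩, rfl⟩
    exact ha
  have h4 : finrank ℝ (LinearMap.ker (Ψ.domRestrict (Q.comap Ψ))) ≤ finrank ℝ (LinearMap.ker Ψ) := by
    let F : LinearMap.ker (Ψ.domRestrict (Q.comap Ψ)) →ₗ[ℝ] LinearMap.ker Ψ :=
      LinearMap.codRestrict _ ((Q.comap Ψ).subtype.comp (LinearMap.ker _).subtype) (by
        rintro ⟨a, ha⟩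
        exact ha)
    apply LinearMap.finrank_le_finrank_of_injective (f := F)
    intro a b h
    have := congrArg Subtype.val h
    exact Subtype.ext (Subtype.ext this)
  omega

theorem L_lemma (hD : 3 < finrank ℝ K) (L : Submodule ℝ (K × K)) (x k2 k3 : K)
    (h2 : (k2, 0) ∈ L) (h3 : (0, k3) ∈ L) (k20 : k2 ≠ 0) (k30 : k3 ≠ 0)
    (hdis : Disjoint (span ℝ {k2}) (span ℝ {k3}))
    (hx3 : x ∉ span ℝ {k3}) (α β : ℝ) (hα : α ≠ 0) (hβ : β ≠ 0) (hαβ : (α • x, β • x) ∈ L)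
    (av1 : x ∈ L.map (LinearMap.fst ℝ K K) → L.map (LinearMap.fst ℝ K K) = ⊤)
    (av2 : x ∈ L.comap (LinearMap.inr ℝ K K) → L.comap (LinearMap.inr ℝ K K) = ⊤)
    (av3 : (∀ y, (0, y) ∈ L → y ∈ span ℝ {k3}) → (¬ ∃ b : ℝ, ∀ k, (k, b • k) ∈ L) →
      ∀ a b : ℝ, (a • x, b • x) ∈ L → a = 0 ∧ b = 0) :
    finrank ℝ K + 1 + finrank ℝ (((span ℝ {x}).prod (span ℝ {x})).comap L.subtype) ≤ finrank ℝ L := by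
  set L3 := L.comap (LinearMap.inr ℝ K K) with hL3
  have memL3 : ∀ y, y ∈ L3 ↔ (0, y) ∈ L := fun y => by simp [hL3]
  have hU : L.map (LinearMap.fst ℝ K K) = ⊤ := by
    apply av1
    refine ⟨(α⁻¹) • (α • x, β • x), L.smul_mem _ hαβ, ?_⟩
    simp [smul_smul, inv_mul_cancel₀ hα]
  have hdim : finrank ℝ L = finrank ℝ K + finrank ℝ L3 := by
    have h := LinearMap.finrank_range_add_finrank_ker ((LinearMap.fst ℝ K K).domRestrict L)
    have e1 : LinearMap.range ((LinearMap.fst ℝ K K).domRestrict L) = ⊤ := by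
      rw [← hU, LinearMap.range_domRestrict]
    rw [e1, finrank_top] at h
    have e2 : finrank ℝ (LinearMap.ker ((LinearMap.fst ℝ K K).domRestrict L)) = finrank ℝ L3 := by
      apply le_antisymm
      · let F : LinearMap.ker ((LinearMap.fst ℝ K K).domRestrict L) →ₗ[ℝ] L3 :=
          LinearMap.codRestrict _ ((LinearMap.snd ℝ K K).comp
            (L.subtype.comp (LinearMap.ker _).subtype)) (by
            rintro ⟨⟨⟨a, b⟩, ha⟩, hb⟩
            have : a = 0 := hb
            subst this
            exact (memL3 b).2 ha)
        apply LinearMap.finrank_le_finrank_of_injective (f := F)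
        rintro ⟨⟨⟨a, b⟩, ha⟩, hb⟩ ⟨⟨⟨a', b'⟩, ha'⟩, hb'⟩ h
        have q1 : a = 0 := hb
        have q2 : a' = 0 := hb'
        have q3 : b = b' := congrArg Subtype.val h
        subst q1 q2 q3
        rfl
      · let F : L3 →ₗ[ℝ] LinearMap.ker ((LinearMap.fst ℝ K K).domRestrict L) :=
          LinearMap.codRestrict _ (LinearMap.codRestrict L ((LinearMap.inr ℝ K K).comp L3.subtype)
            (by rintro ⟨y, hy⟩; exact (memL3 y).1 hy)) (by rintro ⟨y, hy⟩; rfl)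
        apply LinearMap.finrank_le_finrank_of_injective (f := F)
        rintro ⟨y, hy⟩ ⟨y', hy'⟩ h
        have := congrArg (fun z => z.1.1.2) h
        exact Subtype.ext this
    omega
  have hnot : ¬ L3 ≤ span ℝ {k3} := by
    intro hle
    have hex : ∃ b : ℝ, ∀ k, (k, b • k) ∈ L := by
      by_contra hno
      exact hα (av3 (fun y hy => hle ((memL3 y).2 hy)) hno α β hαβ).1
    obtain ⟨b, hb⟩ := hex
    have q1 : b • k2 ∈ L3 := by
      rw [memL3]
      have := L.sub_mem (hb k2) h2
      simpa using this
    have q2 : b • k2 = 0 := disjoint_def.1 hdis _ (smul_mem _ _ (mem_span_singleton_self _)) (hle q1)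
    have b0 : b = 0 := (smul_eq_zero.1 q2).resolve_right k20
    subst b0
    have q3 : β • x ∈ L3 := by
      rw [memL3]
      have := L.sub_mem hαβ (hb (α • x))
      simpa using this
    apply hx3
    have := (span ℝ {k3}).smul_mem β⁻¹ (hle q3)
    rwa [smul_smul, inv_mul_cancel₀ hβ, one_smul] at this
  have hk3 : span ℝ {k3} ≤ L3 := by
    rw [span_singleton_le_iff_mem, memL3]; exact h3
  have hlt : span ℝ {k3} < L3 := lt_of_le_not_ge hk3 hnot
  have hf := finrank_lt_finrank_of_lt hlt
  have hf1 : finrank ℝ (span ℝ {k3}) = 1 := finrank_span_singleton k30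
  set Q := ((span ℝ {x}).prod (span ℝ {x})).comap L.subtype
  have hX := finrank_sing_le x
  by_cases hxL : x ∈ L3
  · have h5 := av2 hxL
    rw [h5, finrank_top] at hdim
    have : finrank ℝ Q ≤ 2 := by
      let F : Q →ₗ[ℝ] (span ℝ {x} × span ℝ {x}) :=
        LinearMap.prod
          (LinearMap.codRestrict _ ((LinearMap.fst ℝ K K).comp (L.subtype.comp Q.subtype))
            (by rintro ⟨⟨⟨a, b⟩, ha⟩, hb⟩; exact hb.1))
          (LinearMap.codRestrict _ ((LinearMap.snd ℝ K K).comp (L.subtype.comp Q.subtype))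
            (by rintro ⟨⟨⟨a, b⟩, ha⟩, hb⟩; exact hb.2))
      have h6 := LinearMap.finrank_le_finrank_of_injective (f := F) (by
        rintro ⟨⟨⟨a, b⟩, ha⟩, hb⟩ ⟨⟨⟨a', b'⟩, ha'⟩, hb'⟩ h
        have q1 : a = a' := congrArg (fun z => (z.1 : K)) h
        have q2 : b = b' := congrArg (fun z => (z.2 : K)) h
        subst q1 q2
        rfl)
      rw [finrank_prod] at h6
      omega
    omega
  · have : finrank ℝ Q ≤ 1 := by
      let F : Q →ₗ[ℝ] (span ℝ {x}) :=
          (LinearMap.codRestrict _ ((LinearMap.fst ℝ K K).comp (L.subtype.comp Q.subtype))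
            (by rintro ⟨⟨⟨a, b⟩, ha⟩, hb⟩; exact hb.1))
      have h6 := LinearMap.finrank_le_finrank_of_injective (f := F) (by
        rintro ⟨⟨⟨a, b⟩, ha⟩, hb⟩ ⟨⟨⟨a', b'⟩, ha'⟩, hb'⟩ h
        have q1 : a = a' := congrArg Subtype.val h
        subst q1
        obtain ⟨c, hc⟩ := mem_span_singleton.1 hb.2
        obtain ⟨c', hc'⟩ := mem_span_singleton.1 hb'.2
        have hcx : c • x = b := hc
        have hcx' : c' • x = b' := hc'
        have c0 : c - c' = 0 := by
          by_contra hc0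
          apply hxL
          have : (c - c') • x ∈ L3 := by
            rw [memL3, sub_smul, hcx, hcx']
            have := L.sub_mem ha ha'
            simpa using this
          have := L3.smul_mem (c - c')⁻¹ this
          rwa [smul_smul, inv_mul_cancel₀ hc0, one_smul] at this
        rw [sub_eq_zero.1 c0, hcx'] at hcx
        subst hcx
        rfl)
      omega
    omega

end rod
end BRB

namespace BRB
open Module Submodule

section rod
variable {V : Type} [DecidableEq V] [Fintype V]
variable {K : Type} [AddCommGroup K] [Module ℝ K] [FiniteDimensional ℝ K]

def spl {E : Type} (ends : E → V × V) (v : V) (c : E → V) : E → V × V :=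
  fun e => ((ends e).1, if (ends e).2 = v then c e else (ends e).2)

theorem cc_ge (D : ℕ) (R : Finset V) (v : V) : (D : ℤ) - 1 ≤ cc D R v := by
  unfold cc; split_ifs <;> omega

theorem sum_cc_ge (D : ℕ) (R X : Finset V) : ((D : ℤ) - 1) * X.card ≤ ∑ v ∈ X, cc D R v := by
  have := Finset.card_nsmul_le_sum X (cc D R) ((D : ℤ) - 1) (fun v _ => cc_ge D R v)
  rw [nsmul_eq_mul, mul_comm] at this
  exact this

theorem spl_sparse {E J : Type} [Fintype E] [Fintype J] (D : ℕ) (hD : 3 < D) (R S : Finset V)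
    (ends : E → V × V) (hs : Sp D R ends) (v b1 b2 : V) (hvR : v ∈ R)
    (hb1R : b1 ∉ R) (hb2R : b2 ∉ R) (hb1 : b1 ∉ insert v S) (hb2 : b2 ∉ insert v S) (hvS : v ∉ S)
    (hor : ∀ e, (ends e).1 ≠ v)
    (hE : ∀ e, (ends e).1 ∈ insert v S ∧ (ends e).2 ∈ insert v S) (c : E → V)
    (hc : ∀ e, c e = b1 ∨ c e = b2) (g : J → E) (hg : ∀ j, g j ∈ del ends v)
    (hgi : Function.Injective (fun j => c (g j))) :
    Sp D R (fun s : E ⊕ J => spl ends v c (Sum.elim id g s)) ∧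
      ∀ s : E ⊕ J, (spl ends v c (Sum.elim id g s)).1 ∈ insert b1 (insert b2 S) ∧
        (spl ends v c (Sum.elim id g s)).2 ∈ insert b1 (insert b2 S) := by
  have h1S : ∀ e, (ends e).1 ∈ S := fun e => (Finset.mem_insert.1 (hE e).1).resolve_left (hor e)
  have hb1v : b1 ≠ v := fun h => hb1 (by simp [h])
  have hb2v : b2 ≠ v := fun h => hb2 (by simp [h])
  have hb1S : b1 ∉ S := fun h => hb1 (by simp [h])
  have hb2S : b2 ∉ S := fun h => hb2 (by simp [h])
  have hcS : ∀ e, c e ∉ S := by intro e; rcases hc e with h | h <;> rw [h] <;> assumption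
  have hcv : ∀ e, c e ≠ v := by intro e; rcases hc e with h | h <;> rw [h] <;> assumption
  have hends : ∀ e, (spl ends v c e).1 ∈ insert b1 (insert b2 S) ∧
        (spl ends v c e).2 ∈ insert b1 (insert b2 S) := by
    intro e
    refine ⟨by simp [spl, h1S e], ?_⟩
    simp only [spl]
    split_ifs with h
    · rcases hc e with h | h <;> rw [h] <;> simp
    · have := (Finset.mem_insert.1 (hE e).2).resolve_left h
      simp [this]
  refine ⟨⟨?_, ?_⟩, fun s => hends _⟩
  · intro s
    simp only [spl]
    split_ifs with h
    · intro h'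
      exact hcS _ (h' ▸ h1S _)
    · exact hs.1 _
  · intro X hX
    set X' := X \ {b1, b2, v} with hX'
    set T := X ∩ {b1, b2} with hT
    have hmemX' : ∀ z ∈ S, z ∈ X → z ∈ X' := by
      intro z hz hzX
      simp only [hX', Finset.mem_sdiff, Finset.mem_insert, Finset.mem_singleton]
      refine ⟨hzX, ?_⟩
      rintro (h | h | h)
      · exact hb1S (h ▸ hz)
      · exact hb2S (h ▸ hz)
      · exact hvS (h ▸ hz)
    have hcard : (ins (fun s : E ⊕ J => spl ends v c (Sum.elim id g s)) X).card ≤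
        (ins (spl ends v c) X).card + T.card := by
      have : (ins (fun s : E ⊕ J => spl ends v c (Sum.elim id g s)) X) ⊆
          (ins (spl ends v c) X).disjSum (Finset.univ.filter (fun j => c (g j) ∈ T)) := by
        intro s hs
        rw [mem_ins] at hs
        rcases s with e | j
        · rw [Finset.inl_mem_disjSum, mem_ins]; exact hs
        · rw [Finset.inr_mem_disjSum]
          simp only [Finset.mem_filter, Finset.mem_univ, true_and, hT, Finset.mem_inter,
            Finset.mem_insert, Finset.mem_singleton]
          refine ⟨?_, hc _⟩
          have h2 := hs.2
          have h3 := (mem_del.1 (hg j)).resolve_left (hor _)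
          simpa [spl, h3] using h2
      refine (Finset.card_le_card this).trans ?_
      rw [Finset.card_disjSum]
      gcongr
      apply Finset.card_le_card_of_injOn (fun j => c (g j))
      · intro j hj
        simpa using hj
      · exact hgi.injOn
    rcases X'.eq_empty_or_nonempty with h0 | hne
    · have : (ins (fun s : E ⊕ J => spl ends v c (Sum.elim id g s)) X) = ∅ := by
        ext s
        simp only [Finset.notMem_empty, iff_false, mem_ins]
        rintro ⟨h, -⟩
        have := hmemX' _ (h1S _) h
        rw [h0] at this
        simp at this
      rw [this, fX]
      have := sum_cc_ge D R X
      have h5 : ((D : ℤ) - 1) * 2 ≤ ((D : ℤ) - 1) * X.card := by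
        apply mul_le_mul_of_nonneg_left
        · exact_mod_cast hX
        · omega
      simp only [Finset.card_empty]
      push_cast
      linarith
    · rcases T.eq_empty_or_nonempty with hT0 | hTne
      · rw [hT0, Finset.card_empty, add_zero] at hcard
        have h1 : ins (spl ends v c) X ⊆ ins ends X := by
          intro e he
          rw [mem_ins] at he ⊢
          refine ⟨he.1, ?_⟩
          have h2 := he.2
          simp only [spl] at h2
          split_ifs at h2 with h
          · exfalso
            have : c e ∈ T := by
              simp only [hT, Finset.mem_inter, Finset.mem_insert, Finset.mem_singleton]
              exact ⟨h2, hc e⟩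
            rw [hT0] at this
            simp at this
          · exact h2
        have := hs.2 X hX
        have := Finset.card_le_card h1
        omega
      · have hvX' : v ∉ X' := by simp [hX']
        have h1 : ins (spl ends v c) X ⊆ ins ends (insert v X') := by
          intro e he
          rw [mem_ins] at he ⊢
          refine ⟨Finset.mem_insert_of_mem (hmemX' _ (h1S e) he.1), ?_⟩
          have h2 := he.2
          simp only [spl] at h2
          split_ifs at h2 with h
          · simp [h]
          · refine Finset.mem_insert_of_mem (hmemX' _ ?_ h2)
            exact (Finset.mem_insert.1 (hE e).2).resolve_left h
        have h2 := Finset.card_le_card h1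
        have h3 := hs.2 (insert v X') (by
          rw [Finset.card_insert_of_notMem hvX']
          have := Finset.card_pos.2 hne
          omega)
        rw [fX_insert _ _ _ _ hvX'] at h3
        have h4 : cc D R v = D - 1 := by simp [cc, hvR]
        have hdis : Disjoint X' T := by
          rw [Finset.disjoint_left]
          intro z hz hz'
          simp only [hX', hT, Finset.mem_sdiff, Finset.mem_inter, Finset.mem_insert,
            Finset.mem_singleton] at hz hz'
          tauto
        have hsub : X' ∪ T ⊆ X :=
          Finset.union_subset Finset.sdiff_subset Finset.inter_subset_left
        have h5 : ∑ z ∈ X' ∪ T, cc D R z ≤ ∑ z ∈ X, cc D R z := by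
          apply Finset.sum_le_sum_of_subset_of_nonneg hsub
          intro i _ _
          have := cc_ge D R i
          omega
        rw [Finset.sum_union hdis] at h5
        have h6 : ∑ z ∈ T, cc D R z = T.card * D := by
          rw [Finset.sum_congr rfl (g := fun _ => (D : ℤ))]
          · simp
          · intro z hz
            simp only [hT, Finset.mem_inter, Finset.mem_insert, Finset.mem_singleton] at hz
            rcases hz.2 with h | h <;> rw [h] <;> simp [cc, hb1R, hb2R]
        have h7 : 1 ≤ T.card := Finset.card_pos.2 hTne
        have h8 : (0 : ℤ) ≤ ((T.card : ℤ) - 1) * (D - 1) := by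
          apply mul_nonneg <;> omega
        unfold fX at *
        have : ((ins (fun s : E ⊕ J => spl ends v c (Sum.elim id g s)) X).card : ℤ) ≤
          ((ins (spl ends v c) X).card : ℤ) + T.card := by exact_mod_cast hcard
        have : ((ins (spl ends v c) X).card : ℤ) ≤ (ins ends (insert v X')).card := by
          exact_mod_cast h2
        nlinarith

theorem Mot_par {E J : Type} (r : V → K) (ends : E → V × V) (g : J → E) :
    Mot r (fun s : E ⊕ J => ends (Sum.elim id g s)) = Mot r ends := by
  ext m
  rw [mem_Mot, mem_Mot]
  constructor
  · intro h e
    exact h (Sum.inl e)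
  · intro h s
    exact h _

/-- the edges not touching `v` -/
def Nv {E : Type} [Fintype E] (r : V → K) (ends : E → V × V) (v : V) : Submodule ℝ (V → K) :=
  Mot r (fun e : {e // e ∉ del ends v} => ends e)

def Ymap (r : V → K) (u1 u2 u3 : V) : ((V → K) × (ℝ × ℝ × ℝ)) →ₗ[ℝ] K × K :=
  LinearMap.prod
    (((LinearMap.proj u2 : (V → K) →ₗ[ℝ] K) - LinearMap.proj u1).comp (LinearMap.fst ℝ _ _)
      + ((LinearMap.toSpanSingleton ℝ K (r u2)).comp ((LinearMap.fst ℝ ℝ ℝ).comp (LinearMap.snd ℝ ℝ (ℝ × ℝ)))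
        - (LinearMap.toSpanSingleton ℝ K (r u1)).comp (LinearMap.fst ℝ ℝ (ℝ × ℝ))).comp (LinearMap.snd ℝ _ _))
    (((LinearMap.proj u3 : (V → K) →ₗ[ℝ] K) - LinearMap.proj u1).comp (LinearMap.fst ℝ _ _)
      + ((LinearMap.toSpanSingleton ℝ K (r u3)).comp ((LinearMap.snd ℝ ℝ ℝ).comp (LinearMap.snd ℝ ℝ (ℝ × ℝ)))
        - (LinearMap.toSpanSingleton ℝ K (r u1)).comp (LinearMap.fst ℝ ℝ (ℝ × ℝ))).comp (LinearMap.snd ℝ _ _))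

theorem Ymap_apply (r : V → K) (u1 u2 u3 : V) (m : V → K) (c1 c2 c3 : ℝ) :
    Ymap r u1 u2 u3 (m, c1, c2, c3) =
      (m u2 - m u1 + (c2 • r u2 - c1 • r u1), m u3 - m u1 + (c3 • r u3 - c1 • r u1)) := by
  simp [Ymap, LinearMap.toSpanSingleton]

def Lsub {E : Type} [Fintype E] (r : V → K) (ends : E → V × V) (v u1 u2 u3 : V) :
    Submodule ℝ (K × K) :=
  ((Nv r ends v).prod (⊤ : Submodule ℝ (ℝ × ℝ × ℝ))).map (Ymap r u1 u2 u3)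

def Wt {E : Type} (r : V → K) (ends : E → V × V) (v b1 b2 : V) (t : E → Bool) :
    Submodule ℝ (V → K) :=
  Mot r (spl ends v (fun e => if t e then b1 else b2))

def Yt {E : Type} (r : V → K) (ends : E → V × V) (v b1 b2 : V) (t : E → Bool) : Submodule ℝ K :=
  (Wt r ends v b1 b2 t).map ((LinearMap.proj b2 : (V → K) →ₗ[ℝ] K) - LinearMap.proj b1)

structure RodOK {E : Type} [Fintype E] (r : V → K) (ends : E → V × V) (v b1 b2 : V) (S : Finset V)
    (x : K) : Prop where
  ind : ∀ u ∈ S, x ∉ span ℝ {r u}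
  av0 : ∀ t : E → Bool, x ∈ Yt r ends v b1 b2 t → Yt r ends v b1 b2 t = ⊤
  av1 : ∀ u1 ∈ S, ∀ u2 ∈ S, ∀ u3 ∈ S, x ∈ (Lsub r ends v u1 u2 u3).map (LinearMap.fst ℝ K K) →
    (Lsub r ends v u1 u2 u3).map (LinearMap.fst ℝ K K) = ⊤
  av2 : ∀ u1 ∈ S, ∀ u2 ∈ S, ∀ u3 ∈ S, x ∈ (Lsub r ends v u1 u2 u3).comap (LinearMap.inr ℝ K K) →
    (Lsub r ends v u1 u2 u3).comap (LinearMap.inr ℝ K K) = ⊤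
  av3 : ∀ u1 ∈ S, ∀ u2 ∈ S, ∀ u3 ∈ S,
    (∀ y, (0, y) ∈ Lsub r ends v u1 u2 u3 → y ∈ span ℝ {r u3}) →
    (¬ ∃ b : ℝ, ∀ k, (k, b • k) ∈ Lsub r ends v u1 u2 u3) →
      ∀ a b : ℝ, (a • x, b • x) ∈ Lsub r ends v u1 u2 u3 → a = 0 ∧ b = 0

end rod
end BRB

namespace BRB
open Module Submodule

section rod
variable {V : Type} [DecidableEq V] [Fintype V]
variable {K : Type} [AddCommGroup K] [Module ℝ K] [FiniteDimensional ℝ K]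

theorem finrank_prod_sub_le {A B : Type*} [AddCommGroup A] [Module ℝ A] [FiniteDimensional ℝ A]
    [AddCommGroup B] [Module ℝ B] [FiniteDimensional ℝ B] (p : Submodule ℝ A) (q : Submodule ℝ B) :
    finrank ℝ (p.prod q) ≤ finrank ℝ p + finrank ℝ q := by
  rw [← finrank_prod]
  let F : p.prod q →ₗ[ℝ] p × q := LinearMap.prod
    (LinearMap.codRestrict p ((LinearMap.fst ℝ A B).comp (p.prod q).subtype) (fun z => z.2.1))
    (LinearMap.codRestrict q ((LinearMap.snd ℝ A B).comp (p.prod q).subtype) (fun z => z.2.2))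
  apply LinearMap.finrank_le_finrank_of_injective (f := F)
  rintro ⟨⟨a, b⟩, h⟩ ⟨⟨a', b'⟩, h'⟩ hh
  have q1 : a = a' := congrArg (fun z => (z.1 : A)) hh
  have q2 : b = b' := congrArg (fun z => (z.2 : B)) hh
  subst q1 q2
  rfl

theorem case3 {E : Type} [Fintype E] (hD : 3 < finrank ℝ K) (S : Finset V) (r : V → K)
    (v b1 b2 : V) (hvS : v ∉ S) (ends : E → V × V)
    (hok : RodOK r ends v b1 b2 S (r v)) (hS0 : ∀ u ∈ S, r u ≠ 0)
    (hNP : ∀ u ∈ S, ∀ w ∈ S, u ≠ w → Disjoint (span ℝ {r u}) (span ℝ {r w}))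
    (P : Submodule ℝ (V → K)) (hPN : P ≤ Nv r ends v) (u1 u2 u3 : V) (h1 : u1 ∈ S) (h2 : u2 ∈ S)
    (h3 : u3 ∈ S) (h23 : u2 ≠ u3)
    (f g : V → K →ₗ[ℝ] ℝ)
    (hfg : ∀ u, u = u1 ∨ u = u2 ∨ u = u3 → ∀ m ∈ P, m u - m v =
      f u (m u - m v) • r v + g u (m u - m v) • r u)
    (m0 : V → K) (hm0 : m0 ∈ P) (h12' : f u2 (m0 u2 - m0 v) ≠ f u1 (m0 u1 - m0 v))
    (h13' : f u3 (m0 u3 - m0 v) ≠ f u1 (m0 u1 - m0 v)) :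
    finrank ℝ P + 2 * finrank ℝ K ≤ finrank ℝ (Nv r ends v) + 3 := by
  set x := r v with hx
  set N := Nv r ends v with hN
  set L := Lsub r ends v u1 u2 u3 with hL
  have hu1v : u1 ≠ v := fun h => hvS (h ▸ h1)
  have hu2v : u2 ≠ v := fun h => hvS (h ▸ h2)
  have hu3v : u3 ≠ v := fun h => hvS (h ▸ h3)
  have memL : ∀ m ∈ N, ∀ c1 c2 c3 : ℝ,
      (m u2 - m u1 + (c2 • r u2 - c1 • r u1), m u3 - m u1 + (c3 • r u3 - c1 • r u1)) ∈ L := by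
    intro m hm c1 c2 c3
    refine ⟨(m, c1, c2, c3), ⟨hm, trivial⟩, Ymap_apply _ _ _ _ _ _ _ _⟩
  have hk2 : (r u2, 0) ∈ L := by
    have := memL 0 (zero_mem _) 0 1 0
    simpa using this
  have hk3 : (0, r u3) ∈ L := by
    have := memL 0 (zero_mem _) 0 0 1
    simpa using this
  have hYP : ∀ m ∈ P, (m u2 - m u1 + ((-g u2 (m u2 - m v)) • r u2 - (-g u1 (m u1 - m v)) • r u1),
      m u3 - m u1 + ((-g u3 (m u3 - m v)) • r u3 - (-g u1 (m u1 - m v)) • r u1)) =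
      ((f u2 (m u2 - m v) - f u1 (m u1 - m v)) • x, (f u3 (m u3 - m v) - f u1 (m u1 - m v)) • x) := by
    intro m hm
    have e1 := hfg u1 (by simp) m hm
    have e2 := hfg u2 (by simp) m hm
    have e3 := hfg u3 (by simp) m hm
    set p1 := f u1 (m u1 - m v)
    set p2 := f u2 (m u2 - m v)
    set p3 := f u3 (m u3 - m v)
    set q1 := g u1 (m u1 - m v)
    set q2 := g u2 (m u2 - m v)
    set q3 := g u3 (m u3 - m v)
    rw [sub_eq_iff_eq_add] at e1 e2 e3
    rw [e1, e2, e3, Prod.mk.injEq]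
    constructor <;> module
  have hLl := L_lemma hD L x (r u2) (r u3) hk2 hk3 (hS0 u2 h2) (hS0 u3 h3) (hNP u2 h2 u3 h3 h23)
    (hok.ind u3 h3) (f u2 (m0 u2 - m0 v) - f u1 (m0 u1 - m0 v))
    (f u3 (m0 u3 - m0 v) - f u1 (m0 u1 - m0 v)) (sub_ne_zero.2 h12') (sub_ne_zero.2 h13')
    (by rw [← hYP m0 hm0]; exact memL m0 (hPN hm0) _ _ _)
    (hok.av1 u1 h1 u2 h2 u3 h3) (hok.av2 u1 h1 u2 h2 u3 h3) (hok.av3 u1 h1 u2 h2 u3 h3)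
  let Ψ : (N × (ℝ × ℝ × ℝ)) →ₗ[ℝ] (K × L) := LinearMap.prod
    (((LinearMap.proj v : (V → K) →ₗ[ℝ] K) - LinearMap.proj u1).comp
      (N.subtype.comp (LinearMap.fst ℝ N _)) -
      (LinearMap.toSpanSingleton ℝ K (r u1)).comp ((LinearMap.fst ℝ ℝ (ℝ × ℝ)).comp (LinearMap.snd ℝ N _)))
    (LinearMap.codRestrict L ((Ymap r u1 u2 u3).comp (LinearMap.prodMap N.subtype LinearMap.id)) (by
      rintro ⟨m, c⟩
      exact ⟨(m, c), ⟨m.2, trivial⟩, rfl⟩))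
  have hΨ1 : ∀ (m : N) (c1 c2 c3 : ℝ), (Ψ (m, c1, c2, c3)).1 = m.1 v - m.1 u1 - c1 • r u1 := by
    intro m c1 c2 c3
    simp [Ψ, LinearMap.toSpanSingleton]
  have hΨ2 : ∀ (m : N) (c1 c2 c3 : ℝ), ((Ψ (m, c1, c2, c3)).2 : K × K) =
      Ymap r u1 u2 u3 (m.1, c1, c2, c3) := by
    intro m c1 c2 c3
    rfl
  have hsurj : Function.Surjective Ψ := by
    rintro ⟨k, ⟨l, hl⟩⟩
    obtain ⟨⟨m, c1, c2, c3⟩, ⟨hm, -⟩, hml⟩ := hl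
    have hup : Function.update m v (k + m u1 + c1 • r u1) ∈ N := by
      have hm' := hm
      rw [hN, Nv, mem_Mot] at *
      intro e
      have q := e.2
      rw [mem_del] at q
      push Not at q
      rw [Function.update_of_ne q.1, Function.update_of_ne q.2]
      exact (mem_Mot.1 hm) e
    refine ⟨(⟨_, hup⟩, c1, c2, c3), ?_⟩
    apply Prod.ext
    · rw [hΨ1]
      simp only [Function.update_self, Function.update_of_ne hu1v]
      abel
    · apply Subtype.ext
      refine (hΨ2 _ _ _ _).trans ?_
      change _ = l
      rw [← hml, Ymap_apply, Ymap_apply]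
      simp only [Function.update_of_ne hu1v, Function.update_of_ne hu2v, Function.update_of_ne hu3v]
  let Q : Submodule ℝ (K × L) := (span ℝ {x}).prod (((span ℝ {x}).prod (span ℝ {x})).comap L.subtype)
  have hcount := count_lemma Ψ hsurj Q
  have hQ : finrank ℝ Q ≤ 1 + finrank ℝ (((span ℝ {x}).prod (span ℝ {x})).comap L.subtype) := by
    have := finrank_prod_sub_le (span ℝ {x}) (((span ℝ {x}).prod (span ℝ {x})).comap L.subtype)
    refine le_trans this ?_
    gcongr
    exact finrank_sing_le x
  let F : P →ₗ[ℝ] Q.comap Ψ := LinearMap.codRestrict _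
    (LinearMap.prod (Submodule.inclusion hPN)
      (LinearMap.prod (-((g u1).comp (((LinearMap.proj u1 : (V → K) →ₗ[ℝ] K) - LinearMap.proj v).comp P.subtype)))
        (LinearMap.prod (-((g u2).comp (((LinearMap.proj u2 : (V → K) →ₗ[ℝ] K) - LinearMap.proj v).comp P.subtype)))
        (-((g u3).comp (((LinearMap.proj u3 : (V → K) →ₗ[ℝ] K) - LinearMap.proj v).comp P.subtype)))))) (by
    rintro ⟨m, hm⟩
    rw [mem_comap]
    refine ⟨?_, ?_⟩
    · erw [hΨ1 ⟨m, hPN hm⟩]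
      simp only [SetLike.mem_coe]
      have e1 := hfg u1 (by simp) m hm
      rw [mem_span_singleton]
      refine ⟨-f u1 (m u1 - m v), ?_⟩
      change _ = m v - m u1 - (-(g u1) (m u1 - m v)) • r u1
      set p1 := f u1 (m u1 - m v)
      set q1 := g u1 (m u1 - m v)
      rw [sub_eq_iff_eq_add] at e1
      rw [e1]; module
    · change Ymap r u1 u2 u3 (m, -g u1 (m u1 - m v), -g u2 (m u2 - m v), -g u3 (m u3 - m v)) ∈
        (span ℝ {x}).prod (span ℝ {x})
      rw [Ymap_apply, hYP m hm]
      exact ⟨smul_mem _ _ (mem_span_singleton_self _), smul_mem _ _ (mem_span_singleton_self _)⟩)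
  have hF : Function.Injective F := by
    rintro ⟨m, hm⟩ ⟨m', hm'⟩ h
    have := congrArg (fun z => (z.1.1 : V → K)) h
    exact Subtype.ext this
  have hFr := LinearMap.finrank_le_finrank_of_injective hF
  rw [finrank_prod, finrank_prod, finrank_prod, finrank_prod, finrank_self] at hcount
  omega

theorem rod_lemma {E : Type} [Fintype E] (hD : 3 < finrank ℝ K) (R S : Finset V) (r : V → K)
    (v b1 b2 : V) (hvR : v ∈ R) (hb12 : b1 ≠ b2)
    (hb1R : b1 ∉ R) (hb2R : b2 ∉ R) (hb1 : b1 ∉ insert v S) (hb2 : b2 ∉ insert v S) (hvS : v ∉ S)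
    (ends : E → V × V) (hs : Sp (finrank ℝ K) R ends)
    (hor : ∀ e, (ends e).1 ≠ v)
    (hE : ∀ e, (ends e).1 ∈ insert v S ∧ (ends e).2 ∈ insert v S)
    (hok : RodOK r ends v b1 b2 S (r v)) (hS0 : ∀ u ∈ S, r u ≠ 0)
    (hNP : ∀ u ∈ S, ∀ w ∈ S, u ≠ w → Disjoint (span ℝ {r u}) (span ℝ {r w}))
    (hdeg : (del ends v).card + 3 ≤ 2 * finrank ℝ K)
    (hG : GoodOn R (insert b1 (insert b2 S)) r) :
    finrank ℝ (Mot r ends) + Fintype.card E ≤ finrank ℝ K * Fintype.card V := by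
  classical
  set x := r v with hx
  set P := Mot r ends with hP
  have h1S : ∀ e, (ends e).1 ∈ S := fun e => (Finset.mem_insert.1 (hE e).1).resolve_left (hor e)
  have hb1v : b1 ≠ v := fun h => hb1 (by simp [h])
  have hb2v : b2 ≠ v := fun h => hb2 (by simp [h])
  have hb1S : b1 ∉ S := fun h => hb1 (by simp [h])
  have hb2S : b2 ∉ S := fun h => hb2 (by simp [h])
  have hne : ∀ e, (ends e).1 ≠ v ∧ (ends e).1 ≠ b1 ∧ (ends e).1 ≠ b2 := by
    intro e
    have := h1S e
    refine ⟨hor e, ?_, ?_⟩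
    · rintro h; exact hb1S (h ▸ this)
    · rintro h; exact hb2S (h ▸ this)
  have hne2 : ∀ e, (ends e).2 ≠ v → (ends e).2 ≠ b1 ∧ (ends e).2 ≠ b2 := by
    intro e h
    have := (Finset.mem_insert.1 (hE e).2).resolve_left h
    refine ⟨?_, ?_⟩
    · rintro h; exact hb1S (h ▸ this)
    · rintro h; exact hb2S (h ▸ this)
  have hv2 : ∀ e, e ∈ del ends v ↔ (ends e).2 = v := by
    intro e
    rw [mem_del]
    exact ⟨fun h => h.resolve_left (hor e), Or.inr⟩
  have hex : ∀ u, ∃ f g : K →ₗ[ℝ] ℝ, u ∈ S → ∀ y ∈ span ℝ {r u, x}, y = f y • x + g y • r u := by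
    intro u
    by_cases hu : u ∈ S
    · obtain ⟨f, g, h⟩ := dec2 x (r u) (hS0 u hu) (hok.ind u hu)
      exact ⟨f, g, fun _ => h⟩
    · exact ⟨0, 0, fun h => absurd h hu⟩
  choose f g hfg using hex
  let A : E → (V → K) →ₗ[ℝ] ℝ := fun e =>
    (f (ends e).1).comp ((LinearMap.proj (ends e).1 : (V → K) →ₗ[ℝ] K) - LinearMap.proj v)
  have hA : ∀ e m, A e m = f (ends e).1 (m (ends e).1 - m v) := fun e m => rfl
  have hdec : ∀ e ∈ del ends v, ∀ m ∈ P, m (ends e).1 - m v =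
      f (ends e).1 (m (ends e).1 - m v) • x + g (ends e).1 (m (ends e).1 - m v) • r (ends e).1 := by
    intro e he m hm
    apply hfg _ (h1S e)
    have := (mem_Mot.1 hm) e
    rw [(hv2 e).1 he] at this
    exact this
  have hPN : P ≤ Nv r ends v := by
    intro m hm
    rw [Nv, mem_Mot]
    intro e
    exact (mem_Mot.1 hm) e
  have hcs := card_split ends v
  by_cases hc3 : ∃ m ∈ P, ∃ e1 ∈ del ends v, ∃ e2 ∈ del ends v, ∃ e3 ∈ del ends v,
      A e1 m ≠ A e2 m ∧ A e1 m ≠ A e3 m ∧ A e2 m ≠ A e3 m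
  · obtain ⟨m0, hm0, e1, he1, e2, he2, e3, he3, h12, h13, h23⟩ := hc3
    have huu : (ends e2).1 ≠ (ends e3).1 := by
      intro h
      apply h23
      rw [hA, hA, h]
    have hfin := case3 hD S r v b1 b2 hvS ends hok hS0 hNP P hPN (ends e1).1 (ends e2).1 (ends e3).1
      (h1S _) (h1S _) (h1S _) huu f g (by
        rintro u (h | h | h) m hm
        · rw [h]; exact hdec e1 he1 m hm
        · rw [h]; exact hdec e2 he2 m hm
        · rw [h]; exact hdec e3 he3 m hm) m0 hm0 (by rw [← hA, ← hA]; exact h12.symm)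
        (by rw [← hA, ← hA]; exact h13.symm)
    have hN := hG {e // e ∉ del ends v} (fun e => ends e) (hs.comp _ Subtype.val_injective) (by
      intro e
      have h1 := e.2
      rw [hv2] at h1
      have := (Finset.mem_insert.1 (hE e).2).resolve_left h1
      simp [this, h1S])
    change finrank ℝ (Nv r ends v) + _ ≤ _ at hN
    omega
  push Not at hc3
  rcases (del ends v).eq_empty_or_nonempty with h0 | ⟨e0, he0⟩
  · refine hG E ends hs ?_
    intro e
    have h1 : e ∉ del ends v := by rw [h0]; simp
    rw [hv2] at h1
    have := (Finset.mem_insert.1 (hE e).2).resolve_left h1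
    simp [this, h1S]
  by_cases hc1 : ∀ m ∈ P, ∀ e ∈ del ends v, A e m = A e0 m
  · -- all equal
    obtain ⟨q1, q2⟩ := spl_sparse (J := Unit) (finrank ℝ K) hD R S ends hs v b1 b2 hvR hb1R hb2R hb1 hb2 hvS
      hor hE (fun _ => b1) (fun _ => Or.inl rfl) (fun _ => e0) (fun _ => he0)
      (fun _ _ _ => rfl)
    have q3 := hG _ _ q1 q2
    rw [Mot_par r (spl ends v fun _ => b1) (fun _ : Unit => e0)] at q3
    set W := Mot r (spl ends v fun _ => b1) with hW
    let M : (V → K) →ₗ[ℝ] (V → K) := LinearMap.pi (fun z => if z = v then LinearMap.proj b1 else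
      if z = b1 then LinearMap.proj v + (A e0).smulRight x else LinearMap.proj z)
    have Mv : ∀ m, M m v = m b1 := by intro m; simp [M]
    have Mb : ∀ m, M m b1 = m v + A e0 m • x := by intro m; simp [M, hb1v]
    have Mo : ∀ m z, z ≠ v → z ≠ b1 → M m z = m z := by intro m z h1 h2; simp [M, h1, h2]
    let F : P →ₗ[ℝ] W × ℝ := LinearMap.prod
      (LinearMap.codRestrict W (M.comp P.subtype) (by
        rintro ⟨m, hm⟩
        rw [mem_Mot]
        intro e
        simp only [spl, LinearMap.comp_apply, Submodule.subtype_apply]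
        rw [Mo m _ (hne e).1 (hne e).2.1]
        split_ifs with h
        · rw [Mb, ← hc1 m hm e ((hv2 e).2 h), hA]
          have := hdec e ((hv2 e).2 h) m hm
          rw [mem_span_pair]
          refine ⟨g (ends e).1 (m (ends e).1 - m v), 0, ?_⟩
          rw [zero_smul, add_zero, ← sub_sub, eq_sub_iff_add_eq, add_comm]
          exact this.symm
        · rw [Mo m _ h (hne2 e h).1]
          exact (mem_Mot.1 hm) e)) ((A e0).comp P.subtype)
    have hF : Function.Injective F := by
      rintro ⟨m, hm⟩ ⟨m', hm'⟩ h
      have t1 : M m = M m' := congrArg (fun z => (z.1 : V → K)) h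
      have t2 : A e0 m = A e0 m' := congrArg (fun z => z.2) h
      apply Subtype.ext
      funext z
      by_cases hz : z = v
      · have := congrFun t1 b1
        rw [Mb, Mb, t2] at this
        rw [hz]
        exact add_right_cancel this
      · by_cases hz' : z = b1
        · have := congrFun t1 v
          rw [Mv, Mv] at this
          rw [hz']; exact this
        · have := congrFun t1 z
          rw [Mo _ _ hz hz', Mo _ _ hz hz'] at this
          exact this
    have := LinearMap.finrank_le_finrank_of_injective hF
    rw [finrank_prod, finrank_self] at this
    rw [Fintype.card_sum] at q3
    simp at q3
    omega
  -- exactly two values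
  push Not at hc1
  obtain ⟨m0, hm0, e2, he2, hne02⟩ := hc1
  have hconst : ∀ p ∈ del ends v, ∀ q ∈ del ends v, ∀ e ∈ del ends v, A p m0 ≠ A q m0 →
      A e m0 = A p m0 → ∀ m ∈ P, A e m = A p m := by
    intro p hp q hq e he hpq hep m hm
    by_contra hcon
    obtain ⟨t, ht, t1, t2⟩ := tau_lemma (A q m0 - A p m0) (A q m0 - A e m0) (A q m - A p m)
      (A q m - A e m) (sub_ne_zero.2 hpq.symm) (by rw [hep]; exact sub_ne_zero.2 hpq.symm)
    have hmem : m0 + t • m ∈ P := P.add_mem hm0 (P.smul_mem _ hm)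
    have := hc3 _ hmem e he p hp q hq
    simp only [map_add, map_smul, smul_eq_mul] at this
    have w1 := this (by
      rw [hep]
      intro h
      exact hcon (mul_left_cancel₀ ht (add_left_cancel h))) (by
      intro h; apply t2; linear_combination -h)
    apply t1
    linear_combination -w1
  let t : E → Bool := fun e => decide (A e m0 = A e0 m0)
  have htT : ∀ e, t e = true ↔ A e m0 = A e0 m0 := by intro e; simp [t]
  have hAt : ∀ m ∈ P, ∀ e ∈ del ends v, A e m = if t e then A e0 m else A e2 m := by
    intro m hm e he
    split_ifs with h
    · rw [htT] at h
      exact hconst e0 he0 e2 he2 e he (fun h => hne02 h.symm) h m hm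
    · rw [htT] at h
      refine hconst e2 he2 e0 he0 e he hne02 ?_ m hm
      by_contra h'
      exact hne02 (hc3 m0 hm0 e he e0 he0 e2 he2 h h').symm
  have ht0 : t e0 = true := by simp [t]
  have ht2 : t e2 = false := by simp [t, hne02]
  obtain ⟨q1, q2⟩ := spl_sparse (J := Bool) (finrank ℝ K) hD R S ends hs v b1 b2 hvR hb1R hb2R hb1 hb2 hvS
    hor hE (fun e => if t e then b1 else b2) (fun e => by by_cases h : t e = true <;> simp [h])
    (fun j => if j then e0 else e2) (fun j => by cases j <;> simp [he0, he2])
    (by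
      intro i j h
      cases i <;> cases j <;> simp [ht0, ht2, hb12, hb12.symm] at h ⊢)
  have q3 := hG _ _ q1 q2
  rw [Mot_par r (spl ends v fun e => if t e then b1 else b2) (fun j : Bool => if j then e0 else e2)] at q3
  change finrank ℝ (Wt r ends v b1 b2 t) + _ ≤ _ at q3
  set W := Wt r ends v b1 b2 t with hW
  let M : (V → K) →ₗ[ℝ] (V → K) := LinearMap.pi (fun z => if z = v then LinearMap.proj b1 else
      if z = b1 then LinearMap.proj v + (A e0).smulRight x else
      if z = b2 then LinearMap.proj v + (A e2).smulRight x else LinearMap.proj z)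
  have Mv : ∀ m, M m v = m b1 := by intro m; simp [M]
  have Mb : ∀ m, M m b1 = m v + A e0 m • x := by intro m; simp [M, hb1v]
  have Mb2 : ∀ m, M m b2 = m v + A e2 m • x := by intro m; simp [M, hb2v, hb12.symm]
  have Mo : ∀ m z, z ≠ v → z ≠ b1 → z ≠ b2 → M m z = m z := by
    intro m z h1 h2 h3; simp [M, h1, h2, h3]
  have MW : ∀ m ∈ P, M m ∈ W := by
    intro m hm
    rw [hW, Wt, mem_Mot]
    intro e
    simp only [spl]
    rw [Mo m _ (hne e).1 (hne e).2.1 (hne e).2.2]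
    by_cases h : (ends e).2 = v
    · rw [if_pos h]
      have key : M m (if t e then b1 else b2) = m v + A e m • x := by
        rw [hAt m hm e ((hv2 e).2 h)]
        split_ifs
        · exact Mb m
        · exact Mb2 m
      rw [key, hA]
      have := hdec e ((hv2 e).2 h) m hm
      rw [mem_span_pair]
      refine ⟨g (ends e).1 (m (ends e).1 - m v), 0, ?_⟩
      rw [zero_smul, add_zero, ← sub_sub, eq_sub_iff_add_eq, add_comm]
      exact this.symm
    · rw [if_neg h, Mo m _ h (hne2 e h).1 (hne2 e h).2]
      exact (mem_Mot.1 hm) e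
  have htop : Yt r ends v b1 b2 t = ⊤ := by
    apply hok.av0
    have h1 : (A e2 m0 - A e0 m0) • x ∈ Yt r ends v b1 b2 t := by
      refine ⟨M m0, MW m0 hm0, ?_⟩
      simp only [LinearMap.sub_apply, LinearMap.proj_apply]
      rw [Mb, Mb2]
      module
    have := (Yt r ends v b1 b2 t).smul_mem (A e2 m0 - A e0 m0)⁻¹ h1
    rwa [smul_smul, inv_mul_cancel₀ (sub_ne_zero.2 hne02), one_smul] at this
  let y : W →ₗ[ℝ] K := ((LinearMap.proj b2 : (V → K) →ₗ[ℝ] K) - LinearMap.proj b1).comp W.subtype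
  have hy : LinearMap.range y = ⊤ := by
    rw [eq_top_iff]
    intro k _
    have : k ∈ Yt r ends v b1 b2 t := by rw [htop]; trivial
    obtain ⟨m, hm, hmk⟩ := this
    exact ⟨⟨m, hm⟩, hmk⟩
  obtain ⟨s, hsec⟩ := y.exists_rightInverse_of_surjective hy
  have hsy : ∀ k, (s k).1 b2 - (s k).1 b1 = k := fun k => LinearMap.congr_fun hsec k
  let F : P →ₗ[ℝ] W × (ℝ × ℝ) := LinearMap.prod
      (LinearMap.codRestrict W (M.comp P.subtype) (fun m => MW m.1 m.2)
        + s.comp ((LinearMap.proj b2 : (V → K) →ₗ[ℝ] K).comp P.subtype))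
      (((A e0).comp P.subtype).prod ((A e2).comp P.subtype))
  have hF : Function.Injective F := by
    rintro ⟨m, hm⟩ ⟨m', hm'⟩ h
    have t1 : M m + (s (m b2)).1 = M m' + (s (m' b2)).1 := congrArg (fun z => (z.1 : V → K)) h
    have t2 : A e0 m = A e0 m' := congrArg (fun z => z.2.1) h
    have t3 : A e2 m = A e2 m' := congrArg (fun z => z.2.2) h
    have t4 : m b2 = m' b2 := by
      have k1 := congrFun t1 b1
      have k2 := congrFun t1 b2
      simp only [Pi.add_apply] at k1 k2
      rw [Mb, Mb, t2] at k1
      rw [Mb2, Mb2, t3] at k2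
      have j1 := hsy (m b2)
      have j2 := hsy (m' b2)
      rw [← j1, ← j2]
      have l1 := congrArg₂ (fun a b => a - b) k2 k1
      have l2 : (s (m b2)).1 b2 - (s (m b2)).1 b1 + (A e2 m' • x - A e0 m' • x) =
        (s (m' b2)).1 b2 - (s (m' b2)).1 b1 + (A e2 m' • x - A e0 m' • x) := by
        convert l1 using 1 <;> abel
      exact add_right_cancel l2
    rw [t4] at t1
    have t5 : M m = M m' := add_right_cancel t1
    apply Subtype.ext
    funext z
    by_cases hz : z = v
    · have := congrFun t5 b1
      rw [Mb, Mb, t2] at this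
      rw [hz]
      exact add_right_cancel this
    · by_cases hz' : z = b1
      · have := congrFun t5 v
        rw [Mv, Mv] at this
        rw [hz']; exact this
      · by_cases hz2 : z = b2
        · rw [hz2]; exact t4
        have := congrFun t5 z
        rw [Mo _ _ hz hz' hz2, Mo _ _ hz hz' hz2] at this
        exact this
  have := LinearMap.finrank_le_finrank_of_injective hF
  rw [finrank_prod, finrank_prod, finrank_self] at this
  rw [Fintype.card_sum] at q3
  simp at q3
  omega

end rod
end BRB

namespace BRB
open Module Submodule Filter Topology

section cong
variable {V : Type} [DecidableEq V] [Fintype V]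
variable {K : Type} [AddCommGroup K] [Module ℝ K] [FiniteDimensional ℝ K]

theorem Mot_congr {E : Type} (r r' : V → K) (ends : E → V × V)
    (h : ∀ e, r (ends e).1 = r' (ends e).1 ∧ r (ends e).2 = r' (ends e).2) :
    Mot r ends = Mot r' ends := by
  ext m
  rw [mem_Mot, mem_Mot]
  apply forall_congr'
  intro e
  rw [(h e).1, (h e).2]

theorem GoodOn_congr (R S : Finset V) (r r' : V → K) (h : ∀ u ∈ S, r u = r' u)
    (hG : GoodOn R S r) : GoodOn R S r' := by
  intro E _ ends hs hE
  rw [← Mot_congr r r' ends (fun e => ⟨h _ (hE e).1, h _ (hE e).2⟩)]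
  exact hG E ends hs hE

theorem RodOK_congr {E : Type} [Fintype E] (r r' : V → K) (ends : E → V × V) (v b1 b2 : V)
    (S : Finset V) (x : K) (hvS : v ∉ S) (hb1 : b1 ≠ v) (hb2 : b2 ≠ v) (hor : ∀ e, (ends e).1 ≠ v)
    (h : ∀ u, u ≠ v → r u = r' u) (hok : RodOK r ends v b1 b2 S x) :
    RodOK r' ends v b1 b2 S x := by
  have hS : ∀ u ∈ S, r u = r' u := fun u hu => h u (fun h => hvS (h ▸ hu))
  have hN : Nv r ends v = Nv r' ends v := by
    apply Mot_congr
    intro e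
    have := e.2
    rw [mem_del] at this
    push Not at this
    exact ⟨h _ this.1, h _ this.2⟩
  have hL : ∀ u1 ∈ S, ∀ u2 ∈ S, ∀ u3 ∈ S, Lsub r ends v u1 u2 u3 = Lsub r' ends v u1 u2 u3 := by
    intro u1 h1 u2 h2 u3 h3
    have : Ymap r u1 u2 u3 = Ymap r' u1 u2 u3 := by
      unfold Ymap
      rw [hS u1 h1, hS u2 h2, hS u3 h3]
    rw [Lsub, Lsub, hN, this]
  have hY : ∀ t : E → Bool, Yt r ends v b1 b2 t = Yt r' ends v b1 b2 t := by
    intro t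
    unfold Yt Wt
    rw [Mot_congr r r']
    intro e
    simp only [spl]
    refine ⟨h _ (hor e), ?_⟩
    split_ifs with h1 h2
    · exact h _ hb1
    · exact h _ hb2
    · exact h _ h1
  constructor
  · intro u hu; rw [← hS u hu]; exact hok.ind u hu
  · intro t; rw [← hY]; exact hok.av0 t
  · intro u1 h1 u2 h2 u3 h3; rw [← hL u1 h1 u2 h2 u3 h3]; exact hok.av1 u1 h1 u2 h2 u3 h3
  · intro u1 h1 u2 h2 u3 h3; rw [← hL u1 h1 u2 h2 u3 h3]; exact hok.av2 u1 h1 u2 h2 u3 h3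
  · intro u1 h1 u2 h2 u3 h3; rw [← hL u1 h1 u2 h2 u3 h3, ← hS u3 h3]; exact hok.av3 u1 h1 u2 h2 u3 h3

theorem GoodOn_of_fin (R S : Finset V) (r : V → K)
    (h : ∀ (k : ℕ) (ends : Fin k → V × V), Sp (finrank ℝ K) R ends →
    (∀ e, (ends e).1 ∈ S ∧ (ends e).2 ∈ S) →
    finrank ℝ (Mot r ends) + k ≤ finrank ℝ K * Fintype.card V) : GoodOn R S r := by
  intro E _ ends hs hE
  let φ := Fintype.equivFin E
  have h1 := h (Fintype.card E) (fun i => ends (φ.symm i)) (hs.comp _ φ.symm.injective)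
    (fun i => hE _)
  have h2 : Mot r (fun i => ends (φ.symm i)) = Mot r ends := by
    ext m
    rw [mem_Mot, mem_Mot]
    constructor
    · intro h e
      have := h (φ e)
      rwa [φ.symm_apply_apply] at this
    · intro h i
      exact h _
  rwa [h2] at h1

theorem exists_low {k : ℕ} (D : ℕ) (hD : 3 < D) (R S : Finset V) (hSR : S ⊆ R) (ends : Fin k → V × V)
    (hs : Sp D R ends) (hE : ∀ e, (ends e).1 ∈ S ∧ (ends e).2 ∈ S) (hk : 0 < k) :
    ∃ v ∈ S, (del ends v).card + 3 ≤ 2 * D := by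
  by_contra hcon
  push Not at hcon
  have e0 : Fin k := ⟨0, hk⟩
  have hS2 : 2 ≤ S.card := by
    have : ({(ends e0).1, (ends e0).2} : Finset V) ⊆ S := by
      intro z hz
      rcases Finset.mem_insert.1 hz with h | h
      · rw [h]; exact (hE e0).1
      · rw [Finset.mem_singleton.1 h]; exact (hE e0).2
    have := Finset.card_le_card this
    rwa [Finset.card_pair (hs.1 e0)] at this
  have h1 := hs.2 S hS2
  have h2 : ins ends S = Finset.univ := by
    ext e; simp [mem_ins, hE e]
  rw [h2, Finset.card_univ, Fintype.card_fin, fX] at h1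
  have h3 : ∑ v ∈ S, cc D R v = S.card * ((D : ℤ) - 1) := by
    rw [Finset.sum_congr rfl (g := fun _ => (D : ℤ) - 1)]
    · rw [Finset.sum_const, nsmul_eq_mul]
    · intro z hz; simp [cc, hSR hz]
  rw [h3] at h1
  have h4 : ∑ v ∈ S, (del ends v).card = 2 * k := by
    have : ∀ v, (del ends v).card = ∑ e : Fin k, ((if (ends e).1 = v then 1 else 0) + (if (ends e).2 = v then 1 else 0)) := by
      intro v
      rw [del, Finset.card_filter]
      apply Finset.sum_congr rfl
      intro e _
      have := hs.1 e
      by_cases h1 : (ends e).1 = v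
      · have h2 : (ends e).2 ≠ v := fun h => this (h1.trans h.symm)
        simp [h1, h2]
      · simp [h1]
    simp_rw [this]
    rw [Finset.sum_comm]
    have : ∀ e : Fin k, ∑ v ∈ S, ((if (ends e).1 = v then 1 else 0) + (if (ends e).2 = v then 1 else 0)) = 2 := by
      intro e
      rw [Finset.sum_add_distrib, Finset.sum_ite_eq, Finset.sum_ite_eq]
      simp [hE e]
    simp_rw [this]
    simp [mul_comm]
  have h5 : S.card * (2 * D - 2) ≤ ∑ v ∈ S, (del ends v).card := by
    have := Finset.card_nsmul_le_sum S (fun v => (del ends v).card) (2 * D - 2) (by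
      intro v hv
      have := hcon v hv
      omega)
    simpa using this
  rw [h4] at h5
  have h6 : (S.card : ℤ) * (2 * D - 2) ≤ 2 * k := by
    have : ((2 * D - 2 : ℕ) : ℤ) = 2 * D - 2 := by
      rw [Nat.cast_sub (by omega)]; push_cast; ring
    rw [← this]; exact_mod_cast h5
  nlinarith

end cong

section gen
variable {V : Type} [DecidableEq V] [Fintype V]
variable {K : Type} [NormedAddCommGroup K] [NormedSpace ℝ K] [FiniteDimensional ℝ K]
variable {Θ : Type} [NormedAddCommGroup Θ] [NormedSpace ℝ Θ] [CompleteSpace Θ]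

structure Gen (γ : Θ → K) : Prop where
  cont : Continuous γ
  dense1 : ∀ U : Submodule ℝ K, U ≠ ⊤ → Dense {θ | γ θ ∉ U}
  dense2 : ∀ (k : K) (L : Submodule ℝ (K × K)), (∀ y, (0, y) ∈ L → y ∈ span ℝ {k}) →
    (¬ ∃ b : ℝ, ∀ x, (x, b • x) ∈ L) →
    Dense {θ | ∀ a b : ℝ, (a • γ θ, b • γ θ) ∈ L → a = 0 ∧ b = 0}

theorem open_avoid {γ : Θ → K} (hγ : Continuous γ) (U : Submodule ℝ K) : IsOpen {θ | γ θ ∉ U} := by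
  have : IsClosed (U : Set K) := U.closed_of_finiteDimensional
  exact (this.isOpen_compl).preimage hγ

theorem open_LI {X : Type*} [TopologicalSpace X] {n : ℕ} {Z : Type*} [NormedAddCommGroup Z] [NormedSpace ℝ Z]
    (F : X → Fin n → Z) (hF : Continuous F) : IsOpen {x | LinearIndependent ℝ (F x)} :=
  (isOpen_setOf_linearIndependent (𝕜 := ℝ) (E := Z) (ι := Fin n)).preimage hF

theorem open_avoid2 {γ : Θ → K} (hγ : Continuous γ) (L : Submodule ℝ (K × K)) :
    IsOpen {θ | ∀ a b : ℝ, (a • γ θ, b • γ θ) ∈ L → a = 0 ∧ b = 0} := by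
  let n := finrank ℝ ((K × K) ⧸ L)
  let π : (K × K) →ₗ[ℝ] (Fin n → ℝ) :=
    (Module.finBasis ℝ ((K × K) ⧸ L)).equivFun.toLinearMap.comp L.mkQ
  have hπ : ∀ z, π z = 0 ↔ z ∈ L := by
    intro z
    simp [π]
  have hc : Continuous π := LinearMap.continuous_of_finiteDimensional π
  have := open_LI (X := Θ) (Z := Fin n → ℝ) (fun θ => ![π (γ θ, 0), π (0, γ θ)]) (by
    apply continuous_pi
    intro i
    fin_cases i
    · exact hc.comp (hγ.prodMk continuous_const)
    · exact hc.comp (continuous_const.prodMk hγ))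
  convert this using 2
  ext θ
  rw [LinearIndependent.pair_iff]
  apply forall_congr'; intro a
  apply forall_congr'; intro b
  rw [← hπ, ← map_smul, ← map_smul, ← map_add]
  simp

theorem res_avoid {γ : Θ → K} (hγ : Gen γ) (U : Submodule ℝ K) :
    ∀ᶠ θ in residual Θ, γ θ ∈ U → U = ⊤ := by
  by_cases hU : U = ⊤
  · exact Eventually.of_forall (fun θ _ => hU)
  · have := residual_of_dense_open (open_avoid hγ.cont U) (hγ.dense1 U hU)
    filter_upwards [this] with θ h h'
    exact absurd h' h

theorem res_avoid2 {γ : Θ → K} (hγ : Gen γ) (k : K) (L : Submodule ℝ (K × K)) :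
    ∀ᶠ θ in residual Θ, (∀ y, (0, y) ∈ L → y ∈ span ℝ {k}) →
    (¬ ∃ b : ℝ, ∀ x, (x, b • x) ∈ L) → ∀ a b : ℝ, (a • γ θ, b • γ θ) ∈ L → a = 0 ∧ b = 0 := by
  by_cases h1 : ∀ y, (0, y) ∈ L → y ∈ span ℝ {k}
  · by_cases h2 : ¬ ∃ b : ℝ, ∀ x, (x, b • x) ∈ L
    · have := residual_of_dense_open (open_avoid2 hγ.cont L) (hγ.dense2 k L h1 h2)
      filter_upwards [this] with θ h _ _
      exact h
    · exact Eventually.of_forall (fun θ _ h => absurd h h2)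
  · exact Eventually.of_forall (fun θ h => absurd h h1)

theorem res_rod {E : Type} [Fintype E] {γ : Θ → K} (hγ : Gen γ) (hD : 3 < finrank ℝ K) (r : V → K)
    (ends : E → V × V) (v b1 b2 : V) (S : Finset V) :
    ∀ᶠ θ in residual Θ, RodOK r ends v b1 b2 S (γ θ) := by
  classical
  have h0 : ∀ᶠ θ in residual Θ, ∀ u, γ θ ∉ span ℝ {r u} := by
    rw [eventually_all]
    intro u
    filter_upwards [res_avoid hγ (span ℝ {r u})] with θ h h'
    have h1 := h h'
    have h2 := finrank_sing_le (r u)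
    rw [h1, finrank_top] at h2
    omega
  have h1 : ∀ᶠ θ in residual Θ, ∀ t : E → Bool, γ θ ∈ Yt r ends v b1 b2 t → Yt r ends v b1 b2 t = ⊤ := by
    rw [eventually_all]
    intro t
    exact res_avoid hγ _
  have h2 : ∀ᶠ θ in residual Θ, ∀ u1 u2 u3, γ θ ∈ (Lsub r ends v u1 u2 u3).map (LinearMap.fst ℝ K K) →
      (Lsub r ends v u1 u2 u3).map (LinearMap.fst ℝ K K) = ⊤ := by
    simp_rw [eventually_all]
    intro u1 u2 u3
    exact res_avoid hγ _
  have h3 : ∀ᶠ θ in residual Θ, ∀ u1 u2 u3, γ θ ∈ (Lsub r ends v u1 u2 u3).comap (LinearMap.inr ℝ K K) →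
      (Lsub r ends v u1 u2 u3).comap (LinearMap.inr ℝ K K) = ⊤ := by
    simp_rw [eventually_all]
    intro u1 u2 u3
    exact res_avoid hγ _
  have h4 : ∀ᶠ θ in residual Θ, ∀ u1 u2 u3,
      (∀ y, (0, y) ∈ Lsub r ends v u1 u2 u3 → y ∈ span ℝ {r u3}) →
      (¬ ∃ b : ℝ, ∀ k, (k, b • k) ∈ Lsub r ends v u1 u2 u3) →
      ∀ a b : ℝ, (a • γ θ, b • γ θ) ∈ Lsub r ends v u1 u2 u3 → a = 0 ∧ b = 0 := by
    rw [eventually_all]; intro u1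
    rw [eventually_all]; intro u2
    rw [eventually_all]; intro u3
    exact res_avoid2 hγ _ _
  filter_upwards [h0, h1, h2, h3, h4] with θ a0 a1 a2 a3 a4
  exact ⟨fun u _ => a0 u, a1, fun u1 _ u2 _ u3 _ => a2 u1 u2 u3, fun u1 _ u2 _ u3 _ => a3 u1 u2 u3,
    fun u1 _ u2 _ u3 _ => a4 u1 u2 u3⟩

theorem upd_dense {D : Set Θ} (hD : Dense D) {O : Set (V → Θ)} (hO : IsOpen O) {θ : V → Θ} (hθ : θ ∈ O)
    (v : V) : ∃ t ∈ D, Function.update θ v t ∈ O := by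
  have hc : Continuous (fun t : Θ => Function.update θ v t) := continuous_const.update v continuous_id
  have ho := hO.preimage hc
  obtain ⟨t, ht, ht'⟩ := hD.inter_open_nonempty _ ho ⟨θ v, by simpa using hθ⟩
  exact ⟨t, ht', ht⟩

def NP (γ : Θ → K) (R : Finset V) (θ : V → Θ) : Prop :=
  ∀ u w, u ∈ R → w ∈ R → u ≠ w → LinearIndependent ℝ ![γ (θ u), γ (θ w)]

theorem LI_of {x k : K} (hk : k ≠ 0) (hx : x ∉ span ℝ {k}) : LinearIndependent ℝ ![k, x] := by
  rw [LinearIndependent.pair_iff]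
  intro s t h
  have ht : t = 0 := by
    by_contra ht
    apply hx
    rw [mem_span_singleton]
    refine ⟨-(t⁻¹ * s), ?_⟩
    have h1 : t • x = -(s • k) := by rw [eq_neg_iff_add_eq_zero, add_comm]; exact h
    have h2 : x = t⁻¹ • (t • x) := by rw [smul_smul, inv_mul_cancel₀ ht, one_smul]
    rw [h2, h1, smul_neg, neg_smul, smul_smul]
  rw [ht, zero_smul, add_zero] at h
  exact ⟨(smul_eq_zero.1 h).resolve_right hk, ht⟩

theorem LI_disj {x k : K} (h : LinearIndependent ℝ ![k, x]) : Disjoint (span ℝ {k}) (span ℝ {x}) := by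
  rw [disjoint_def]
  intro y h1 h2
  obtain ⟨a, rfl⟩ := mem_span_singleton.1 h1
  obtain ⟨b, hb⟩ := mem_span_singleton.1 h2
  rw [LinearIndependent.pair_iff] at h
  have := h a (-b) (by rw [neg_smul, hb]; simp)
  rw [this.1, zero_smul]

theorem res_NP {γ : Θ → K} (hγ : Gen γ) (hD : 3 < finrank ℝ K) (R : Finset V) :
    ∀ᶠ θ in residual (V → Θ), NP γ R θ := by
  unfold NP
  rw [eventually_all]; intro u
  rw [eventually_all]; intro w
  by_cases huw : u = w
  · exact Eventually.of_forall (fun θ _ _ h => absurd huw h)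
  have hop : IsOpen {θ : V → Θ | LinearIndependent ℝ ![γ (θ u), γ (θ w)]} := by
    apply open_LI (X := V → Θ) (fun θ => ![γ (θ u), γ (θ w)])
    apply continuous_pi
    intro i
    fin_cases i
    · exact hγ.cont.comp (continuous_apply u)
    · exact hγ.cont.comp (continuous_apply w)
  have hde : Dense {θ : V → Θ | LinearIndependent ℝ ![γ (θ u), γ (θ w)]} := by
    rw [dense_iff_inter_open]
    rintro O hO ⟨θ0, hθ0⟩
    obtain ⟨t, ht, htO⟩ := upd_dense (hγ.dense1 ⊥ (by
      intro h
      have := finrank_bot ℝ K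
      rw [h, finrank_top] at this
      omega)) hO hθ0 u
    obtain ⟨s, hs, hsO⟩ := upd_dense (hγ.dense1 (span ℝ {γ t}) (by
      intro h
      have := finrank_sing_le (γ t)
      rw [h, finrank_top] at this
      omega)) hO htO w
    refine ⟨_, hsO, ?_⟩
    simp only [Set.mem_setOf_eq, Function.update_self]
    rw [Function.update_of_ne huw, Function.update_self]
    exact LI_of (by simpa using ht) hs
  filter_upwards [residual_of_dense_open hop hde] with θ h _ _ _
  exact h

noncomputable def rr (γ : Θ → K) (R : Finset V) (θ : V → Θ) (v : V) : K := if v ∈ R then γ (θ v) else 0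

theorem rr_cont {γ : Θ → K} (hγ : Continuous γ) (R : Finset V) (v : V) :
    Continuous (fun θ : V → Θ => rr γ R θ v) := by
  unfold rr
  split_ifs
  · exact hγ.comp (continuous_apply v)
  · exact continuous_const

noncomputable def Phi {k : ℕ} (r : V → K) (ends : Fin k → V × V) :
    ((V → K) × (Fin k → ℝ × ℝ)) →ₗ[ℝ] (Fin k → K) :=
  LinearMap.pi (fun e =>
    ((LinearMap.proj (ends e).1 : (V → K) →ₗ[ℝ] K) - LinearMap.proj (ends e).2).comp (LinearMap.fst ℝ _ _)
    - ((LinearMap.toSpanSingleton ℝ K (r (ends e).1)).comp ((LinearMap.fst ℝ ℝ ℝ).comp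
        ((LinearMap.proj e : (Fin k → ℝ × ℝ) →ₗ[ℝ] ℝ × ℝ).comp (LinearMap.snd ℝ _ _))))
    - ((LinearMap.toSpanSingleton ℝ K (r (ends e).2)).comp ((LinearMap.snd ℝ ℝ ℝ).comp
        ((LinearMap.proj e : (Fin k → ℝ × ℝ) →ₗ[ℝ] ℝ × ℝ).comp (LinearMap.snd ℝ _ _)))))

theorem Phi_apply {k : ℕ} (r : V → K) (ends : Fin k → V × V) (z : (V → K) × (Fin k → ℝ × ℝ)) (e : Fin k) :
    Phi r ends z e = z.1 (ends e).1 - z.1 (ends e).2 - (z.2 e).1 • r (ends e).1 - (z.2 e).2 • r (ends e).2 := by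
  simp [Phi, LinearMap.toSpanSingleton]

theorem Phi_dom {k : ℕ} (r : V → K) (ends : Fin k → V × V) :
    finrank ℝ (LinearMap.range (Phi r ends)) + finrank ℝ (LinearMap.ker (Phi r ends)) =
      finrank ℝ K * Fintype.card V + 2 * k := by
  rw [LinearMap.finrank_range_add_finrank_ker, finrank_prod, finrank_fun, finrank_fun]
  simp

theorem Mot_le_ker {k : ℕ} (r : V → K) (ends : Fin k → V × V) :
    finrank ℝ (Mot r ends) ≤ finrank ℝ (LinearMap.ker (Phi r ends)) := by
  have h : Mot r ends ≤ (LinearMap.ker (Phi r ends)).map (LinearMap.fst ℝ _ _) := by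
    intro m hm
    rw [mem_Mot] at hm
    have : ∀ e, ∃ ab : ℝ × ℝ, ab.1 • r (ends e).1 + ab.2 • r (ends e).2 = m (ends e).1 - m (ends e).2 := by
      intro e
      obtain ⟨a, b, h⟩ := mem_span_pair.1 (hm e)
      exact ⟨(a, b), h⟩
    choose ab hab using this
    refine ⟨(m, ab), ?_, rfl⟩
    rw [SetLike.mem_coe, LinearMap.mem_ker]
    funext e
    rw [Phi_apply, ← hab]
    simp
  exact (finrank_mono h).trans (finrank_map_le _ _)

theorem ker_le_Mot {k : ℕ} (r : V → K) (ends : Fin k → V × V)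
    (h : ∀ e, LinearIndependent ℝ ![r (ends e).1, r (ends e).2]) :
    finrank ℝ (LinearMap.ker (Phi r ends)) ≤ finrank ℝ (Mot r ends) := by
  let F : LinearMap.ker (Phi r ends) →ₗ[ℝ] Mot r ends := LinearMap.codRestrict _
    ((LinearMap.fst ℝ _ _).comp (LinearMap.ker (Phi r ends)).subtype) (by
      rintro ⟨⟨m, l⟩, hz⟩
      rw [mem_Mot]
      intro e
      have := congrFun (LinearMap.mem_ker.1 hz) e
      rw [Phi_apply] at this
      rw [mem_span_pair]
      refine ⟨(l e).1, (l e).2, ?_⟩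
      simp only [Pi.zero_apply] at this
      rw [sub_sub, sub_eq_zero] at this
      exact this.symm)
  apply LinearMap.finrank_le_finrank_of_injective (f := F)
  rintro ⟨⟨m, l⟩, hz⟩ ⟨⟨m', l'⟩, hz'⟩ hh
  have q : m = m' := congrArg Subtype.val hh
  subst q
  have : l = l' := by
    funext e
    have h1 := congrFun (LinearMap.mem_ker.1 hz) e
    have h2 := congrFun (LinearMap.mem_ker.1 hz') e
    rw [Phi_apply] at h1 h2
    simp only [Pi.zero_apply] at h1 h2
    rw [sub_sub, sub_eq_zero] at h1 h2
    have h3 := (LinearIndependent.pair_iff.1 (h e)) ((l e).1 - (l' e).1) ((l e).2 - (l' e).2) (by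
      rw [sub_smul, sub_smul, sub_add_sub_comm, ← h1, ← h2, sub_self])
    exact Prod.ext (sub_eq_zero.1 h3.1) (sub_eq_zero.1 h3.2)
  subst this
  rfl

end gen
end BRB

namespace BRB
open Module Submodule Filter Topology

section gen2
variable {V : Type} [DecidableEq V] [Fintype V]
variable {K : Type} [NormedAddCommGroup K] [NormedSpace ℝ K] [FiniteDimensional ℝ K]
variable {Θ : Type} [NormedAddCommGroup Θ] [NormedSpace ℝ Θ] [CompleteSpace Θ]

def NZ (γ : Θ → K) (R : Finset V) (θ : V → Θ) : Prop := ∀ u, u ∈ R → γ (θ u) ≠ 0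

theorem res_NZ {γ : Θ → K} (hγ : Gen γ) (hD : 3 < finrank ℝ K) (R : Finset V) :
    ∀ᶠ θ in residual (V → Θ), NZ γ R θ := by
  unfold NZ
  rw [eventually_all]; intro u
  have hop : IsOpen {θ : V → Θ | γ (θ u) ∉ (⊥ : Submodule ℝ K)} :=
    (open_avoid (Θ := Θ) hγ.cont ⊥).preimage (continuous_apply (A := fun _ : V => Θ) u)
  have hde : Dense {θ : V → Θ | γ (θ u) ∉ (⊥ : Submodule ℝ K)} := by
    rw [dense_iff_inter_open]
    rintro O hO ⟨θ0, hθ0⟩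
    obtain ⟨t, ht, htO⟩ := upd_dense (hγ.dense1 ⊥ (by
      intro h
      have := finrank_bot ℝ K
      rw [h, finrank_top] at this
      omega)) hO hθ0 u
    refine ⟨_, htO, ?_⟩
    simp only [Set.mem_setOf_eq, Function.update_self]
    exact ht
  filter_upwards [residual_of_dense_open hop hde] with θ h _
  simpa using h

theorem rr_mem (γ : Θ → K) {R : Finset V} (θ : V → Θ) {v : V} (h : v ∈ R) : rr γ R θ v = γ (θ v) := by
  simp [rr, h]

theorem rr_not (γ : Θ → K) {R : Finset V} (θ : V → Θ) {v : V} (h : v ∉ R) : rr γ R θ v = 0 := by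
  simp [rr, h]

theorem rr_disj {γ : Θ → K} {R : Finset V} {θ : V → Θ} (h : NP γ R θ) (u w : V) (huw : u ≠ w) :
    Disjoint (span ℝ {rr γ R θ u}) (span ℝ {rr γ R θ w}) := by
  by_cases hu : u ∈ R
  · by_cases hw : w ∈ R
    · rw [rr_mem γ θ hu, rr_mem γ θ hw]
      exact LI_disj (h u w hu hw huw)
    · rw [rr_not γ θ hw]; simp
  · rw [rr_not γ θ hu]; simp

theorem exists_LI_of_rank {A B : Type} [AddCommGroup A] [Module ℝ A] [AddCommGroup B] [Module ℝ B]
    [FiniteDimensional ℝ A] [FiniteDimensional ℝ B] (f : A →ₗ[ℝ] B) (n : ℕ)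
    (h : n ≤ finrank ℝ (LinearMap.range f)) :
    ∃ z : Fin n → A, LinearIndependent ℝ (fun i => f (z i)) := by
  let b := Module.finBasis ℝ (LinearMap.range f)
  have h1 : LinearIndependent ℝ (fun i : Fin n => ((b (Fin.castLE h i) : LinearMap.range f) : B)) := by
    have := b.linearIndependent.comp (Fin.castLE h) (Fin.castLE_injective h)
    exact this.map' (LinearMap.range f).subtype (by simp)
  have : ∀ i : Fin n, ∃ a, f a = (b (Fin.castLE h i) : LinearMap.range f) := fun i => (b (Fin.castLE h i)).2
  choose z hz using this
  refine ⟨z, ?_⟩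
  simpa only [hz] using h1

theorem res_step {γ : Θ → K} (hγ : Gen γ) (hD : 3 < finrank ℝ K) (R : Finset V) (b1 b2 : V)
    (hb12 : b1 ≠ b2) (hb1R : b1 ∉ R) (hb2R : b2 ∉ R) (S : Finset V) (hSR : S ⊆ R)
    (IH : ∀ v ∈ S, ∀ᶠ θ in residual (V → Θ), GoodOn R (S.erase v) (rr γ R θ))
    (k : ℕ) (hk : k ≠ 0) (ends : Fin k → V × V) (hs : Sp (finrank ℝ K) R ends)
    (hE : ∀ e, (ends e).1 ∈ S ∧ (ends e).2 ∈ S) :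
    ∀ᶠ θ in residual (V → Θ),
      finrank ℝ (Mot (rr γ R θ) ends) + k ≤ finrank ℝ K * Fintype.card V := by
  obtain ⟨v, hvS, hdeg⟩ := exists_low (finrank ℝ K) (by omega) R S hSR ends hs hE (by omega)
  set OG : Set (V → Θ) := ⋃ z : Fin (3 * k) → ((V → K) × (Fin k → ℝ × ℝ)),
    {θ | LinearIndependent ℝ (fun i => Phi (rr γ R θ) ends (z i))} with hOG
  have hop : IsOpen OG := by
    apply isOpen_iUnion
    intro z
    apply open_LI (fun θ i => Phi (rr γ R θ) ends (z i))
    apply continuous_pi; intro i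
    apply continuous_pi; intro e
    simp only [Phi_apply]
    exact (continuous_const.sub ((rr_cont hγ.cont R _).const_smul _)).sub
      ((rr_cont hγ.cont R _).const_smul _)
  have hgood : ∀ θ ∈ OG, finrank ℝ (Mot (rr γ R θ) ends) + k ≤ finrank ℝ K * Fintype.card V := by
    intro θ hθ
    obtain ⟨z, hz⟩ := Set.mem_iUnion.1 hθ
    have hz' : LinearIndependent ℝ (fun i => Phi (rr γ R θ) ends (z i)) := hz
    have h1 := Phi_dom (rr γ R θ) ends
    have h2 := Mot_le_ker (rr γ R θ) ends
    have h3 : 3 * k ≤ finrank ℝ (LinearMap.range (Phi (rr γ R θ) ends)) := by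
      have := finrank_span_eq_card hz'
      rw [Fintype.card_fin] at this
      rw [← this]
      apply finrank_mono
      rw [span_le]
      rintro _ ⟨i, rfl⟩
      exact ⟨_, rfl⟩
    omega
  have hde : Dense OG := by
    rw [dense_iff_inter_open]
    rintro O hO hne
    obtain ⟨θ1, h1O, ⟨h1G, h1NP⟩, h1NZ⟩ := (dense_of_mem_residual
      (((IH v hvS).and (res_NP hγ hD R)).and (res_NZ hγ hD R))).inter_open_nonempty O hO hne
    obtain ⟨ends', hsw, hor⟩ := exists_orient hs v
    have hs' := Sp_swap hs ends' hsw
    have hE' : ∀ e, (ends' e).1 ∈ insert v (S.erase v) ∧ (ends' e).2 ∈ insert v (S.erase v) := by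
      intro e
      rw [Finset.insert_erase hvS]
      rcases hsw e with h | h
      · rw [h]; exact hE e
      · rw [h]; exact (hE e).symm
    have hb1S : b1 ∉ S := fun h => hb1R (hSR h)
    have hb2S : b2 ∉ S := fun h => hb2R (hSR h)
    have hb1v : b1 ≠ v := fun h => hb1S (h ▸ hvS)
    have hb2v : b2 ≠ v := fun h => hb2S (h ▸ hvS)
    have hr0 : ∀ u, u ∉ R → rr γ R θ1 u = 0 := fun u hu => rr_not γ θ1 hu
    have hG2 := body_lemma hD R (S.erase v) (rr γ R θ1) h1G b2 hb2R
      (fun h => hb2S (Finset.mem_of_mem_erase h)) hr0 (fun u _ w _ h => rr_disj h1NP u w h)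
    have hG1 := body_lemma hD R _ (rr γ R θ1) hG2 b1 hb1R
      (by
        rw [Finset.mem_insert]
        rintro (h | h)
        · exact hb12 h
        · exact hb1S (Finset.mem_of_mem_erase h)) hr0 (fun u _ w _ h => rr_disj h1NP u w h)
    obtain ⟨t, ht, htO⟩ := upd_dense (dense_of_mem_residual
      (res_rod hγ hD (rr γ R θ1) ends' v b1 b2 (S.erase v))) hO h1O v
    have ht' : RodOK (rr γ R θ1) ends' v b1 b2 (S.erase v) (γ t) := ht
    set θ2 := Function.update θ1 v t with hθ2
    have hag : ∀ u, u ≠ v → rr γ R θ1 u = rr γ R θ2 u := by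
      intro u hu
      simp only [rr, hθ2, Function.update_of_ne hu]
    have hv2 : rr γ R θ2 v = γ t := by
      rw [rr_mem γ θ2 (hSR hvS), hθ2, Function.update_self]
    have hok := RodOK_congr (rr γ R θ1) (rr γ R θ2) ends' v b1 b2 (S.erase v) (γ t)
      (Finset.notMem_erase v S) hb1v hb2v hor hag ht'
    rw [← hv2] at hok
    have hG' := GoodOn_congr R _ _ (rr γ R θ2) (by
      intro u hu
      apply hag
      rintro rfl
      rcases Finset.mem_insert.1 hu with h | hu
      · exact hb1v h.symm
      rcases Finset.mem_insert.1 hu with h | hu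
      · exact hb2v h.symm
      exact Finset.notMem_erase _ _ hu) hG1
    have hne' : ∀ u ∈ S.erase v, u ≠ v := fun u hu => Finset.ne_of_mem_erase hu
    have hS0 : ∀ u ∈ S.erase v, rr γ R θ2 u ≠ 0 := by
      intro u hu
      rw [← hag u (hne' u hu), rr_mem γ θ1 (hSR (Finset.mem_of_mem_erase hu))]
      exact h1NZ u (hSR (Finset.mem_of_mem_erase hu))
    have hfin := rod_lemma hD R (S.erase v) (rr γ R θ2) v b1 b2 (hSR hvS) hb12 hb1R hb2R
      (by rwa [Finset.insert_erase hvS]) (by rwa [Finset.insert_erase hvS])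
      (Finset.notMem_erase v S) ends' hs' hor hE' hok hS0
      (by
        intro u hu w hw h
        rw [← hag u (hne' u hu), ← hag w (hne' w hw)]
        exact rr_disj h1NP u w h)
      (by
        have : del ends' v = del ends v := by
          ext e
          rw [mem_del, mem_del]
          rcases hsw e with h | h
          · rw [h]
          · rw [h]; simp only [Prod.fst_swap, Prod.snd_swap]; exact or_comm
        rwa [this]) hG'
    rw [Mot_swap _ ends ends' hsw, Fintype.card_fin] at hfin
    have hLI : ∀ u ∈ S, ∀ w ∈ S, u ≠ w → LinearIndependent ℝ ![rr γ R θ2 u, rr γ R θ2 w] := by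
      have key : ∀ u ∈ S.erase v, LinearIndependent ℝ ![rr γ R θ2 u, rr γ R θ2 v] := fun u hu =>
        LI_of (hS0 u hu) (hok.ind u hu)
      intro u hu w hw huw
      by_cases hwv : w = v
      · subst hwv
        exact key u (Finset.mem_erase.2 ⟨huw, hu⟩)
      · by_cases huv : u = v
        · subst huv
          exact LinearIndependent.pair_symm_iff.1 (key w (Finset.mem_erase.2 ⟨hwv, hw⟩))
        · rw [← hag u huv, ← hag w hwv, rr_mem γ θ1 (hSR hu), rr_mem γ θ1 (hSR hw)]
          exact h1NP u w (hSR hu) (hSR hw) huw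
    have h2 := ker_le_Mot (rr γ R θ2) ends (fun e => hLI _ (hE e).1 _ (hE e).2 (hs.1 e))
    have h1 := Phi_dom (rr γ R θ2) ends
    obtain ⟨z, hz⟩ := exists_LI_of_rank (Phi (rr γ R θ2) ends) (3 * k) (by omega)
    exact ⟨θ2, htO, Set.mem_iUnion.2 ⟨z, hz⟩⟩
  filter_upwards [residual_of_dense_open hop hde] with θ h
  exact hgood θ h

theorem res_good {γ : Θ → K} (hγ : Gen γ) (hD : 3 < finrank ℝ K) (R : Finset V) (b1 b2 : V)
    (hb12 : b1 ≠ b2) (hb1R : b1 ∉ R) (hb2R : b2 ∉ R) (n : ℕ) : ∀ S : Finset V, S.card = n → S ⊆ R →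
    ∀ᶠ θ in residual (V → Θ), GoodOn R S (rr γ R θ) := by
  induction n with
  | zero =>
    intro S hS _
    rw [Finset.card_eq_zero] at hS
    subst hS
    apply Eventually.of_forall
    intro θ E _ ends hs hE
    have : IsEmpty E := ⟨fun e => by simpa using (hE e).1⟩
    rw [Fintype.card_eq_zero, add_zero, ← finrank_fun]
    exact Submodule.finrank_le _
  | succ n ih =>
    intro S hS hSR
    have : ∀ᶠ θ in residual (V → Θ), ∀ (k : ℕ) (ends : Fin k → V × V), Sp (finrank ℝ K) R ends →
        (∀ e, (ends e).1 ∈ S ∧ (ends e).2 ∈ S) →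
        finrank ℝ (Mot (rr γ R θ) ends) + k ≤ finrank ℝ K * Fintype.card V := by
      rw [eventually_countable_forall]; intro k
      rw [eventually_countable_forall]; intro ends
      by_cases hs : Sp (finrank ℝ K) R ends
      · by_cases hE : ∀ e, (ends e).1 ∈ S ∧ (ends e).2 ∈ S
        · by_cases hk : k = 0
          · apply Eventually.of_forall
            intro θ _ _
            subst hk
            rw [add_zero, ← finrank_fun]
            exact Submodule.finrank_le _
          · filter_upwards [res_step hγ hD R b1 b2 hb12 hb1R hb2R S hSR (fun v hv => ih _ (by
              rw [Finset.card_erase_of_mem hv, hS]; rfl) ((Finset.erase_subset _ _).trans hSR)) k hk ends hs hE]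
              with θ h _ _
            exact h
        · exact Eventually.of_forall (fun θ _ h => absurd h hE)
      · exact Eventually.of_forall (fun θ h => absurd h hs)
    filter_upwards [this] with θ h
    exact GoodOn_of_fin R S _ h

theorem exists_good {γ : Θ → K} (hγ : Gen γ) (hD : 3 < finrank ℝ K) (R : Finset V) (b1 b2 : V)
    (hb12 : b1 ≠ b2) (hb1R : b1 ∉ R) (hb2R : b2 ∉ R) :
    ∃ θ : V → Θ, NP γ R θ ∧ NZ γ R θ ∧ GoodOn R Finset.univ (rr γ R θ) := by
  obtain ⟨θ, ⟨hG, hNP⟩, hNZ⟩ := (dense_of_mem_residual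
      (((res_good hγ hD R b1 b2 hb12 hb1R hb2R _ R rfl (Finset.Subset.refl _)).and
        (res_NP hγ hD R)).and (res_NZ hγ hD R))).nonempty
  refine ⟨θ, hNP, hNZ, ?_⟩
  have : ∀ T : Finset V, Disjoint T R → GoodOn R (T ∪ R) (rr γ R θ) := by
    intro T
    induction T using Finset.induction_on with
    | empty => intro _; simpa using hG
    | insert b T hb ih =>
      intro hT
      rw [Finset.disjoint_insert_left] at hT
      rw [Finset.insert_union]
      apply body_lemma hD R _ _ (ih hT.2) b hT.1 _ (fun u hu => rr_not γ θ hu)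
        (fun u _ w _ h => rr_disj hNP u w h)
      rw [Finset.mem_union]
      rintro (h | h)
      · exact hb h
      · exact hT.1 h
  have h := this (Finset.univ \ R) Finset.sdiff_disjoint
  rwa [Finset.sdiff_union_of_subset (Finset.subset_univ R)] at h

end gen2
end BRB

set_option synthInstance.maxHeartbeats 1000000
set_option maxHeartbeats 1000000
open ExteriorAlgebra
namespace BRB
open Module Submodule Filter Topology

section ext
variable {d : ℕ}

theorem mem_grade_mul {k : ℕ} (a : Wd d) {x : ExtAlg d} (hx : x ∈ extGrade d k) :
    ι ℝ a * x ∈ extGrade d (k + 1) := by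
  rw [extGrade, pow_succ']
  exact Submodule.mul_mem_mul ⟨a, rfl⟩ hx

noncomputable def eul (d : ℕ) : ExtAlg d →ₗ[ℝ] ExtAlg d :=
  ∑ i : Fin (d + 1), (LinearMap.mulLeft ℝ (ι ℝ (Pi.single i (1 : ℝ)) : ExtAlg d)).comp
    (CliffordAlgebra.contractLeft (Q := (0 : QuadraticForm ℝ (Wd d))) (LinearMap.proj i : Wd d →ₗ[ℝ] ℝ))

theorem eul_apply (x : ExtAlg d) : eul d x = ∑ i : Fin (d + 1), (ι ℝ (Pi.single i (1 : ℝ)) : ExtAlg d) *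
    CliffordAlgebra.contractLeft (Q := (0 : QuadraticForm ℝ (Wd d))) (LinearMap.proj i : Wd d →ₗ[ℝ] ℝ) x := by
  simp [eul]

theorem anti (a b : Wd d) (x : ExtAlg d) : ι ℝ a * (ι ℝ b * x) = - (ι ℝ b * (ι ℝ a * x)) := by
  have := ι_add_mul_swap (R := ℝ) a b
  rw [← mul_assoc, ← mul_assoc, eq_neg_iff_add_eq_zero, ← add_mul, this, zero_mul]

theorem contr_ι (f : Wd d →ₗ[ℝ] ℝ) (a : Wd d) (x : ExtAlg d) :
    CliffordAlgebra.contractLeft (Q := (0 : QuadraticForm ℝ (Wd d))) f ((ι ℝ a : ExtAlg d) * x) =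
    f a • x - (ι ℝ a : ExtAlg d) * CliffordAlgebra.contractLeft (Q := (0 : QuadraticForm ℝ (Wd d))) f x :=
  CliffordAlgebra.contractLeft_ι_mul _ a x

theorem eul_ι (a : Wd d) (x : ExtAlg d) : eul d (ι ℝ a * x) = ι ℝ a * x + ι ℝ a * eul d x := by
  rw [eul_apply, eul_apply, Finset.mul_sum]
  simp only [contr_ι, mul_sub, mul_smul_comm]
  rw [Finset.sum_sub_distrib]
  simp only [anti _ a, Finset.sum_neg_distrib, sub_neg_eq_add]
  congr 1
  simp only [← smul_mul_assoc]
  rw [← Finset.sum_mul]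
  congr 1
  simp only [← map_smul]
  rw [← map_sum]
  congr 1
  ext j
  simp [Finset.sum_apply, Pi.single_apply]

theorem eul_grade {k : ℕ} {x : ExtAlg d} (hx : x ∈ extGrade d k) : eul d x = (k : ℝ) • x := by
  induction k generalizing x with
  | zero =>
    rw [extGrade, pow_zero, Submodule.mem_one] at hx
    obtain ⟨c, rfl⟩ := hx
    rw [eul_apply]
    have : ∀ i : Fin (d+1), CliffordAlgebra.contractLeft (Q := (0 : QuadraticForm ℝ (Wd d))) (LinearMap.proj i : Wd d →ₗ[ℝ] ℝ)
      (algebraMap ℝ (ExtAlg d) c) = 0 := fun i => CliffordAlgebra.contractLeft_algebraMap _ _ _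
    simp [this]
  | succ k ih =>
    rw [extGrade, pow_succ'] at hx
    induction hx using Submodule.mul_induction_on' with
    | mem_mul_mem m hm n hn =>
      obtain ⟨a, rfl⟩ := hm
      rw [eul_ι, ih hn]
      push_cast
      rw [add_smul, one_smul, mul_smul_comm, add_comm]
    | add x _ y _ hx hy => rw [map_add, hx, hy, smul_add]

theorem nondeg1 {k : ℕ} (hk : k ≠ d + 1) {x : ExtAlg d} (hx : x ∈ extGrade d k)
    (h : ∀ a, ι ℝ a * x = 0) : x = 0 := by
  have h1 := eul_grade hx
  rw [eul_apply] at h1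
  have h2 : ∀ i : Fin (d+1), (ι ℝ (Pi.single i (1 : ℝ)) : ExtAlg d) *
    CliffordAlgebra.contractLeft (Q := (0 : QuadraticForm ℝ (Wd d))) (LinearMap.proj i : Wd d →ₗ[ℝ] ℝ) x = x := by
    intro i
    have := contr_ι (LinearMap.proj i : Wd d →ₗ[ℝ] ℝ) (Pi.single i (1 : ℝ)) x
    rw [h, map_zero] at this
    rw [eq_comm, sub_eq_zero] at this
    rw [← this]
    simp
  simp only [h2] at h1
  rw [Finset.sum_const, Finset.card_univ, Fintype.card_fin, ← Nat.cast_smul_eq_nsmul ℝ, ← sub_eq_zero, ← sub_smul] at h1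
  refine (smul_eq_zero.1 h1).resolve_left ?_
  intro h3
  rw [sub_eq_zero] at h3
  exact hk.symm (by exact_mod_cast h3)

theorem nondeg2 {k : ℕ} (hk : k < d) {x : ExtAlg d} (hx : x ∈ extGrade d k)
    (h : ∀ a b, ι ℝ a * (ι ℝ b * x) = 0) : x = 0 :=
  nondeg1 (by omega) hx (fun b => nondeg1 (k := k + 1) (by omega) (mem_grade_mul b hx) (fun a => h a b))

theorem finrank_grade (k : ℕ) : finrank ℝ (extGrade d k) = (d + 1).choose k := by
  have := exteriorPower.finrank_eq ℝ k (M := Wd d)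
  rw [finrank_fin_fun] at this
  exact this

theorem exists_vol (d : ℕ) : ∃ vol : ExtAlg d →ₗ[ℝ] ℝ, ∀ x ∈ extGrade d (d + 1), vol x = 0 → x = 0 := by
  have h : finrank ℝ (extGrade d (d + 1)) = finrank ℝ ℝ := by
    rw [finrank_grade, finrank_self]; simp
  have : FiniteDimensional ℝ (extGrade d (d + 1)) := by
    apply FiniteDimensional.of_finrank_pos
    rw [h]; simp
  let e := LinearEquiv.ofFinrankEq (extGrade d (d + 1)) ℝ h
  obtain ⟨g, hg⟩ := LinearMap.exists_extend e.toLinearMap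
  refine ⟨g, fun x hx h0 => ?_⟩
  have h1 : e ⟨x, hx⟩ = g x := by rw [← LinearEquiv.coe_toLinearMap, ← hg]; rfl
  rw [h0, LinearEquiv.map_eq_zero_iff] at h1
  exact congrArg Subtype.val h1

theorem dec_mem (k : ℕ) (w : Fin k → Wd d) : ιMulti ℝ k w ∈ extGrade d k := by
  exact (exteriorPower.ιMulti ℝ k w).2

theorem ι_dec {k : ℕ} (w : Fin k → Wd d) (i : Fin k) : ι ℝ (w i) * ιMulti ℝ k w = 0 := by
  have : ι ℝ (w i) * ιMulti ℝ k w = ιMulti ℝ (k + 1) (Fin.cons (w i) w) := by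
    rw [ιMulti_succ_apply]; simp [Matrix.vecTail, Function.comp_def]
  rw [this]
  apply (ιMulti ℝ (k+1)).map_eq_zero_of_eq _ (i := 0) (j := i.succ)
  · simp
  · exact (Fin.succ_ne_zero i).symm

theorem ι_span_dec {k : ℕ} (w : Fin k → Wd d) (a : Wd d) (ha : a ∈ span ℝ (Set.range w)) :
    ι ℝ a * ιMulti ℝ k w = 0 := by
  induction ha using span_induction with
  | mem x h => obtain ⟨i, rfl⟩ := h; exact ι_dec w i
  | zero => simp
  | add x y _ _ hx hy => rw [map_add, add_mul, hx, hy, add_zero]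
  | smul c x _ hx => rw [map_smul, smul_mul_assoc, hx, smul_zero]

theorem lin_span {Z : Type*} [AddCommGroup Z] [Module ℝ Z] (f g : Z →ₗ[ℝ] ℝ) (h : ∀ z, g z = 0 → f z = 0) :
    f ∈ span ℝ {g} := by
  have := mem_span_of_iInf_ker_le_ker (L := fun _ : Unit => g) (K := f) (by
    intro z hz
    simp only [iInf_const, LinearMap.mem_ker] at hz ⊢
    exact h z hz)
  simpa using this

/-- Key reconstruction lemma. -/
theorem F2 {n : ℕ} (w : Fin n → Wd (n + 1)) (hu : ιMulti ℝ n w ≠ 0)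
    (v k : ExtAlg (n + 1)) (hv : v ∈ extGrade (n + 1) n) (hk : k ∈ extGrade (n + 1) n)
    (h : ∀ a b, ι ℝ a * (ι ℝ b * ιMulti ℝ n w) = 0 → ι ℝ a * (ι ℝ b * v) = 0 → ι ℝ a * (ι ℝ b * k) = 0) :
    k ∈ span ℝ {ιMulti ℝ n w, v} := by
  obtain ⟨vol, hvol⟩ := exists_vol (n + 1)
  let T : ExtAlg (n+1) → Wd (n+1) →ₗ[ℝ] (Wd (n+1) →ₗ[ℝ] ℝ) := fun x =>
    LinearMap.mk₂ ℝ (fun a b => vol (ι ℝ a * (ι ℝ b * x)))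
      (by intros; simp [add_mul]) (by intros; simp) (by intros; simp [add_mul, mul_add]) (by intros; simp)
  have hT : ∀ x a b, T x a b = vol (ι ℝ a * (ι ℝ b * x)) := fun _ _ _ => rfl
  have hT0 : ∀ x ∈ extGrade (n+1) n, ∀ a b, T x a b = 0 → ι ℝ a * (ι ℝ b * x) = 0 := fun x hx a b h =>
    hvol _ (mem_grade_mul a (mem_grade_mul b hx)) h
  let U := span ℝ (Set.range w)
  obtain ⟨l, hl⟩ := prop_lemma ((T k).comp U.subtype) ((T v).comp U.subtype) (by
    intro a
    apply lin_span
    intro b hb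
    have hb' := hT0 v hv _ _ hb
    have : ι ℝ (a : Wd (n+1)) * (ι ℝ b * k) = 0 := by
      apply h _ _ _ hb'
      rw [anti, show ι ℝ (U.subtype a) * ιMulti ℝ n w = 0 from ι_span_dec w a a.2]; simp
    change vol _ = 0
    erw [this, map_zero])
  set k' := k - l • v with hk'
  have hk'm : k' ∈ extGrade (n+1) n := sub_mem hk (Submodule.smul_mem _ _ hv)
  have hk'U : ∀ a ∈ U, ∀ b, ι ℝ a * (ι ℝ b * k') = 0 := by
    intro a ha b
    apply hT0 _ hk'm
    have := LinearMap.congr_fun (LinearMap.congr_fun hl ⟨a, ha⟩) b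
    have h2 : T k a b = l * T v a b := this
    rw [hT] at *
    rw [hT] at h2
    rw [hk', mul_sub, mul_sub, map_sub, h2]
    simp
  obtain ⟨a0, b0, hab⟩ : ∃ a b, ι ℝ a * (ι ℝ b * ιMulti ℝ n w) ≠ 0 := by
    by_contra hcon
    push Not at hcon
    exact hu (nondeg2 (by omega) (dec_mem n w) hcon)
  have hdec : ι ℝ a0 * (ι ℝ b0 * ιMulti ℝ n w) = ιMulti ℝ (n+2) (Fin.cons a0 (Fin.cons b0 w)) := by
    rw [ιMulti_succ_apply, ιMulti_succ_apply]; simp [Matrix.vecTail, Function.comp_def]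
  have hLI : LinearIndependent ℝ (Fin.cons a0 (Fin.cons b0 w) : Fin (n+2) → Wd (n+1)) := by
    by_contra hcon
    exact hab (hdec.trans ((ιMulti ℝ (n+2)).map_linearDependent _ hcon))
  have hsp : ∀ z, z ∈ span ℝ (Set.range (Fin.cons a0 (Fin.cons b0 w) : Fin (n+2) → Wd (n+1))) := by
    intro z
    rw [hLI.span_eq_top_of_card_eq_finrank (by simp)]
    trivial
  have hz : ∀ z : Wd (n+1), ∃ α β : ℝ, ∃ u ∈ U, z = α • a0 + (β • b0 + u) := by
    intro z
    have := hsp z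
    rw [Fin.range_cons, Fin.range_cons, mem_span_insert] at this
    obtain ⟨α, y, hy, rfl⟩ := this
    rw [mem_span_insert] at hy
    obtain ⟨β, u, hu, rfl⟩ := hy
    exact ⟨α, β, u, hu, rfl⟩
  obtain ⟨c, hc⟩ : ∃ c : ℝ, T k' a0 b0 = c * T (ιMulti ℝ n w) a0 b0 := by
    refine ⟨T k' a0 b0 / T (ιMulti ℝ n w) a0 b0, ?_⟩
    rw [div_mul_cancel₀]
    intro h0
    exact hab (hT0 _ (dec_mem n w) _ _ h0)
  have hfin : k' - c • ιMulti ℝ n w = 0 := by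
    have hm : k' - c • ιMulti ℝ n w ∈ extGrade (n+1) n := sub_mem hk'm (Submodule.smul_mem _ _ (dec_mem n w))
    set k'' := k' - c • ιMulti ℝ n w with hk''
    have hkU : ∀ a ∈ U, ∀ b, ι ℝ a * (ι ℝ b * k'') = 0 := by
      intro a ha b
      rw [hk'', mul_sub, mul_sub, hk'U a ha b]
      rw [mul_smul_comm, mul_smul_comm, anti, ι_span_dec w a ha]; simp
    have h00 : ι ℝ a0 * (ι ℝ b0 * k'') = 0 := by
      apply hT0 _ hm
      rw [hT] at *
      rw [hT] at hc
      rw [hk'', mul_sub, mul_sub, map_sub, hc]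
      simp
    apply nondeg2 (by omega) hm
    intro a b
    obtain ⟨α, β, u, hu, rfl⟩ := hz a
    obtain ⟨α', β', u', hu', rfl⟩ := hz b
    have h1 : ∀ x, ι ℝ x * (ι ℝ u' * k'') = 0 := by
      intro x; rw [anti, hkU u' hu' x, neg_zero]
    have h2 : ι ℝ b0 * (ι ℝ a0 * k'') = 0 := by rw [anti, h00, neg_zero]
    have h3 : ∀ x, ι ℝ x * (ι ℝ x * k'') = 0 := by
      intro x; rw [← mul_assoc, ι_sq_zero, zero_mul]
    simp only [map_add, map_smul, add_mul, mul_add, smul_mul_assoc, mul_smul_comm, h1, h2, h3, h00, hkU u hu]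
    simp
  rw [mem_span_pair]
  refine ⟨c, l, ?_⟩
  rw [sub_eq_zero] at hfin
  rw [← hfin, hk']
  abel

end ext
end BRB

set_option synthInstance.maxHeartbeats 1000000
set_option maxHeartbeats 1000000
open ExteriorAlgebra
namespace BRB
open Module Submodule Filter Topology

section mult
variable {n : ℕ} {W M : Type} [NormedAddCommGroup W] [NormedSpace ℝ W] [AddCommGroup M] [Module ℝ M]

theorem lin_zero_open (f : W →ₗ[ℝ] M) (O : Set W) (hO : IsOpen O) (x0 : W) (hx : x0 ∈ O)
    (h : ∀ x ∈ O, f x = 0) (y : W) : f y = 0 := by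
  have hc : Continuous (fun t : ℝ => x0 + t • y) := by fun_prop
  have hn : (fun t : ℝ => x0 + t • y) ⁻¹' O ∈ 𝓝 (0 : ℝ) := (hO.preimage hc).mem_nhds (by simpa using hx)
  obtain ⟨ε, hε, hb⟩ := Metric.mem_nhds_iff.1 hn
  have h1 : (ε / 2) ∈ Metric.ball (0 : ℝ) ε := by
    rw [Metric.mem_ball, dist_zero_right, Real.norm_eq_abs, abs_of_pos (by positivity)]
    linarith
  have h2 := h _ (hb h1)
  simp only [map_add, map_smul, h x0 hx, zero_add] at h2
  exact (smul_eq_zero.1 h2).resolve_left (by positivity)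

theorem mult_zero_open (f : MultilinearMap ℝ (fun _ : Fin n => W) M) (O : Set (Fin n → W)) (hO : IsOpen O)
    (hne : O.Nonempty) (h : ∀ θ ∈ O, f θ = 0) (y : Fin n → W) : f y = 0 := by
  have key : ∀ s : Finset (Fin n), ∀ θ ∈ O, f (s.piecewise y θ) = 0 := by
    intro s
    induction s using Finset.induction_on with
    | empty => intro θ hθ; simpa using h θ hθ
    | insert i s hi ih =>
      intro θ hθ
      rw [Finset.piecewise_insert]
      have hc : Continuous (fun t : W => Function.update θ i t) := continuous_const.update i continuous_id
      apply lin_zero_open (f.toLinearMap (s.piecewise y θ) i) ((fun t : W => Function.update θ i t) ⁻¹' O)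
        (hO.preimage hc) (θ i) (by simpa using hθ)
      intro t ht
      have := ih _ ht
      rw [MultilinearMap.toLinearMap_apply]
      rwa [← Finset.update_piecewise_of_notMem _ _ _ hi] at this
  obtain ⟨θ, hθ⟩ := hne
  have := key Finset.univ θ hθ
  simpa using this

theorem slot_const {α : Type} (β : (Fin n → W) → α) (c : Fin n → W) (ε : ℝ)
    (h : ∀ θ ∈ Metric.ball c ε, ∀ i y, Function.update θ i y ∈ Metric.ball c ε → β (Function.update θ i y) = β θ)
    (θ θ' : Fin n → W) (hθ : θ ∈ Metric.ball c ε) (hθ' : θ' ∈ Metric.ball c ε) : β θ = β θ' := by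
  have hε : 0 < ε := Metric.pos_of_mem_ball hθ
  have hm : ∀ s : Finset (Fin n), s.piecewise θ θ' ∈ Metric.ball c ε := by
    intro s
    rw [Metric.mem_ball, dist_pi_lt_iff hε] at hθ hθ' ⊢
    intro i
    by_cases hi : i ∈ s
    · rw [Finset.piecewise_eq_of_mem _ _ _ hi]; exact hθ i
    · rw [Finset.piecewise_eq_of_notMem _ _ _ hi]; exact hθ' i
  have key : ∀ s : Finset (Fin n), β (s.piecewise θ θ') = β θ' := by
    intro s
    induction s using Finset.induction_on with
    | empty => simp
    | insert i s hi ih =>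
      have := hm (insert i s)
      rw [Finset.piecewise_insert] at this ⊢
      rw [h _ (hm s) i _ this, ih]
  simpa using key Finset.univ

end mult

theorem mult_cont {n d : ℕ} {K : Type} [NormedAddCommGroup K] [NormedSpace ℝ K]
    (f : MultilinearMap ℝ (fun _ : Fin n => Wd d) K) : Continuous (fun θ => f θ) := by
  have h : ∀ θ : Fin n → Wd d, f θ = ∑ r : Fin n → Fin (d + 1),
      (∏ i, θ i (r i)) • f (fun i => Pi.single (r i) (1 : ℝ)) := by
    intro θ
    have h1 : θ = fun i => ∑ j : Fin (d + 1), θ i j • (Pi.single j (1 : ℝ) : Wd d) := by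
      funext i
      ext k
      simp [Finset.sum_apply, Pi.single_apply]
    conv_lhs => rw [h1]
    rw [MultilinearMap.map_sum]
    apply Finset.sum_congr rfl
    intro r _
    rw [MultilinearMap.map_smul_univ]
  rw [funext h]
  apply continuous_finsetSum
  intro r _
  apply Continuous.smul _ continuous_const
  apply continuous_finsetProd
  intro i _
  exact (continuous_apply (r i)).comp (continuous_apply i)

section gen
variable {n : ℕ} {K : Type} [NormedAddCommGroup K] [NormedSpace ℝ K] [FiniteDimensional ℝ K]

theorem span_dec (ψ : K →ₗ[ℝ] ExtAlg (n + 1)) (hinj : Function.Injective ψ)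
    (hr : LinearMap.range ψ = extGrade (n + 1) n)
    (γ : MultilinearMap ℝ (fun _ : Fin n => Wd (n + 1)) K) (hγ : ∀ θ, ψ (γ θ) = ιMulti ℝ n θ)
    (U : Submodule ℝ K) (h : ∀ θ, γ θ ∈ U) : U = ⊤ := by
  rw [eq_top_iff]
  intro x _
  have h1 : extGrade (n + 1) n ≤ U.map ψ := by
    have := ExteriorAlgebra.ιMulti_span_fixedDegree ℝ n (M := Wd (n+1))
    change span ℝ _ = extGrade (n+1) n at this
    rw [← this, span_le]
    rintro _ ⟨θ, rfl⟩
    exact ⟨γ θ, h θ, hγ θ⟩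
  rw [← hr] at h1
  obtain ⟨y, hy, hxy⟩ := h1 ⟨x, rfl⟩
  rwa [← hinj hxy]

theorem gen_dense1 (ψ : K →ₗ[ℝ] ExtAlg (n + 1)) (hinj : Function.Injective ψ)
    (hr : LinearMap.range ψ = extGrade (n + 1) n)
    (γ : MultilinearMap ℝ (fun _ : Fin n => Wd (n + 1)) K) (hγ : ∀ θ, ψ (γ θ) = ιMulti ℝ n θ)
    (U : Submodule ℝ K) (hU : U ≠ ⊤) : Dense {θ | γ θ ∉ U} := by
  rw [dense_iff_inter_open]
  intro O hO hne
  by_contra hcon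
  rw [Set.not_nonempty_iff_eq_empty] at hcon
  have h1 : ∀ θ ∈ O, (U.mkQ.compMultilinearMap γ) θ = 0 := by
    intro θ hθ
    by_contra h
    have : θ ∈ O ∩ {θ | γ θ ∉ U} := ⟨hθ, fun h' => h (by simpa using h')⟩
    rw [hcon] at this
    exact this
  apply hU
  apply span_dec ψ hinj hr γ hγ
  intro θ
  have := mult_zero_open _ O hO hne h1 θ
  simpa using this

theorem gen_model (hn : 2 ≤ n) (hK : 1 < finrank ℝ K) (ψ : K →ₗ[ℝ] ExtAlg (n + 1)) (hinj : Function.Injective ψ)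
    (hr : LinearMap.range ψ = extGrade (n + 1) n)
    (γ : MultilinearMap ℝ (fun _ : Fin n => Wd (n + 1)) K) (hγ : ∀ θ, ψ (γ θ) = ιMulti ℝ n θ) :
    Gen (fun θ => γ θ) := by
  have hd1 := gen_dense1 ψ hinj hr γ hγ
  refine ⟨mult_cont γ, hd1, ?_⟩
  intro k L hL hnb
  rw [dense_iff_inter_open]
  intro O hO hne
  by_contra hcon
  rw [Set.not_nonempty_iff_eq_empty] at hcon
  have hbad : ∀ θ ∈ O, ∃ a b : ℝ, (a • γ θ, b • γ θ) ∈ L ∧ ¬ (a = 0 ∧ b = 0) := by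
    intro θ hθ
    by_contra h
    push Not at h
    have : θ ∈ O ∩ {θ | ∀ a b : ℝ, (a • γ θ, b • γ θ) ∈ L → a = 0 ∧ b = 0} :=
      ⟨hθ, fun a b hab => by
        have := h a b hab
        tauto⟩
    rw [hcon] at this
    exact this
  have hkt : span ℝ {k} ≠ ⊤ := by
    intro h
    have := finrank_sing_le k
    rw [h, finrank_top] at this
    omega
  -- shrink
  let P : Submodule ℝ (Wd (n+1)) := LinearMap.ker ((LinearMap.mulRight ℝ (ψ k)).comp (ι ℝ))
  have hP : ∀ a, a ∈ P ↔ ι ℝ a * ψ k = 0 := by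
    intro a; simp [P]
  have hPo : IsOpen {a : Wd (n+1) | a ∉ P} := (P.closed_of_finiteDimensional).isOpen_compl
  have hshr : ∃ O1 ⊆ O, IsOpen O1 ∧ O1.Nonempty ∧ (∀ θ ∈ O1, γ θ ∉ span ℝ {k}) ∧
      (k ≠ 0 → ∀ θ ∈ O1, ∀ j, θ j ∉ P) := by
    have hOa : IsOpen (O ∩ {θ | γ θ ∉ span ℝ {k}}) := hO.inter (open_avoid (mult_cont γ) _)
    have hOan : (O ∩ {θ | γ θ ∉ span ℝ {k}}).Nonempty := (hd1 _ hkt).inter_open_nonempty O hO hne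
    by_cases hk0 : k = 0
    · exact ⟨_, Set.inter_subset_left, hOa, hOan, fun θ h => h.2, fun h => absurd hk0 h⟩
    have hPt : ∃ a0, a0 ∉ P := by
      by_contra h
      push Not at h
      apply hk0
      apply hinj
      rw [map_zero]
      exact nondeg1 (k := n) (by omega) (by rw [← hr]; exact ⟨k, rfl⟩) (fun a => (hP a).1 (h a))
    have hPd : Dense {a : Wd (n+1) | a ∉ P} := by
      obtain ⟨a0, ha0⟩ := hPt
      rw [dense_iff_inter_open]
      rintro Q hQ ⟨x, hx⟩
      by_contra hc
      rw [Set.not_nonempty_iff_eq_empty] at hc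
      apply ha0
      have := lin_zero_open P.mkQ Q hQ x hx (by
        intro y hy
        by_contra h
        have : y ∈ Q ∩ {a : Wd (n+1) | a ∉ P} := ⟨hy, fun h' => h (by simpa using h')⟩
        rw [hc] at this
        exact this) a0
      simpa using this
    refine ⟨(O ∩ {θ | γ θ ∉ span ℝ {k}}) ∩ ⋂ j : Fin n, (fun θ : Fin n → Wd (n+1) => θ j) ⁻¹' {a | a ∉ P},
      ?_, ?_, ?_, ?_, ?_⟩
    · exact fun θ h => h.1.1
    · apply hOa.inter
      apply isOpen_iInter_of_finite
      intro j
      exact hPo.preimage (continuous_apply j)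
    · have : Dense (⋂ j : Fin n, (fun θ : Fin n → Wd (n+1) => θ j) ⁻¹' {a | a ∉ P}) := by
        have h2 : (⋂ j : Fin n, (fun θ : Fin n → Wd (n+1) => θ j) ⁻¹' {a | a ∉ P}) =
            Set.pi Set.univ (fun _ => {a | a ∉ P}) := by
          ext θ; simp
        rw [h2]
        exact dense_pi _ (fun _ _ => hPd)
      exact this.inter_open_nonempty _ hOa hOan
    · exact fun θ h => h.1.2
    · intro _ θ h j
      exact Set.mem_iInter.1 h.2 j
  obtain ⟨O1, hO1, hO1o, ⟨c, hc⟩, hk1, hk2⟩ := hshr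
  obtain ⟨ε, hε, hball⟩ := Metric.isOpen_iff.1 hO1o c hc
  have hne0 : ∀ θ ∈ Metric.ball c ε, γ θ ≠ 0 := by
    intro θ hθ h
    apply hk1 θ (hball hθ)
    rw [h]; exact zero_mem _
  have hβ : ∀ θ, ∃ b : ℝ, θ ∈ Metric.ball c ε → (γ θ, b • γ θ) ∈ L := by
    intro θ
    by_cases hθ : θ ∈ Metric.ball c ε
    · obtain ⟨a, b, hab, hn0⟩ := hbad θ (hO1 (hball hθ))
      have ha : a ≠ 0 := by
        rintro rfl
        rw [zero_smul] at hab
        have hb : b ≠ 0 := by tauto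
        have := hL _ hab
        apply hk1 θ (hball hθ)
        exact (Submodule.smul_mem_iff _ hb).1 this
      refine ⟨a⁻¹ * b, fun _ => ?_⟩
      have := L.smul_mem a⁻¹ hab
      rw [Prod.smul_mk, smul_smul, smul_smul, inv_mul_cancel₀ ha, one_smul] at this
      exact this
    · exact ⟨0, fun h => absurd h hθ⟩
  choose β hβ using hβ
  have huniq : ∀ θ ∈ Metric.ball c ε, ∀ b b' : ℝ, (γ θ, b • γ θ) ∈ L → (γ θ, b' • γ θ) ∈ L → b = b' := by
    intro θ hθ b b' h h'
    have h1 := L.sub_mem h h'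
    rw [Prod.mk_sub_mk, sub_self, ← sub_smul] at h1
    have h2 := hL _ h1
    by_contra hbb
    exact hk1 θ (hball hθ) ((Submodule.smul_mem_iff _ (sub_ne_zero.2 hbb)).1 h2)
  have hconst : ∀ θ ∈ Metric.ball c ε, ∀ i y, Function.update θ i y ∈ Metric.ball c ε →
      β (Function.update θ i y) = β θ := by
    intro θ hθ i y hy
    set θ' := Function.update θ i y with hθ'
    set θ'' := Function.update θ i ((1/2 : ℝ) • θ i + (1/2 : ℝ) • y) with hθ''
    have hupd : ∀ s t : ℝ, γ (Function.update θ i (s • θ i + t • y)) = s • γ θ + t • γ θ' := by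
      intro s t
      rw [MultilinearMap.map_update_add, MultilinearMap.map_update_smul, MultilinearMap.map_update_smul,
        Function.update_eq_self]
    have h'' : θ'' ∈ Metric.ball c ε := by
      have h3 : θ'' = (1/2 : ℝ) • θ + (1/2 : ℝ) • θ' := by
        funext j
        by_cases hj : j = i
        · subst hj; simp [hθ'', hθ']
        · simp only [hθ'', hθ', Function.update_of_ne hj, Pi.add_apply, Pi.smul_apply]
          rw [← add_smul]; norm_num
      rw [h3]
      exact (convex_ball c ε) hθ hy (by norm_num) (by norm_num) (by norm_num)
    have hx'' : γ θ'' = (1/2 : ℝ) • γ θ + (1/2 : ℝ) • γ θ' := hupd _ _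
    have e1 := hβ θ hθ
    have e2 := hβ θ' hy
    have e3 := hβ θ'' h''
    have e4 : (γ θ + γ θ', β θ'' • (γ θ + γ θ')) ∈ L := by
      have := L.smul_mem (2 : ℝ) e3
      rw [hx'', ← smul_add, Prod.smul_mk, smul_comm (β θ'') (1/2 : ℝ), smul_smul, smul_smul] at this
      norm_num at this
      rwa [← smul_add] at this
    have e5 := L.sub_mem (L.add_mem e1 e2) e4
    rw [Prod.mk_add_mk, Prod.mk_sub_mk, sub_self] at e5
    have e6 := hL _ e5
    have e7 : β θ • γ θ + β θ' • γ θ' - β θ'' • (γ θ + γ θ') =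
        (β θ - β θ'') • γ θ + (β θ' - β θ'') • γ θ' := by
      rw [smul_add, sub_smul, sub_smul]; abel
    rw [e7, ← hupd] at e6
    set z := Function.update θ i ((β θ - β θ'') • θ i + (β θ' - β θ'') • y) with hz
    -- γ z = 0
    have hz0 : γ z = 0 := by
      obtain ⟨κ, hκ⟩ := mem_span_singleton.1 e6
      by_contra hzne
      have hκ0 : κ ≠ 0 := by rintro rfl; rw [zero_smul] at hκ; exact hzne hκ.symm
      have hk0 : k ≠ 0 := by rintro rfl; rw [smul_zero] at hκ; exact hzne hκ.symm
      have : Nontrivial (Fin n) := Fin.nontrivial_iff_two_le.2 hn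
      obtain ⟨j, hj⟩ := exists_ne i
      apply hk2 hk0 θ (hball hθ) j
      rw [hP]
      have h8 := ι_dec z j
      rw [← hγ, ← hκ, map_smul, mul_smul_comm, hz, Function.update_of_ne hj] at h8
      exact (smul_eq_zero.1 h8).resolve_left hκ0
    rw [hz, hupd] at hz0
    by_cases hli : LinearIndependent ℝ ![γ θ, γ θ']
    · have := LinearIndependent.pair_iff.1 hli _ _ hz0
      linarith [this.1, this.2]
    · have hmem : γ θ' ∈ span ℝ {γ θ} := by
        by_contra h
        exact hli (LI_of (hne0 θ hθ) h)
      obtain ⟨s, hs⟩ := mem_span_singleton.1 hmem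
      apply huniq θ' hy _ _ e2
      have := L.smul_mem s e1
      rwa [Prod.smul_mk, smul_comm, hs] at this
  apply hnb
  refine ⟨β c, ?_⟩
  have hcc : c ∈ Metric.ball c ε := Metric.mem_ball_self hε
  let Λ : K →ₗ[ℝ] K × K := LinearMap.prod LinearMap.id (β c • LinearMap.id)
  have h1 : ∀ θ ∈ Metric.ball c ε, ((L.mkQ.comp Λ).compMultilinearMap γ) θ = 0 := by
    intro θ hθ
    have h2 := hβ θ hθ
    rw [slot_const β c ε hconst θ c hθ hcc] at h2
    simpa [Λ] using h2
  have h3 : L.comap Λ = ⊤ := by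
    apply span_dec ψ hinj hr γ hγ
    intro θ
    have := mult_zero_open _ _ Metric.isOpen_ball ⟨c, hcc⟩ h1 θ
    simpa using this
  intro x
  have : x ∈ L.comap Λ := by rw [h3]; trivial
  exact this

theorem exists_model (n : ℕ) : ∃ (ψ : (Fin ((n + 2).choose 2) → ℝ) →ₗ[ℝ] ExtAlg (n + 1))
    (γ : MultilinearMap ℝ (fun _ : Fin n => Wd (n + 1)) (Fin ((n + 2).choose 2) → ℝ)),
    Function.Injective ψ ∧ LinearMap.range ψ = extGrade (n + 1) n ∧ ∀ θ, ψ (γ θ) = ιMulti ℝ n θ := by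
  have h : finrank ℝ (extGrade (n+1) n) = finrank ℝ (Fin ((n + 2).choose 2) → ℝ) := by
    rw [finrank_grade, finrank_fin_fun, ← Nat.choose_symm (by omega)]
    congr 1
    omega
  have : FiniteDimensional ℝ (extGrade (n+1) n) := by
    apply FiniteDimensional.of_finrank_pos
    rw [h, finrank_fin_fun]
    exact Nat.choose_pos (by omega)
  let e : extGrade (n+1) n ≃ₗ[ℝ] (Fin ((n + 2).choose 2) → ℝ) := LinearEquiv.ofFinrankEq _ _ h
  let g : MultilinearMap ℝ (fun _ : Fin n => Wd (n + 1)) (extGrade (n+1) n) :=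
    (exteriorPower.ιMulti ℝ n (M := Wd (n+1))).toMultilinearMap
  refine ⟨(extGrade (n+1) n).subtype.comp e.symm.toLinearMap, e.toLinearMap.compMultilinearMap g, ?_, ?_, ?_⟩
  · exact (Subtype.val_injective).comp e.symm.injective
  · rw [LinearMap.range_comp, LinearEquiv.range, Submodule.map_top, Submodule.range_subtype]
  · intro θ
    simp only [LinearMap.comp_apply, LinearMap.compMultilinearMap_apply, LinearEquiv.coe_coe,
      LinearEquiv.symm_apply_apply]
    rfl

end gen
end BRB

set_option synthInstance.maxHeartbeats 1000000
set_option maxHeartbeats 1000000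
open ExteriorAlgebra
namespace BRB
open Module Submodule

section glue
variable {V E : Type} [Fintype V] [Fintype E] [DecidableEq V] [DecidableEq E]

def MS {X : Type} [AddCommGroup X] [Module ℝ X] (T : Set (Dual ℝ X)) : Submodule ℝ X :=
  (span ℝ T).dualCoannihilator

theorem mem_MS {X : Type} [AddCommGroup X] [Module ℝ X] (T : Set (Dual ℝ X)) (m : X) :
    m ∈ MS T ↔ ∀ φ ∈ T, φ m = 0 := by
  rw [MS, mem_dualCoannihilator]
  constructor
  · intro h φ hφ; exact h φ (subset_span hφ)
  · intro h φ hφ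
    induction hφ using span_induction with
    | mem x hx => exact h x hx
    | zero => simp
    | add x y _ _ hx hy => simp [hx, hy]
    | smul c x _ hx => simp [hx]

theorem finrank_MS {X : Type} [AddCommGroup X] [Module ℝ X] [FiniteDimensional ℝ X] (T : Set (Dual ℝ X)) :
    finrank ℝ (span ℝ T) + finrank ℝ (MS T) = finrank ℝ X :=
  Subspace.finrank_add_finrank_dualCoannihilator_eq _

variable {n : ℕ} {K : Type} [AddCommGroup K] [Module ℝ K] [FiniteDimensional ℝ K]

noncomputable def bar (vol : ExtAlg (n+1) →ₗ[ℝ] ℝ) (ψ : K →ₗ[ℝ] ExtAlg (n + 1)) (pq : V × V) (q : ExtAlg (n+1)) :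
    Dual ℝ (V → K) :=
  (vol.comp ((LinearMap.mulLeft ℝ q).comp ψ)).comp
    ((LinearMap.proj pq.1 : (V → K) →ₗ[ℝ] K) - LinearMap.proj pq.2)

theorem bar_apply (vol : ExtAlg (n+1) →ₗ[ℝ] ℝ) (ψ : K →ₗ[ℝ] ExtAlg (n + 1)) (pq : V × V) (q : ExtAlg (n+1))
    (m : V → K) : bar vol ψ pq q m = vol (q * ψ (m pq.1 - m pq.2)) := rfl

theorem bar_zero {vol : ExtAlg (n+1) →ₗ[ℝ] ℝ} (hvol : ∀ x ∈ extGrade (n+1) (n + 2), vol x = 0 → x = 0)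
    {ψ : K →ₗ[ℝ] ExtAlg (n + 1)} (hr : LinearMap.range ψ = extGrade (n + 1) n) (pq : V × V) (a b : Wd (n+1))
    (m : V → K) : bar vol ψ pq (ι ℝ a * ι ℝ b) m = 0 ↔ (ι ℝ a * ι ℝ b) * ψ (m pq.1 - m pq.2) = 0 := by
  rw [bar_apply]
  constructor
  · intro h
    apply hvol _ _ h
    rw [mul_assoc]
    apply mem_grade_mul
    apply mem_grade_mul
    rw [← hr]; exact ⟨_, rfl⟩
  · intro h; rw [h, map_zero]

theorem finrank_motion {vol : ExtAlg (n+1) →ₗ[ℝ] ℝ} (hvol : ∀ x ∈ extGrade (n+1) (n + 2), vol x = 0 → x = 0)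
    {ψ : K →ₗ[ℝ] ExtAlg (n + 1)} (hinj : Function.Injective ψ)
    (hr : LinearMap.range ψ = extGrade (n + 1) n) (ends : E → V × V) (a b : E → Wd (n+1)) (E₀ : Set E) :
    finrank ℝ (motionSpace (n+1) ends (fun e => ι ℝ (a e) * ι ℝ (b e)) E₀) =
      finrank ℝ (MS ((fun e => bar vol ψ (ends e) (ι ℝ (a e) * ι ℝ (b e))) '' E₀)) := by
  have hinj' : Function.Injective (ψ.compLeft V) := by
    intro f g h
    funext v
    exact hinj (congrFun h v)
  have : motionSpace (n+1) ends (fun e => ι ℝ (a e) * ι ℝ (b e)) E₀ =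
      (MS ((fun e => bar vol ψ (ends e) (ι ℝ (a e) * ι ℝ (b e))) '' E₀)).map (ψ.compLeft V) := by
    ext M
    rw [motionSpace, mem_inf, mem_iInf, mem_map]
    constructor
    · rintro ⟨h1, h2⟩
      have h3 : ∀ v, ∃ x, ψ x = M v := by
        intro v
        have := h1 v
        rw [mem_comap, Nat.add_sub_cancel, ← hr] at this
        exact this
      choose m hm using h3
      refine ⟨m, ?_, funext hm⟩
      rw [mem_MS]
      rintro _ ⟨e, he, rfl⟩
      simp only []
      rw [bar_zero hvol hr, map_sub, hm, hm]
      have := (mem_iInf _).1 ((mem_iInf _).1 h2 e) he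
      exact this
    · rintro ⟨m, hm, rfl⟩
      rw [mem_MS] at hm
      refine ⟨?_, ?_⟩
      · intro v
        rw [mem_comap, Nat.add_sub_cancel, ← hr]
        exact ⟨_, rfl⟩
      · rw [mem_iInf]; intro e
        rw [mem_iInf]; intro he
        have := (bar_zero hvol hr _ _ _ _).1 (hm _ ⟨e, he, rfl⟩)
        rw [map_sub] at this
        exact this
  rw [this]
  exact (LinearEquiv.finrank_eq (Submodule.equivMapOfInjective _ hinj' _)).symm

theorem mem_VF {ends : E → V × V} {F : Finset E} {v : V} :
    v ∈ VF ends F ↔ ∃ e ∈ F, v = (ends e).1 ∨ v = (ends e).2 := by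
  simp only [VF, Finset.mem_union, Finset.mem_image]
  constructor
  · rintro (⟨e, h, rfl⟩ | ⟨e, h, rfl⟩)
    · exact ⟨e, h, Or.inl rfl⟩
    · exact ⟨e, h, Or.inr rfl⟩
  · rintro ⟨e, h, rfl | rfl⟩
    · exact Or.inl ⟨e, h, rfl⟩
    · exact Or.inr ⟨e, h, rfl⟩

/-- lower bound on the motion space of an edge set -/
theorem MS_lower (ψ : K →ₗ[ℝ] ExtAlg (n + 1)) (vol : ExtAlg (n+1) →ₗ[ℝ] ℝ)
    (ends : E → V × V) (hloop : ∀ e : E, (ends e).1 ≠ (ends e).2) (R : Finset V) (ρ : V → K)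
    (h0 : ∀ v ∈ R, ρ v ≠ 0) (hNP : ∀ u ∈ R, ∀ v ∈ R, u ≠ v → Disjoint (span ℝ {ρ u}) (span ℝ {ρ v}))
    (q : E → ExtAlg (n+1)) (hq : ∀ e, ∀ w ∈ R, (w = (ends e).1 ∨ w = (ends e).2) → q e * ψ (ρ w) = 0)
    (F : Finset E) (hF : F.Nonempty) :
    finrank ℝ K + (VF ends F ∩ R).card + finrank ℝ K * (Fintype.card V - (VF ends F).card) ≤
      finrank ℝ (MS ((fun e => bar vol ψ (ends e) (q e)) '' (F : Set E))) := by
  set Y := VF ends F with hY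
  let f : (K × ({v // v ∈ Y ∩ R} → ℝ) × ({v // v ∉ Y} → K)) → (V → K) := fun z v =>
    if h : v ∈ Y then z.1 + (if h' : v ∈ Y ∩ R then z.2.1 ⟨v, h'⟩ • ρ v else 0) else z.2.2 ⟨v, h⟩
  have f1 : ∀ z v, v ∈ Y → f z v = z.1 + (if h' : v ∈ Y ∩ R then z.2.1 ⟨v, h'⟩ • ρ v else 0) := by
    intro z v h; simp only [f, dif_pos h]
  have f2 : ∀ z v (h : v ∉ Y), f z v = z.2.2 ⟨v, h⟩ := by
    intro z v h; simp only [f, dif_neg h]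
  let L : (K × ({v // v ∈ Y ∩ R} → ℝ) × ({v // v ∉ Y} → K)) →ₗ[ℝ] (V → K) :=
    { toFun := f
      map_add' := by
        intro x y
        funext v
        rw [Pi.add_apply]
        by_cases h : v ∈ Y
        · rw [f1 _ _ h, f1 _ _ h, f1 _ _ h]
          by_cases h' : v ∈ Y ∩ R
          · simp only [dif_pos h', Prod.fst_add, Prod.snd_add, Pi.add_apply, add_smul]; abel
          · simp only [dif_neg h', Prod.fst_add]; abel
        · rw [f2 _ _ h, f2 _ _ h, f2 _ _ h]; rfl
      map_smul' := by
        intro c y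
        funext v
        rw [Pi.smul_apply]
        by_cases h : v ∈ Y
        · rw [f1 _ _ h, f1 _ _ h]
          by_cases h' : v ∈ Y ∩ R
          · simp only [dif_pos h', Prod.smul_fst, Prod.smul_snd, Pi.smul_apply, smul_add, smul_eq_mul, mul_smul,
              RingHom.id_apply]
          · simp only [dif_neg h', Prod.smul_fst, add_zero, RingHom.id_apply]
        · rw [f2 _ _ h, f2 _ _ h]; rfl }
  have hL : ∀ z, L z = f z := fun _ => rfl
  have hinj : Function.Injective L := by
    rw [injective_iff_map_eq_zero]
    intro z hz
    have hzv : ∀ v, f z v = 0 := fun v => congrFun hz v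
    obtain ⟨e, he⟩ := hF
    have hmem : ∀ v ∈ Y, v ∈ R → -z.1 ∈ span ℝ {ρ v} := by
      intro v hv hvR
      have := hzv v
      rw [f1 _ _ hv, dif_pos (Finset.mem_inter.2 ⟨hv, hvR⟩)] at this
      rw [neg_eq_of_add_eq_zero_right this]
      exact Submodule.smul_mem _ _ (mem_span_singleton_self _)
    have hnot : ∀ v ∈ Y, v ∉ R → z.1 = 0 := by
      intro v hv hvR
      have := hzv v
      rwa [f1 _ _ hv, dif_neg (fun h => hvR (Finset.mem_inter.1 h).2), add_zero] at this
    have hp : (ends e).1 ∈ Y := mem_VF.2 ⟨e, he, Or.inl rfl⟩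
    have hq' : (ends e).2 ∈ Y := mem_VF.2 ⟨e, he, Or.inr rfl⟩
    have hc : z.1 = 0 := by
      by_cases hpR : (ends e).1 ∈ R
      · by_cases hqR : (ends e).2 ∈ R
        · have := (disjoint_def.1 (hNP _ hpR _ hqR (hloop e))) _ (hmem _ hp hpR) (hmem _ hq' hqR)
          simpa using this
        · exact hnot _ hq' hqR
      · exact hnot _ hp hpR
    have hs : z.2.1 = 0 := by
      funext ⟨v, hv⟩
      have hv' := Finset.mem_inter.1 hv
      have := hzv v
      rw [f1 _ _ hv'.1, dif_pos hv, hc, zero_add] at this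
      exact (smul_eq_zero.1 this).resolve_right (h0 v hv'.2)
    have hy : z.2.2 = 0 := by
      funext ⟨v, hv⟩
      have := hzv v
      rwa [f2 _ _ hv] at this
    exact Prod.ext hc (Prod.ext hs hy)
  have hle : LinearMap.range L ≤ MS ((fun e => bar vol ψ (ends e) (q e)) '' (F : Set E)) := by
    rintro _ ⟨z, rfl⟩
    rw [mem_MS]
    rintro _ ⟨e, he, rfl⟩
    have hp : (ends e).1 ∈ Y := mem_VF.2 ⟨e, he, Or.inl rfl⟩
    have hq' : (ends e).2 ∈ Y := mem_VF.2 ⟨e, he, Or.inr rfl⟩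
    have key : ∀ w, (w = (ends e).1 ∨ w = (ends e).2) →
        q e * ψ (if h' : w ∈ Y ∩ R then z.2.1 ⟨w, h'⟩ • ρ w else 0) = 0 := by
      intro w hw
      split_ifs with h
      · rw [map_smul, mul_smul_comm, hq e w (Finset.mem_inter.1 h).2 hw, smul_zero]
      · simp
    simp only []
    rw [bar_apply, hL, f1 _ _ hp, f1 _ _ hq', add_sub_add_left_eq_sub, map_sub, mul_sub,
      key _ (Or.inl rfl), key _ (Or.inr rfl), sub_zero, map_zero]
  have h1 := finrank_mono hle
  rw [LinearMap.finrank_range_of_inj hinj, finrank_prod, finrank_prod, finrank_fun (K := K), finrank_fun (K := ℝ),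
    finrank_self, one_mul, Fintype.card_coe, Fintype.card_subtype_compl, Fintype.card_coe] at h1
  omega

theorem dir1 (hn : 2 ≤ n) (hcard : 3 < finrank ℝ K)
    {vol : ExtAlg (n+1) →ₗ[ℝ] ℝ} (hvol : ∀ x ∈ extGrade (n+1) (n + 2), vol x = 0 → x = 0)
    {ψ : K →ₗ[ℝ] ExtAlg (n + 1)} (hinj : Function.Injective ψ)
    (hr : LinearMap.range ψ = extGrade (n + 1) n)
    (ends : E → V × V) (hloop : ∀ e : E, (ends e).1 ≠ (ends e).2)
    (B R : Finset V) (hdisj : Disjoint B R) (hcov : B ∪ R = Finset.univ)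
    (r : V → ExtAlg (n+1)) (a b : E → Wd (n+1)) (h0 : ∀ v ∈ R, r v ≠ 0)
    (hdec : ∀ v ∈ R, IsDecomp (n+1) n (r v))
    (hNP : ∀ u ∈ R, ∀ v ∈ R, u ≠ v → ∀ c : ℝ, r u ≠ c • r v)
    (hq : ∀ e : E, ∀ w ∈ R, (w = (ends e).1 ∨ w = (ends e).2) → (ι ℝ (a e) * ι ℝ (b e)) * r w = 0)
    (hrig : finrank ℝ (motionSpace (n+1) ends (fun e => ι ℝ (a e) * ι ℝ (b e)) Set.univ) = finrank ℝ K + R.card)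
    (hmin : ∀ e₀ : E, finrank ℝ K + R.card + 1 ≤
        finrank ℝ (motionSpace (n+1) ends (fun e => ι ℝ (a e) * ι ℝ (b e)) {e : E | e ≠ e₀})) :
    ((Fintype.card E : ℤ) = finrank ℝ K * B.card + ((finrank ℝ K : ℤ) - 1) * R.card - finrank ℝ K ∧
      ∀ F : Finset E, F.Nonempty →
        (F.card : ℤ) ≤ finrank ℝ K * ((VF ends F) ∩ B).card
          + ((finrank ℝ K : ℤ) - 1) * ((VF ends F) ∩ R).card - finrank ℝ K) := by
  set D := finrank ℝ K with hD
  rw [finrank_motion hvol hinj hr] at hrig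
  simp only [finrank_motion hvol hinj hr] at hmin
  set x : E → Dual ℝ (V → K) := fun e => bar vol ψ (ends e) (ι ℝ (a e) * ι ℝ (b e)) with hx
  have hX : finrank ℝ (V → K) = D * Fintype.card V := finrank_fun
  have hcV : Fintype.card V = B.card + R.card := by
    rw [← Finset.card_univ, ← hcov, Finset.card_union_of_disjoint hdisj]
  have hLI : LinearIndependent ℝ x := by
    rw [linearIndependent_iff_notMem_span]
    intro e he
    have h1 := finrank_MS (x '' Set.univ)
    have h2 := finrank_MS (x '' {e' : E | e' ≠ e})
    have h3 := hmin e
    have h4 : span ℝ (x '' Set.univ) ≤ span ℝ (x '' {e' : E | e' ≠ e}) := by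
      rw [span_le]
      rintro _ ⟨e', _, rfl⟩
      by_cases hee : e' = e
      · subst hee
        have hset : {e'_1 : E | e'_1 ≠ e'} = Set.univ \ {e'} := by ext; simp
        rw [hset]
        exact he
      · exact subset_span ⟨e', hee, rfl⟩
    have h5 := finrank_mono h4
    omega
  have hρ : ∀ v, ∃ k, v ∈ R → ψ k = r v := by
    intro v
    by_cases hv : v ∈ R
    · have : r v ∈ LinearMap.range ψ := by
        rw [hr]
        obtain ⟨w, hw⟩ := hdec v hv
        rw [hw, ← ιMulti_apply]
        exact dec_mem n w
      obtain ⟨k, hk⟩ := this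
      exact ⟨k, fun _ => hk⟩
    · exact ⟨0, fun h => absurd h hv⟩
  choose ρ hρ using hρ
  refine ⟨?_, ?_⟩
  · have h1 := finrank_MS (x '' Set.univ)
    rw [Set.image_univ] at h1 hrig
    rw [finrank_span_eq_card hLI, hrig, hX, hcV] at h1
    have h2 : ((Fintype.card E + (D + R.card) : ℕ) : ℤ) = ((D * (B.card + R.card) : ℕ) : ℤ) := by rw [h1]
    push_cast at h2
    linarith
  · intro F hF
    have h1 := finrank_MS (x '' (F : Set E))
    have h2 : finrank ℝ (span ℝ (x '' (F : Set E))) = F.card := by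
      have h3 := finrank_span_eq_card (hLI.comp (fun e : F => (e : E)) Subtype.val_injective)
      have h3' : Set.range (x ∘ fun e : F => (e : E)) = x '' (F : Set E) := by
        ext y; simp
      rw [h3', Fintype.card_coe] at h3
      exact h3
    have h4 := MS_lower ψ vol ends hloop R ρ
      (by
        intro v hv h
        apply h0 v hv
        rw [← hρ v hv, h, map_zero])
      (by
        intro u hu v hv huv
        rw [disjoint_def]
        intro y hy1 hy2
        obtain ⟨s, rfl⟩ := mem_span_singleton.1 hy1
        obtain ⟨t, ht⟩ := mem_span_singleton.1 hy2
        by_contra hne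
        have hs : s ≠ 0 := by rintro rfl; simp at hne
        apply hNP u hu v hv huv (s⁻¹ * t)
        rw [← hρ u hu, ← hρ v hv, ← map_smul, mul_smul, ht, smul_smul, inv_mul_cancel₀ hs, one_smul])
      (fun e => ι ℝ (a e) * ι ℝ (b e))
      (by
        intro e w hw hwe
        rw [hρ w hw]
        exact hq e w hw hwe) F hF
    rw [h2, hX] at h1
    have h5 : (VF ends F).card = (VF ends F ∩ B).card + (VF ends F ∩ R).card := by
      rw [← Finset.card_union_of_disjoint (hdisj.mono Finset.inter_subset_right Finset.inter_subset_right),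
        ← Finset.inter_union_distrib_left, hcov, Finset.inter_univ]
    have h6 : (VF ends F).card ≤ Fintype.card V := Finset.card_le_univ _
    obtain ⟨c, hc⟩ := Nat.exists_eq_add_of_le h6
    rw [hc, Nat.add_sub_cancel_left] at h4
    rw [hc] at h1
    have h7 : ((F.card + (D + (VF ends F ∩ R).card + D * c) : ℕ) : ℤ) ≤ ((D * ((VF ends F).card + c) : ℕ) : ℤ) := by
      rw [← h1]
      exact_mod_cast Nat.add_le_add_left h4 _
    rw [h5] at h7
    push_cast at h7
    linarith

end glue
end BRB

set_option synthInstance.maxHeartbeats 1000000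
set_option maxHeartbeats 1000000
open ExteriorAlgebra
namespace BRB
open Module Submodule

section glue2
variable {V E : Type} [Fintype V] [Fintype E] [DecidableEq V] [DecidableEq E]

def inlE (V : Type) : V ↪ V ⊕ Bool := ⟨Sum.inl, Sum.inl_injective⟩

def liftEnds (ends : E → V × V) (e : E) : (V ⊕ Bool) × (V ⊕ Bool) := (Sum.inl (ends e).1, Sum.inl (ends e).2)

theorem lift_Sp (D : ℕ) (hD : 3 < D) (ends : E → V × V) (hloop : ∀ e : E, (ends e).1 ≠ (ends e).2)
    (B R : Finset V) (hdisj : Disjoint B R) (hcov : B ∪ R = Finset.univ)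
    (h : ∀ F : Finset E, F.Nonempty →
        (F.card : ℤ) ≤ D * ((VF ends F) ∩ B).card + ((D : ℤ) - 1) * ((VF ends F) ∩ R).card - D) :
    Sp D (R.map (inlE V)) (liftEnds ends) := by
  refine ⟨fun e h => hloop e (Sum.inl_injective h), ?_⟩
  intro X hX
  rw [fX]
  by_cases hF : (ins (liftEnds ends) X).Nonempty
  · have h1 := h _ hF
    set F := ins (liftEnds ends) X with hFd
    have h2 : ∑ v ∈ (VF ends F).map (inlE V), cc D (R.map (inlE V)) v =
        D * ((VF ends F) ∩ B).card + ((D : ℤ) - 1) * ((VF ends F) ∩ R).card := by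
      rw [Finset.sum_map]
      have h3 : ∀ v, cc D (R.map (inlE V)) (inlE V v) = cc D R v := by
        intro v; simp [cc, inlE]
      simp only [h3]
      have h4 : VF ends F = (VF ends F ∩ B) ∪ (VF ends F ∩ R) := by
        rw [← Finset.inter_union_distrib_left, hcov, Finset.inter_univ]
      conv_lhs => rw [h4]
      rw [Finset.sum_union (hdisj.mono Finset.inter_subset_right Finset.inter_subset_right)]
      rw [Finset.sum_congr rfl (g := fun _ => (D : ℤ)) (s₁ := VF ends F ∩ B), Finset.sum_congr rfl
        (g := fun _ => (D : ℤ) - 1) (s₁ := VF ends F ∩ R), Finset.sum_const, Finset.sum_const,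
        nsmul_eq_mul, nsmul_eq_mul]
      · ring
      · intro v hv; simp [cc, (Finset.mem_inter.1 hv).2]
      · intro v hv
        have : v ∉ R := Finset.disjoint_left.1 hdisj (Finset.mem_inter.1 hv).2
        simp [cc, this]
    have h5 : (VF ends F).map (inlE V) ⊆ X := by
      intro y hy
      obtain ⟨v, hv, rfl⟩ := Finset.mem_map.1 hy
      obtain ⟨e, he, hve⟩ := mem_VF.1 hv
      have := mem_ins.1 he
      rcases hve with rfl | rfl
      · exact this.1
      · exact this.2
    have h6 := Finset.sum_le_sum_of_subset_of_nonneg h5 (f := cc D (R.map (inlE V))) (by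
      intro i _ _
      have := cc_ge D (R.map (inlE V)) i
      omega)
    rw [h2] at h6
    linarith
  · rw [Finset.not_nonempty_iff_eq_empty] at hF
    rw [hF]
    have := sum_cc_ge D (R.map (inlE V)) X
    have h2 : (2 : ℤ) ≤ X.card := by exact_mod_cast hX
    have h3 : (3 : ℤ) < D := by exact_mod_cast hD
    simp only [Finset.card_empty, Nat.cast_zero]
    nlinarith

theorem lift_Mot {F : Type} {K : Type} [AddCommGroup K] [Module ℝ K] [FiniteDimensional ℝ K]
    (ends : F → V × V) (r : V ⊕ Bool → K) :
    finrank ℝ (Mot (fun v => r (Sum.inl v)) ends) + finrank ℝ K * 2 ≤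
      finrank ℝ (Mot r (fun e => ((Sum.inl (ends e).1 : V ⊕ Bool), (Sum.inl (ends e).2 : V ⊕ Bool)))) := by
  let f : (Mot (fun v => r (Sum.inl v)) ends × (Bool → K)) →ₗ[ℝ] (V ⊕ Bool → K) :=
    { toFun := fun z => Sum.elim z.1.1 z.2
      map_add' := by
        intro x y; funext v; rcases v with v | v <;> rfl
      map_smul' := by
        intro c y; funext v; rcases v with v | v <;> rfl }
  have hinj : Function.Injective f := by
    rintro ⟨⟨m, hm⟩, y⟩ ⟨⟨m', hm'⟩, y'⟩ h
    have h1 : m = m' := by funext v; exact congrFun h (Sum.inl v)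
    have h2 : y = y' := by funext v; exact congrFun h (Sum.inr v)
    subst h1; subst h2; rfl
  have hle : LinearMap.range f ≤ Mot r (fun e => ((Sum.inl (ends e).1 : V ⊕ Bool), (Sum.inl (ends e).2 : V ⊕ Bool))) := by
    rintro _ ⟨⟨⟨m, hm⟩, y⟩, rfl⟩
    rw [mem_Mot] at hm ⊢
    intro e
    exact hm e
  have := finrank_mono hle
  rwa [LinearMap.finrank_range_of_inj hinj, finrank_prod, finrank_fun, Fintype.card_bool] at this

variable {n : ℕ} {K : Type} [NormedAddCommGroup K] [NormedSpace ℝ K] [FiniteDimensional ℝ K]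

theorem dir2 (hn : 2 ≤ n) (hD : 3 < finrank ℝ K)
    {vol : ExtAlg (n+1) →ₗ[ℝ] ℝ} (hvol : ∀ x ∈ extGrade (n+1) (n + 2), vol x = 0 → x = 0)
    {ψ : K →ₗ[ℝ] ExtAlg (n + 1)} (hinj : Function.Injective ψ)
    (hr : LinearMap.range ψ = extGrade (n + 1) n)
    (γ : MultilinearMap ℝ (fun _ : Fin n => Wd (n + 1)) K) (hγ : ∀ θ, ψ (γ θ) = ιMulti ℝ n θ)
    (ends : E → V × V) (hloop : ∀ e : E, (ends e).1 ≠ (ends e).2)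
    (B R : Finset V) (hdisj : Disjoint B R) (hcov : B ∪ R = Finset.univ)
    (hcount : (Fintype.card E : ℤ) = finrank ℝ K * B.card + ((finrank ℝ K : ℤ) - 1) * R.card - finrank ℝ K)
    (h : ∀ F : Finset E, F.Nonempty →
        (F.card : ℤ) ≤ finrank ℝ K * ((VF ends F) ∩ B).card
          + ((finrank ℝ K : ℤ) - 1) * ((VF ends F) ∩ R).card - finrank ℝ K) :
    (∃ (r : V → ExtAlg (n+1)) (a b : E → Wd (n+1)),
      (∀ v ∈ R, r v ≠ 0) ∧
      (∀ v ∈ R, IsDecomp (n+1) n (r v)) ∧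
      (∀ u ∈ R, ∀ v ∈ R, u ≠ v → ∀ c : ℝ, r u ≠ c • r v) ∧
      (∀ e : E, ι ℝ (a e) * ι ℝ (b e) ≠ 0) ∧
      (∀ e : E, ∀ w ∈ R, (w = (ends e).1 ∨ w = (ends e).2) →
        (ι ℝ (a e) * ι ℝ (b e)) * r w = 0) ∧
      Module.finrank ℝ
        ↥(motionSpace (n+1) ends (fun e => ι ℝ (a e) * ι ℝ (b e)) Set.univ) = finrank ℝ K + R.card ∧
      (∀ e₀ : E, finrank ℝ K + R.card + 1 ≤
        Module.finrank ℝ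
          ↥(motionSpace (n+1) ends (fun e => ι ℝ (a e) * ι ℝ (b e)) {e : E | e ≠ e₀}))) := by
  set D := finrank ℝ K with hDd
  have hSp := lift_Sp D hD ends hloop B R hdisj hcov h
  have hgen := gen_model hn (by omega) ψ hinj hr γ hγ
  obtain ⟨θ, hNP, hNZ, hG⟩ := exists_good hgen hD (R.map (inlE V)) (Sum.inr true) (Sum.inr false)
    (by simp) (by simp [inlE]) (by simp [inlE])
  set r' := rr (fun θ => γ θ) (R.map (inlE V)) θ with hr'
  set ρ : V → K := fun v => r' (Sum.inl v) with hρ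
  have hmemR : ∀ v, v ∈ R → (Sum.inl v : V ⊕ Bool) ∈ R.map (inlE V) := by
    intro v hv; simpa [inlE] using hv
  have hρR : ∀ v ∈ R, ρ v = γ (θ (Sum.inl v)) := fun v hv => rr_mem _ θ (hmemR v hv)
  have hρB : ∀ v, v ∉ R → ρ v = 0 := fun v hv => rr_not _ θ (by simpa [inlE] using hv)
  have hρ0 : ∀ v ∈ R, ρ v ≠ 0 := by
    intro v hv
    rw [hρR v hv]
    exact hNZ _ (hmemR v hv)
  have hψmem : ∀ k, ψ k ∈ extGrade (n+1) n := by
    intro k; rw [← hr]; exact ⟨k, rfl⟩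
  -- motions bound
  have hMot : ∀ F : Finset E, finrank ℝ (Mot ρ (fun e : F => ends e)) + F.card ≤ D * Fintype.card V := by
    intro F
    have h1 := hG F (fun e : F => liftEnds ends e) (hSp.comp _ Subtype.val_injective) (by simp)
    have h2 := lift_Mot (fun e : F => ends e) r'
    rw [Fintype.card_coe, Fintype.card_sum, Fintype.card_bool, mul_add] at h1
    have h1' : finrank ℝ (Mot r' (fun e : F => ((Sum.inl (ends e).1 : V ⊕ Bool), (Sum.inl (ends e).2 : V ⊕ Bool)))) + F.card ≤ D * Fintype.card V + D * 2 := h1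
    have h2' : finrank ℝ (Mot ρ (fun e : F => ends e)) + D * 2 ≤ finrank ℝ (Mot r' (fun e : F => ((Sum.inl (ends e).1 : V ⊕ Bool), (Sum.inl (ends e).2 : V ⊕ Bool)))) := h2
    clear_value D
    clear h1 h2 hcount h
    omega
  have hX : finrank ℝ (V → K) = D * Fintype.card V := finrank_fun
  have hcV : Fintype.card V = B.card + R.card := by
    rw [← Finset.card_univ, ← hcov, Finset.card_union_of_disjoint hdisj]
  let S : E → Set (Dual ℝ (V → K)) := fun e => {φ | ∃ a b : Wd (n+1),
    (∀ w ∈ R, (w = (ends e).1 ∨ w = (ends e).2) → (ι ℝ a * ι ℝ b) * ψ (ρ w) = 0) ∧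
    φ = bar vol ψ (ends e) (ι ℝ a * ι ℝ b)}
  have F2' : ∀ u ∈ R, ∀ (y k : K), (∀ a b : Wd (n+1), ι ℝ a * (ι ℝ b * ψ (ρ u)) = 0 → ι ℝ a * (ι ℝ b * ψ y) = 0 →
      ι ℝ a * (ι ℝ b * ψ k) = 0) → k ∈ span ℝ {ρ u, y} := by
    intro u hu y k hk
    have h1 : ψ (ρ u) = ιMulti ℝ n (θ (Sum.inl u)) := by rw [hρR u hu, hγ]
    rw [h1] at hk
    have h2 := F2 (θ (Sum.inl u)) (by
      rw [← h1]
      intro h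
      exact hρ0 u hu (hinj (h.trans (map_zero ψ).symm))) (ψ y) (ψ k) (hψmem y) (hψmem k) hk
    rw [← h1, mem_span_pair] at h2
    obtain ⟨s, t, hst⟩ := h2
    rw [mem_span_pair]
    refine ⟨s, t, hinj ?_⟩
    rw [map_add, map_smul, map_smul, hst]
  have hsub : ∀ F : Finset E, MS (⋃ e ∈ F, S e) ≤ Mot ρ (fun e : F => ends e) := by
    intro F m hm
    rw [mem_MS] at hm
    rw [mem_Mot]
    rintro ⟨e, he⟩
    simp only []
    have key : ∀ a b : Wd (n+1),
        (∀ w ∈ R, (w = (ends e).1 ∨ w = (ends e).2) → (ι ℝ a * ι ℝ b) * ψ (ρ w) = 0) →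
        ι ℝ a * (ι ℝ b * ψ (m (ends e).1 - m (ends e).2)) = 0 := by
      intro a b hab
      rw [← mul_assoc]
      apply (bar_zero hvol hr (ends e) a b m).1
      apply hm
      simp only [Set.mem_iUnion]
      exact ⟨e, he, a, b, hab, rfl⟩
    by_cases hp : (ends e).1 ∈ R
    · apply F2' _ hp
      intro a b h1 h2
      apply key
      rintro w hw (rfl | rfl)
      · rw [mul_assoc]; exact h1
      · rw [mul_assoc]; exact h2
    · by_cases hq : (ends e).2 ∈ R
      · rw [Set.pair_comm]
        apply F2' _ hq
        intro a b h1 h2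
        apply key
        rintro w hw (rfl | rfl)
        · exact absurd hw hp
        · rw [mul_assoc]; exact h1
      · have : ψ (m (ends e).1 - m (ends e).2) = 0 := by
          apply nondeg2 (by omega) (hψmem _)
          intro a b
          apply key
          rintro w hw (rfl | rfl)
          · exact absurd hw hp
          · exact absurd hw hq
        rw [hinj (this.trans (map_zero ψ).symm)]
        exact zero_mem _
  obtain ⟨x, hxS, hxr⟩ := rado S _ (Finset.univ : Finset E) rfl ⊥ (by
    intro F _
    have h1 := finrank_MS (⋃ e ∈ F, S e)
    have h2 := finrank_mono (hsub F)
    have h3 := hMot F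
    rw [bot_sup_eq, finrank_bot]
    omega)
  rw [bot_sup_eq, finrank_bot, zero_add, Finset.card_univ, Finset.coe_univ] at hxr
  have hxS' : ∀ e, ∃ a b : Wd (n+1),
    (∀ w ∈ R, (w = (ends e).1 ∨ w = (ends e).2) → (ι ℝ a * ι ℝ b) * ψ (ρ w) = 0) ∧
    x e = bar vol ψ (ends e) (ι ℝ a * ι ℝ b) := fun e => hxS e (Finset.mem_univ e)
  choose a b hab hxab using hxS'
  have hxx : (fun e => bar vol ψ (ends e) (ι ℝ (a e) * ι ℝ (b e))) = x := by
    funext e; rw [hxab]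
  have hle : finrank ℝ (span ℝ (x '' Set.univ)) ≤ Fintype.card E := by
    rw [Set.image_univ]; exact finrank_range_le_card x
  have hle1 : ∀ e0, finrank ℝ (span ℝ (x '' {e | e ≠ e0})) + 1 ≤ Fintype.card E := by
    intro e0
    have h1 : x '' {e | e ≠ e0} = Set.range (fun e : {e // e ≠ e0} => x e) := by
      ext y; simp
    have h2 := finrank_range_le_card (R := ℝ) (fun e : {e // e ≠ e0} => x e)
    rw [← h1] at h2
    have h3 : Fintype.card {e // e ≠ e0} = Fintype.card E - 1 := by
      rw [Fintype.card_subtype_compl, Fintype.card_subtype_eq]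
    have h4 : 0 < Fintype.card E := Fintype.card_pos_iff.2 ⟨e0⟩
    rw [h3] at h2
    change finrank ℝ (span ℝ _) ≤ _ at h2
    omega
  have hcN : Fintype.card E + (D + R.card) = D * Fintype.card V := by
    rw [hcV]
    zify
    rw [hcount]
    ring
  refine ⟨fun v => ψ (ρ v), a, b, ?_, ?_, ?_, ?_, ?_, ?_, ?_⟩
  · intro v hv h
    exact hρ0 v hv (hinj (h.trans (map_zero ψ).symm))
  · intro v hv
    refine ⟨θ (Sum.inl v), ?_⟩
    rw [← ιMulti_apply, ← hγ]
    exact congrArg ψ (hρR v hv)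
  · intro u hu v hv huv c hc
    have h1 := hNP (Sum.inl u) (Sum.inl v) (hmemR u hu) (hmemR v hv) (fun h => huv (Sum.inl_injective h))
    rw [← map_smul] at hc
    have h2 := hinj hc
    rw [hρR u hu, hρR v hv] at h2
    have := LinearIndependent.pair_iff.1 h1 1 (-c) (by
      change (1:ℝ) • γ (θ (Sum.inl u)) + -c • γ (θ (Sum.inl v)) = 0
      rw [one_smul, h2, neg_smul, add_neg_cancel])
    exact one_ne_zero this.1
  · intro e h0
    have hx0 : x e = 0 := by
      rw [hxab, h0]
      apply LinearMap.ext
      intro m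
      rw [bar_apply, zero_mul, map_zero]
      rfl
    have h1 : span ℝ (x '' Set.univ) ≤ span ℝ (x '' {e' | e' ≠ e}) := by
      rw [span_le]
      rintro _ ⟨e', _, rfl⟩
      by_cases hee : e' = e
      · rw [hee, hx0]; exact zero_mem _
      · exact subset_span ⟨e', hee, rfl⟩
    have h2 := finrank_mono h1
    have h3 := hle1 e
    omega
  · exact hab
  · rw [finrank_motion hvol hinj hr, hxx]
    have := finrank_MS (x '' Set.univ)
    omega
  · intro e0
    rw [finrank_motion hvol hinj hr, hxx]
    have := finrank_MS (x '' {e | e ≠ e0})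
    have := hle1 e0
    omega

end glue2
end BRB
open BRB
theorem statement_3
    (d : ℕ) (hd : 3 ≤ d) (D : ℕ) (hD : D = (d + 1).choose 2)
    (V E : Type) [Fintype V] [Fintype E] [DecidableEq V] [DecidableEq E]
    (ends : E → V × V) (hloop : ∀ e : E, (ends e).1 ≠ (ends e).2)
    (B R : Finset V) (hdisj : Disjoint B R) (hcov : B ∪ R = Finset.univ) :
    (∃ (r : V → ExtAlg d) (a b : E → Wd d),
      (∀ v ∈ R, r v ≠ 0) ∧
      (∀ v ∈ R, IsDecomp d (d - 1) (r v)) ∧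
      (∀ u ∈ R, ∀ v ∈ R, u ≠ v → ∀ c : ℝ, r u ≠ c • r v) ∧
      (∀ e : E, ι ℝ (a e) * ι ℝ (b e) ≠ 0) ∧
      (∀ e : E, ∀ w ∈ R, (w = (ends e).1 ∨ w = (ends e).2) →
        (ι ℝ (a e) * ι ℝ (b e)) * r w = 0) ∧
      Module.finrank ℝ
        ↥(motionSpace d ends (fun e => ι ℝ (a e) * ι ℝ (b e)) Set.univ) = D + R.card ∧
      (∀ e₀ : E, D + R.card + 1 ≤
        Module.finrank ℝ
          ↥(motionSpace d ends (fun e => ι ℝ (a e) * ι ℝ (b e)) {e : E | e ≠ e₀})))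
    ↔
    ((Fintype.card E : ℤ) = D * B.card + ((D : ℤ) - 1) * R.card - D ∧
      ∀ F : Finset E, F.Nonempty →
        (F.card : ℤ) ≤ D * ((VF ends F) ∩ B).card + ((D : ℤ) - 1) * ((VF ends F) ∩ R).card - D) := by
  obtain ⟨n, rfl⟩ : ∃ n, d = n + 1 := ⟨d - 1, by omega⟩
  have hn : 2 ≤ n := by omega
  obtain ⟨ψ, γ, hinj, hr, hγ⟩ := exists_model n
  obtain ⟨vol, hvol⟩ := exists_vol (n + 1)
  have hK : Module.finrank ℝ (Fin ((n + 2).choose 2) → ℝ) = D := by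
    rw [Module.finrank_fin_fun, hD]
  have hD3 : 3 < Module.finrank ℝ (Fin ((n + 2).choose 2) → ℝ) := by
    rw [Module.finrank_fin_fun]
    have h1 : (4).choose 2 ≤ (n + 2).choose 2 := Nat.choose_le_choose 2 (by omega)
    have h2 : (4).choose 2 = 6 := by decide
    omega
  rw [← hK]
  constructor
  · rintro ⟨r, a, b, h0, hdec, hNP, -, hq, hrig, hmin⟩
    exact dir1 hn hD3 hvol hinj hr ends hloop B R hdisj hcov r a b h0 hdec hNP hq hrig hmin
  · rintro ⟨h1, h2⟩
    exact dir2 hn hD3 hvol hinj hr γ hγ ends hloop B R hdisj hcov h1 h2
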